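/- Entanglement testing, i.i.d. alternative. Let ℋ_{AB} = ℋ_A ⊗ ℋ_B be a finite-dimensional bipartite Hilbert space and 𝒻₁ ⊆ 𝒟(ℋ_{AB}) a non-empty closed set of states. Then the Stein exponent of the hypothesis testing task with null hypothesis the sequence 𝒮 of separable states and alternative hypothesis 𝒻₁^{iid} satisfies Stein(𝒮‖𝒻₁^{iid}) = min*_{μ∈𝒫(𝒻₁)} lim_{n→∞} (1/n) inf_{σ∈𝒮_{A^n:B^n}} D(σ ‖ ∫_{𝒻₁} dμ(ρ) ρ^{⊗n}), where the minimum is restricted to those μ for which the inner limit in n exists (a non-empty set on which the minimum is attained). -/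

import Mathlib

open Filter MeasureTheory Topology
open scoped BigOperators Classical ComplexOrder

noncomputable section

namespace QSanov

/-- Matrices representing operators on the single-copy Hilbert space with orthonormal
basis indexed by `ι`. -/
abbrev MatC (ι : Type*) := Matrix ι ι ℂ

/-- Matrices representing operators on the `n`-fold tensor power Hilbert space. -/
abbrev MatN (ι : Type*) (n : ℕ) := Matrix (Fin n → ι) (Fin n → ι) ℂ

instance matMeasurableSpace (m n : Type*) : MeasurableSpace (Matrix m n ℂ) :=
  inferInstanceAs (MeasurableSpace (m → n → ℂ))

/-- A quantum state: a positive semidefinite matrix of trace one. -/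
def IsState {κ : Type*} [Fintype κ] (ρ : Matrix κ κ ℂ) : Prop :=
  ρ.PosSemidef ∧ ρ.trace = 1

/-- Loewner order: `A ≤ B` iff `B - A` is positive semidefinite. -/
def loewnerLE {κ : Type*} [Fintype κ] (A B : Matrix κ κ ℂ) : Prop :=
  (B - A).PosSemidef

/-- The `n`-fold tensor power `ρ^{⊗n}` of a single-copy matrix. -/
def tensorPow {ι : Type*} (ρ : MatC ι) (n : ℕ) : MatN ι n :=
  fun i j => ∏ k, ρ (i k) (j k)

/-- The tensor product `ρ₁ ⊗ ⋯ ⊗ ρ_n` of a family of single-copy matrices. -/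
def tensorProdFam {ι : Type*} {n : ℕ} (ρ : Fin n → MatC ι) : MatN ι n :=
  fun i j => ∏ k, ρ k (i k) (j k)

/-- The tensor product of an `n`-copy matrix and an `m`-copy matrix. -/
def tensorMul {ι : Type*} {n m : ℕ} (ρ : MatN ι n) (σ : MatN ι m) : MatN ι (n + m) :=
  fun i j => ρ (fun t => i (Fin.castAdd m t)) (fun t => j (Fin.castAdd m t)) *
    σ (fun t => i (Fin.natAdd n t)) (fun t => j (Fin.natAdd n t))

/-- Conjugation `U_π ρ U_π†` by the unitary permuting the `n` tensor factors. -/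
def permCopies {ι : Type*} {n : ℕ} (π : Equiv.Perm (Fin n)) (ρ : MatN ι n) : MatN ι n :=
  fun i j => ρ (i ∘ π) (j ∘ π)

/-- Matrix logarithm via functional calculus on the support (eigenvalue `0` is sent
to `0`, since `Real.log 0 = 0`). -/
def matLog {κ : Type*} [Fintype κ] [DecidableEq κ] (A : Matrix κ κ ℂ) : Matrix κ κ ℂ :=
  if hA : A.IsHermitian then
    (hA.eigenvectorUnitary : Matrix κ κ ℂ) *
      (Matrix.diagonal fun i => (Real.log (hA.eigenvalues i) : ℂ)) *
      (star (hA.eigenvectorUnitary : Matrix κ κ ℂ))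
  else 0

/-- Support inclusion `supp ρ ⊆ supp σ`, phrased as inclusion of ranges. -/
def suppLE {κ : Type*} [Fintype κ] [DecidableEq κ] (ρ σ : Matrix κ κ ℂ) : Prop :=
  LinearMap.range (Matrix.toLin' ρ) ≤ LinearMap.range (Matrix.toLin' σ)

/-- Umegaki relative entropy `D(ρ‖σ) = Tr[ρ (log ρ - log σ)]`, equal to `+∞` when
`supp ρ ⊄ supp σ`. -/
def relEnt {κ : Type*} [Fintype κ] [DecidableEq κ] (ρ σ : Matrix κ κ ℂ) : EReal :=
  if suppLE ρ σ then (((ρ * (matLog ρ - matLog σ)).trace.re : ℝ) : EReal) else ⊤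

/-- Relative entropy between two sets of states: `D(𝒜‖ℬ) = inf_{ρ∈𝒜, σ∈ℬ} D(ρ‖σ)`. -/
def relEntSet {κ : Type*} [Fintype κ] [DecidableEq κ] (A B : Set (Matrix κ κ ℂ)) : EReal :=
  ⨅ ρ ∈ A, ⨅ σ ∈ B, relEnt ρ σ

/-- The composite i.i.d. hypothesis `𝒻₁^{⊗n, iid}` built on the base set `F1`. -/
def iidSet {ι : Type*} (F1 : Set (MatC ι)) (n : ℕ) : Set (MatN ι n) :=
  {ρ | ∃ σ ∈ F1, ρ = tensorPow σ n}

/-- The arbitrarily varying hypothesis `𝒻₁^{⊗n, av}` built on the base set `F1`. -/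
def avSet {ι : Type*} (F1 : Set (MatC ι)) (n : ℕ) : Set (MatN ι n) :=
  {ρ | ∃ f : Fin n → MatC ι, (∀ p, f p ∈ F1) ∧ ρ = tensorProdFam f}

/-- Worst-case type II error probability `β_ε(A‖B)` for a threshold `ε` on the
worst-case type I error probability. -/
def typeII {κ : Type*} [Fintype κ] [DecidableEq κ] (A B : Set (Matrix κ κ ℂ)) (ε : ℝ) : ℝ :=
  sInf {b : ℝ | ∃ E : Matrix κ κ ℂ, E.PosSemidef ∧ (1 - E).PosSemidef ∧
    (∀ ρ ∈ A, (ρ * (1 - E)).trace.re ≤ ε) ∧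
    b = sSup {x : ℝ | ∃ σ ∈ B, x = (σ * E).trace.re}}

/-- `- log x`, with value `+∞` for `x ≤ 0`. -/
def negLog (x : ℝ) : EReal := if x ≤ 0 then ⊤ else ((-Real.log x : ℝ) : EReal)

/-- `(1/n : EReal)`. -/
def cFrac (n : ℕ) : EReal := (((n : ℝ)⁻¹ : ℝ) : EReal)

/-- The Stein exponent `Stein(𝒜‖ℬ) = lim_{ε→0⁺} liminf_n -(1/n) log β_ε(𝒜_n‖ℬ_n)`;
since the inner quantity is monotone nondecreasing in `ε`, the limit as `ε → 0⁺`
coincides with the infimum over `ε ∈ (0,1)`. -/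
def steinExponent {ι : Type*} [Fintype ι] [DecidableEq ι]
    (A B : ∀ n : ℕ, Set (MatN ι n)) : EReal :=
  ⨅ ε ∈ Set.Ioo (0 : ℝ) 1,
    Filter.liminf (fun n : ℕ => cFrac n * negLog (typeII (A n) (B n) ε)) Filter.atTop

/-- The mixture `∫ dμ(σ) σ^{⊗n}` of i.i.d. states along a measure `μ` on a set of
states `C` (Bochner integral, computed entrywise). -/
def iidMix {ι : Type*} {C : Set (MatC ι)} (μ : Measure ↥C) (n : ℕ) : MatN ι n :=
  fun i j => ∫ σ, (∏ k, (σ : MatC ι) (i k) (j k)) ∂μ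

/-- The `b`-th block of size `k` of an index of `ℋ^{⊗ mk}`. -/
def blockOf {ι : Type*} {m k : ℕ} (i : Fin (m * k) → ι) (b : Fin m) : Fin k → ι :=
  fun t => i (finProdFinEquiv (b, t))

/-- Replace the blocks in `S` of the index `i` by the values prescribed by `c`. -/
def mergeBlocks {ι : Type*} {m k : ℕ} (S : Finset (Fin m)) (c : Fin m → Fin k → ι)
    (i : Fin (m * k) → ι) : Fin (m * k) → ι :=
  fun p => if (finProdFinEquiv.symm p).1 ∈ S
    then c (finProdFinEquiv.symm p).1 (finProdFinEquiv.symm p).2 else i p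

/-- Entry `(i,j)` of the partial trace of `ρ` over the blocks in `S`
(the remaining blocks being evaluated at `i`, `j`). -/
def blockPartialTrace {ι : Type*} [Fintype ι] {m k : ℕ} (S : Finset (Fin m))
    (ρ : MatN ι (m * k)) (i j : Fin (m * k) → ι) : ℂ :=
  (((Fintype.card ι : ℂ) ^ (k * (m - S.card)))⁻¹) *
    ∑ c : Fin m → Fin k → ι, ρ (mergeBlocks S c i) (mergeBlocks S c j)

/-- The `m`-fold tensor power `(𝒩^δ_ω)^{⊗ m}` of the depolarising channel
`𝒩^δ_ω(X) = (1-δ) X + δ Tr[X] ω`, acting blockwise on blocks of `k` tensor factors. -/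
def blockDepolarize {ι : Type*} [Fintype ι] (δ : ℝ) {k : ℕ} (ω : MatN ι k) (m : ℕ)
    (ρ : MatN ι (m * k)) : MatN ι (m * k) :=
  fun i j => ∑ S : Finset (Fin m),
    (((1 - δ) ^ (m - S.card) * δ ^ S.card : ℝ) : ℂ) *
      ((∏ b ∈ S, ω (blockOf i b) (blockOf j b)) * blockPartialTrace S ρ i j)

/-- The `m`-fold tensor power of a `k`-copy matrix, as an `mk`-copy matrix. -/
def powBlocks {ι : Type*} {k : ℕ} (ρ : MatN ι k) (m : ℕ) : MatN ι (m * k) :=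
  fun i j => ∏ b : Fin m, ρ (blockOf i b) (blockOf j b)

/-- `Tr_{n+1,…,n+k}[ρ (𝟙^{⊗n} ⊗ F)]`, the filtered reduction of an `(n+k)`-copy matrix. -/
def condReduce {ι : Type*} [Fintype ι] {n k : ℕ} (ρ : MatN ι (n + k)) (F : MatN ι k) :
    MatN ι n :=
  fun i j => ∑ a : Fin k → ι, ∑ b : Fin k → ι,
    ρ (Fin.append i a) (Fin.append j b) * F b a

/-- Partial trace over the `k`-th tensor factor. -/
def traceOutAt {ι : Type*} [Fintype ι] {n : ℕ} (k : Fin (n + 1)) (σ : MatN ι (n + 1)) :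
    MatN ι n :=
  fun i j => ∑ a : ι, σ (k.insertNth a i) (k.insertNth a j)

/-- Insert the single-copy state `τ` at position `k` into an `n`-copy matrix. -/
def insertState {ι : Type*} {n : ℕ} (k : Fin (n + 1)) (τ : MatC ι) (σ : MatN ι n) :
    MatN ι (n + 1) :=
  fun i j => τ (i k) (j k) *
    σ (fun t => i (k.succAbove t)) (fun t => j (k.succAbove t))

/-- Product of a state on `A^n` and a state on `B^n`, viewed as a state on
`(ℋ_A ⊗ ℋ_B)^{⊗ n}` (reordering tensor factors implicitly). -/
def prodStateAB {ιA ιB : Type*} {n : ℕ} (α : Matrix (Fin n → ιA) (Fin n → ιA) ℂ)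
    (β : Matrix (Fin n → ιB) (Fin n → ιB) ℂ) : MatN (ιA × ιB) n :=
  fun i j => α (fun k => (i k).1) (fun k => (j k).1) * β (fun k => (i k).2) (fun k => (j k).2)


/-- The set `𝒮_{A^n:B^n}` of separable states across the cut `A^n : B^n`. -/
def sepSet (ιA ιB : Type*) [Fintype ιA] [Fintype ιB] (n : ℕ) : Set (MatN (ιA × ιB) n) :=
  convexHull ℝ {ρ | ∃ α β, IsState α ∧ IsState β ∧ ρ = prodStateAB α β}

/-- Classical relative entropy of two finitely supported output distributions. -/
def clRelEnt {m : ℕ} (P Q : Fin m → ℝ) : EReal :=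
  ∑ x, (if P x = 0 then (0 : EReal) else if Q x = 0 then (⊤ : EReal)
    else ((P x * Real.log (P x / Q x) : ℝ) : EReal))

/-- Measured relative entropy: supremum over all finite POVMs of the classical
relative entropy of the induced outcome distributions. -/
def measuredRelEnt {κ : Type*} [Fintype κ] [DecidableEq κ] (ρ σ : Matrix κ κ ℂ) : EReal :=
  ⨆ (m : ℕ) (E : Fin m → Matrix κ κ ℂ) (_ : ∀ x, (E x).PosSemidef) (_ : ∑ x, E x = 1),
    clRelEnt (fun x => (ρ * E x).trace.re) (fun x => (σ * E x).trace.re)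


/-- Axiom Q.I: there is a full-support free state `τ ∈ 𝒜₁` such that every `𝒜_{mk}`
is stable under blockwise depolarising towards `τ^{⊗k}`. -/
def AxiomQI {ι : Type*} [Fintype ι] [DecidableEq ι] (A : ∀ n : ℕ, Set (MatN ι n)) : Prop :=
  ∃ τ : MatC ι, tensorPow τ 1 ∈ A 1 ∧
    ∀ m k : ℕ, 1 ≤ m → 1 ≤ k → ∀ ρ ∈ A (m * k),
      suppLE ρ (tensorPow τ (m * k)) ∧
      ∀ δ ∈ Set.Icc (0 : ℝ) 1, blockDepolarize δ (tensorPow τ k) m ρ ∈ A (m * k)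

/-- Axiom Q.II: closedness under tensor powers. -/
def AxiomQII {ι : Type*} (A : ∀ n : ℕ, Set (MatN ι n)) : Prop :=
  ∀ m k : ℕ, 1 ≤ m → 1 ≤ k → ∀ ρ ∈ A k, powBlocks ρ m ∈ A (m * k)

/-- Axiom Q.III: closedness under permutations of the tensor factors. -/
def AxiomQIII {ι : Type*} (A : ∀ n : ℕ, Set (MatN ι n)) : Prop :=
  ∀ n : ℕ, ∀ ρ ∈ A n, ∀ π : Equiv.Perm (Fin n), permCopies π ρ ∈ A n

/-- Axiom Q.IV: filtering by Hermitian operators in a neighbourhood of the identity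
is completely `cone(𝒜)`-preserving. -/
def AxiomQIV {ι : Type*} [Fintype ι] [DecidableEq ι] (A : ∀ n : ℕ, Set (MatN ι n)) : Prop :=
  ∀ k : ℕ, 1 ≤ k →
    ∃ V : Set (MatN ι k), V ∈ nhds (1 : MatN ι k) ∧
      ∀ F ∈ V, F.IsHermitian → ∀ n : ℕ, 1 ≤ n → ∀ ρ ∈ A (n + k),
        ∃ (lam : ℝ) (ω : MatN ι n), 0 ≤ lam ∧ ω ∈ A n ∧ condReduce ρ F = (lam : ℂ) • ω


section Spectral

variable {κ : Type*} [Fintype κ] [DecidableEq κ]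

/-- The matrix `U diag(f) U†`. -/
def specM (U : Matrix κ κ ℂ) (f : κ → ℝ) : Matrix κ κ ℂ :=
  U * Matrix.diagonal (fun i => (f i : ℂ)) * star U

/-- Unitarity, as a pair of equations. -/
def IsUni (U : Matrix κ κ ℂ) : Prop := star U * U = 1 ∧ U * star U = 1

lemma isUni_eigenvectorUnitary {A : Matrix κ κ ℂ} (hA : A.IsHermitian) :
    IsUni (hA.eigenvectorUnitary : Matrix κ κ ℂ) :=
  ⟨Matrix.mem_unitaryGroup_iff'.1 hA.eigenvectorUnitary.2,
    Matrix.mem_unitaryGroup_iff.1 hA.eigenvectorUnitary.2⟩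

lemma specM_mul {U : Matrix κ κ ℂ} (hU : IsUni U) (f g : κ → ℝ) :
    specM U f * specM U g = specM U (fun i => f i * g i) := by
  unfold specM
  calc U * Matrix.diagonal (fun i => (f i : ℂ)) * star U
        * (U * Matrix.diagonal (fun i => (g i : ℂ)) * star U)
      = U * Matrix.diagonal (fun i => (f i : ℂ)) * (star U * U)
        * Matrix.diagonal (fun i => (g i : ℂ)) * star U := by simp only [Matrix.mul_assoc]
    _ = _ := by
      rw [hU.1, Matrix.mul_one, Matrix.mul_assoc U, Matrix.diagonal_mul_diagonal]
      simp

lemma specM_add (U : Matrix κ κ ℂ) (f g : κ → ℝ) :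
    specM U f + specM U g = specM U (fun i => f i + g i) := by
  unfold specM
  rw [← Matrix.add_mul, ← Matrix.mul_add, Matrix.diagonal_add]
  simp

lemma specM_sub (U : Matrix κ κ ℂ) (f g : κ → ℝ) :
    specM U f - specM U g = specM U (fun i => f i - g i) := by
  unfold specM
  rw [← Matrix.sub_mul, ← Matrix.mul_sub, Matrix.diagonal_sub]
  simp

lemma specM_smul (U : Matrix κ κ ℂ) (c : ℝ) (f : κ → ℝ) :
    (c : ℂ) • specM U f = specM U (fun i => c * f i) := by
  have h : Matrix.diagonal (fun i => ((c * f i : ℝ) : ℂ))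
      = (c : ℂ) • Matrix.diagonal (fun i => (f i : ℂ)) := by
    rw [← Matrix.diagonal_smul]
    congr 1
    ext i
    simp
  simp only [specM]
  rw [h]
  simp only [Matrix.mul_smul, Matrix.smul_mul]

lemma specM_const {U : Matrix κ κ ℂ} (hU : IsUni U) (c : ℝ) :
    specM U (fun _ => c) = (c : ℂ) • (1 : Matrix κ κ ℂ) := by
  have h : Matrix.diagonal (fun _ : κ => (c : ℂ)) = (c : ℂ) • (1 : Matrix κ κ ℂ) := by
    rw [← Matrix.diagonal_one, ← Matrix.diagonal_smul]
    congr 1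
    ext i
    simp
  unfold specM
  rw [h, Matrix.mul_smul, Matrix.mul_one, Matrix.smul_mul, hU.2]

lemma specM_posSemidef (U : Matrix κ κ ℂ) {f : κ → ℝ} (hf : ∀ i, 0 ≤ f i) :
    (specM U f).PosSemidef := by
  unfold specM
  rw [Matrix.star_eq_conjTranspose]
  refine Matrix.PosSemidef.mul_mul_conjTranspose_same (Matrix.PosSemidef.diagonal ?_) U
  intro i
  simpa using hf i

lemma specM_isHermitian (U : Matrix κ κ ℂ) (f : κ → ℝ) : (specM U f).IsHermitian := by
  have := (specM_posSemidef U (f := fun i => max (f i) 0) (by intro i; simp)).isHermitian.sub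
    (specM_posSemidef U (f := fun i => max (f i) 0 - f i) (by intro i; simp)).isHermitian
  rw [specM_sub] at this
  simpa using this

lemma specM_conj {U : Matrix κ κ ℂ} (hU : IsUni U) (f : κ → ℝ) :
    star U * specM U f * U = Matrix.diagonal (fun i => (f i : ℂ)) := by
  unfold specM
  calc star U * (U * Matrix.diagonal (fun i => (f i : ℂ)) * star U) * U
      = (star U * U) * Matrix.diagonal (fun i => (f i : ℂ)) * (star U * U) := by
        simp only [Matrix.mul_assoc]
    _ = _ := by rw [hU.1]; simp

lemma specM_posDef {U : Matrix κ κ ℂ} (hU : IsUni U) {f : κ → ℝ} (hf : ∀ i, 0 < f i) :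
    (specM U f).PosDef := by
  refine (specM_posSemidef U fun i => (hf i).le).posDef_iff_isUnit.2 ?_
  refine ⟨⟨specM U f, specM U (fun i => (f i)⁻¹), ?_, ?_⟩, rfl⟩
  · rw [specM_mul hU]
    simp only [mul_inv_cancel₀ (hf _).ne']
    simpa using specM_const hU 1
  · rw [specM_mul hU]
    simp only [inv_mul_cancel₀ (hf _).ne']
    simpa using specM_const hU 1

lemma eq_specM {A : Matrix κ κ ℂ} (hA : A.IsHermitian) :
    A = specM (hA.eigenvectorUnitary : Matrix κ κ ℂ) hA.eigenvalues := by
  conv_lhs => rw [hA.spectral_theorem]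
  simp [specM, Function.comp_def]

lemma matLog_eq {A : Matrix κ κ ℂ} (hA : A.IsHermitian) :
    matLog A = specM (hA.eigenvectorUnitary : Matrix κ κ ℂ) (fun i => Real.log (hA.eigenvalues i)) := by
  unfold matLog
  rw [dif_pos hA]
  rfl

lemma trace_mul_specM (M U : Matrix κ κ ℂ) (f : κ → ℝ) :
    (M * specM U f).trace.re = ∑ y, f y * ((star U * M * U) y y).re := by
  have h : (M * specM U f).trace
      = (star U * M * U * Matrix.diagonal (fun i => (f i : ℂ))).trace := by
    unfold specM
    rw [← Matrix.mul_assoc, Matrix.trace_mul_comm]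
    simp only [Matrix.mul_assoc]
  rw [h, Matrix.trace]
  simp only [Matrix.diag, Matrix.mul_diagonal, Complex.re_sum, Complex.mul_re, Complex.ofReal_re,
    Complex.ofReal_im, mul_zero, sub_zero]
  exact Finset.sum_congr rfl fun y _ => mul_comm _ _

lemma trace_specM_mul_specM (U V : Matrix κ κ ℂ) (f g : κ → ℝ) :
    (specM U f * specM V g).trace.re
      = ∑ x, ∑ y, f x * g y * Complex.normSq ((star U * V) x y) := by
  rw [trace_mul_specM, Finset.sum_comm]
  refine Finset.sum_congr rfl fun y _ => ?_
  have h : star V * specM U f * V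
      = star (star U * V) * Matrix.diagonal (fun i => (f i : ℂ)) * (star U * V) := by
    unfold specM
    simp only [star_mul, star_star, Matrix.mul_assoc]
  rw [h, Matrix.mul_apply, Complex.re_sum, Finset.mul_sum]
  refine Finset.sum_congr rfl fun x _ => ?_
  rw [Matrix.mul_diagonal, Matrix.star_apply, mul_right_comm]
  have : star ((star U * V) x y) * (star U * V) x y = (Complex.normSq ((star U * V) x y) : ℂ) := by
    rw [mul_comm]; exact Complex.mul_conj _
  rw [this, ← Complex.ofReal_mul, Complex.ofReal_re]
  ring

lemma isUni_star_mul {U V : Matrix κ κ ℂ} (hU : IsUni U) (hV : IsUni V) : IsUni (star U * V) := by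
  constructor
  · calc star (star U * V) * (star U * V) = star V * (U * star U) * V := by
          simp only [star_mul, star_star, Matrix.mul_assoc]
      _ = 1 := by rw [hU.2, Matrix.mul_one, hV.1]
  · calc (star U * V) * star (star U * V) = star U * (V * star V) * U := by
          simp only [star_mul, star_star, Matrix.mul_assoc]
      _ = 1 := by rw [hV.2, Matrix.mul_one, hU.1]

lemma IsUni.sum_row {U : Matrix κ κ ℂ} (hU : IsUni U) (x : κ) :
    ∑ y, Complex.normSq (U x y) = 1 := by
  have h := congrFun (congrFun hU.2 x) x
  rw [Matrix.mul_apply, Matrix.one_apply_eq] at h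
  have h2 := congrArg Complex.re h
  rw [Complex.re_sum, Complex.one_re] at h2
  rw [← h2]
  refine Finset.sum_congr rfl fun y _ => ?_
  rw [Matrix.star_apply]
  have : U x y * star (U x y) = (Complex.normSq (U x y) : ℂ) := Complex.mul_conj _
  rw [this, Complex.ofReal_re]

lemma IsUni.sum_col {U : Matrix κ κ ℂ} (hU : IsUni U) (y : κ) :
    ∑ x, Complex.normSq (U x y) = 1 := by
  have h : IsUni (star U) := ⟨by rw [star_star]; exact hU.2, by rw [star_star]; exact hU.1⟩
  rw [← h.sum_row y]
  refine Finset.sum_congr rfl fun x _ => ?_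
  rw [Matrix.star_apply]
  exact (Complex.normSq_conj _).symm

lemma trace_specM {U : Matrix κ κ ℂ} (hU : IsUni U) (f : κ → ℝ) :
    (specM U f).trace.re = ∑ x, f x := by
  unfold specM
  rw [Matrix.trace_mul_comm, ← Matrix.mul_assoc, hU.1, Matrix.one_mul, Matrix.trace_diagonal,
    Complex.re_sum]
  simp

lemma trace_mul_nonneg {A B : Matrix κ κ ℂ} (hA : A.PosSemidef) (hB : B.PosSemidef) :
    0 ≤ (A * B).trace.re := by
  conv_rhs => rw [eq_specM hA.1, eq_specM hB.1]
  rw [trace_specM_mul_specM]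
  exact Finset.sum_nonneg fun x _ => Finset.sum_nonneg fun y _ =>
    mul_nonneg (mul_nonneg (hA.eigenvalues_nonneg x) (hB.eigenvalues_nonneg y))
      (Complex.normSq_nonneg _)

/-- Comparison of traces against a positive semidefinite matrix. -/
lemma trace_mul_le {A B C : Matrix κ κ ℂ} (hA : A.PosSemidef) (hBC : (C - B).PosSemidef) :
    (A * B).trace.re ≤ (A * C).trace.re := by
  have := trace_mul_nonneg hA hBC
  rw [Matrix.mul_sub, Matrix.trace_sub, Complex.sub_re] at this
  linarith

lemma exists_spec {A : Matrix κ κ ℂ} (hA : A.PosSemidef) :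
    ∃ (U : Matrix κ κ ℂ) (a : κ → ℝ), IsUni U ∧ (∀ x, 0 ≤ a x) ∧ A = specM U a ∧
      matLog A = specM U (fun x => Real.log (a x)) ∧ (A.PosDef → ∀ x, 0 < a x) :=
  ⟨hA.1.eigenvectorUnitary, hA.1.eigenvalues, isUni_eigenvectorUnitary hA.1,
    hA.eigenvalues_nonneg, eq_specM hA.1, matLog_eq hA.1, fun h x => h.eigenvalues_pos x⟩

lemma sum_mul_overlap_row {W : Matrix κ κ ℂ} (hW : IsUni W) (f : κ → ℝ) :
    ∑ x, ∑ y, f x * Complex.normSq (W x y) = ∑ x, f x :=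
  Finset.sum_congr rfl fun x _ => by rw [← Finset.mul_sum, hW.sum_row, mul_one]

lemma sum_mul_overlap_col {W : Matrix κ κ ℂ} (hW : IsUni W) (f : κ → ℝ) :
    ∑ x, ∑ y, f y * Complex.normSq (W x y) = ∑ y, f y := by
  rw [Finset.sum_comm]
  exact Finset.sum_congr rfl fun x _ => by rw [← Finset.mul_sum, hW.sum_col, mul_one]

lemma specM_inv {U : Matrix κ κ ℂ} (hU : IsUni U) {a : κ → ℝ} (ha : ∀ x, 0 < a x) :
    (specM U a)⁻¹ = specM U (fun x => (a x)⁻¹) := by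
  refine Matrix.inv_eq_right_inv ?_
  rw [specM_mul hU]
  simp only [mul_inv_cancel₀ (ha _).ne']
  simpa using specM_const hU 1

/-- Klein's inequality. -/
lemma klein {X Y : Matrix κ κ ℂ} (hX : X.PosSemidef) (hY : Y.PosDef) :
    (X * matLog Y).trace.re ≤ (X * matLog X).trace.re + Y.trace.re - X.trace.re := by
  obtain ⟨U, a, hU, ha, eX, lX, -⟩ := exists_spec hX
  obtain ⟨V, b, hV, -, eY, lY, hb⟩ := exists_spec hY.posSemidef
  replace hb := hb hY
  have hW := isUni_star_mul hU hV
  rw [lX, lY, eX, eY, trace_specM_mul_specM, specM_mul hU, trace_specM hU, trace_specM hU,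
    trace_specM hV, ← sum_mul_overlap_row hW (fun x => a x * Real.log (a x)),
    ← sum_mul_overlap_row hW a, ← sum_mul_overlap_col hW b, ← Finset.sum_add_distrib,
    ← Finset.sum_sub_distrib]
  refine Finset.sum_le_sum fun x _ => ?_
  rw [← Finset.sum_add_distrib, ← Finset.sum_sub_distrib]
  refine Finset.sum_le_sum fun y _ => ?_
  have key : a x * Real.log (b y) ≤ a x * Real.log (a x) + b y - a x := by
    have hm := hb y
    rcases (ha x).eq_or_lt with h0 | h0
    · rw [← h0]; simp [hm.le]
    · have := Real.log_le_sub_one_of_pos (div_pos hm h0)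
      rw [Real.log_div hm.ne' h0.ne'] at this
      have h2 := mul_le_mul_of_nonneg_left this h0.le
      have h3 : a x * (b y / a x - 1) = b y - a x := by field_simp
      nlinarith
  have := mul_le_mul_of_nonneg_right key (Complex.normSq_nonneg ((star U * V) x y))
  linarith

/-- Upper bound of the relative entropy by the quadratic divergence. -/
lemma klein_reverse {X Y : Matrix κ κ ℂ} (hX : X.PosSemidef) (hY : Y.PosDef) :
    (X * matLog X).trace.re
      ≤ (X * matLog Y).trace.re + (X * X * Y⁻¹).trace.re - X.trace.re := by
  obtain ⟨U, a, hU, ha, eX, lX, -⟩ := exists_spec hX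
  obtain ⟨V, b, hV, -, eY, lY, hb⟩ := exists_spec hY.posSemidef
  replace hb := hb hY
  have hW := isUni_star_mul hU hV
  rw [lX, lY, eX, eY, specM_inv hV hb, specM_mul hU, specM_mul hU, trace_specM_mul_specM,
    trace_specM_mul_specM, trace_specM hU, trace_specM hU,
    ← sum_mul_overlap_row hW (fun x => a x * Real.log (a x)),
    ← sum_mul_overlap_row hW a, ← Finset.sum_add_distrib, ← Finset.sum_sub_distrib]
  refine Finset.sum_le_sum fun x _ => ?_
  rw [← Finset.sum_add_distrib, ← Finset.sum_sub_distrib]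
  refine Finset.sum_le_sum fun y _ => ?_
  have key : a x * Real.log (a x) ≤ a x * Real.log (b y) + a x * a x * (b y)⁻¹ - a x := by
    have hm := hb y
    rcases (ha x).eq_or_lt with h0 | h0
    · rw [← h0]; simp
    · have := Real.log_le_sub_one_of_pos (div_pos h0 hm)
      rw [Real.log_div h0.ne' hm.ne'] at this
      have h2 := mul_le_mul_of_nonneg_left this h0.le
      rw [div_eq_mul_inv] at h2
      nlinarith
  have := mul_le_mul_of_nonneg_right key (Complex.normSq_nonneg ((star U * V) x y))
  linarith

end Spectral

section TestBound

variable {κ : Type*} [Fintype κ] [DecidableEq κ]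

lemma exists_mul_of_suppLE {ρ σ : Matrix κ κ ℂ} (h : suppLE ρ σ) : ∃ M, ρ = σ * M := by
  have h1 : ∀ j, ∃ z, σ.mulVec z = ρ.mulVec (Pi.single j 1) := by
    intro j
    obtain ⟨z, hz⟩ := h (LinearMap.mem_range_self (Matrix.toLin' ρ) (Pi.single j 1))
    exact ⟨z, by simpa using hz⟩
  choose z hz using h1
  refine ⟨Matrix.of fun i j => z j i, ?_⟩
  ext i j
  have := congrFun (hz j) i
  rw [Matrix.mulVec_single_one] at this
  exact this.symm

lemma suppLE_of_eq_mul {ρ σ M : Matrix κ κ ℂ} (h : ρ = σ * M) : suppLE ρ σ := by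
  rw [suppLE, h, Matrix.toLin'_mul]
  exact LinearMap.range_comp_le_range _ _

lemma overlap_eq_zero {U V : Matrix κ κ ℂ} (hU : IsUni U) (hV : IsUni V) {a b : κ → ℝ}
    (h : suppLE (specM U a) (specM V b)) (x y : κ) (hb : b y = 0) :
    a x * Complex.normSq ((star U * V) x y) = 0 := by
  obtain ⟨M, hM⟩ := exists_mul_of_suppLE h
  have h1 : star V * U * Matrix.diagonal (fun i => (a i : ℂ))
      = Matrix.diagonal (fun i => (b i : ℂ)) * (star V * M * U) := by
    calc star V * U * Matrix.diagonal (fun i => (a i : ℂ))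
        = star V * (U * Matrix.diagonal (fun i => (a i : ℂ)) * star U) * U := by
          simp only [Matrix.mul_assoc, hU.1, Matrix.mul_one]
      _ = star V * (specM V b * M) * U := by rw [← hM]; rfl
      _ = _ := by
          unfold specM
          calc star V * (V * Matrix.diagonal (fun i => (b i : ℂ)) * star V * M) * U
              = (star V * V) * Matrix.diagonal (fun i => (b i : ℂ)) * (star V * M * U) := by
                simp only [Matrix.mul_assoc]
            _ = _ := by rw [hV.1, Matrix.one_mul]
  have h2 := congrFun (congrFun h1 y) x
  rw [Matrix.mul_diagonal, Matrix.diagonal_mul, hb] at h2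
  simp only [Complex.ofReal_zero, zero_mul, mul_eq_zero, Complex.ofReal_eq_zero] at h2
  rcases h2 with h2 | h2
  · have h3 : (star U * V) x y = star ((star V * U) y x) := by
      rw [← Matrix.star_apply, star_mul, star_star]
    rw [h3, h2]; simp
  · rw [h2, zero_mul]

lemma suppLE_of_diag_zero {ρ V : Matrix κ κ ℂ} (hρ : ρ.PosSemidef) (hV : IsUni V) {b : κ → ℝ}
    (h : ∀ y, b y = 0 → ((star V * ρ * V) y y).re = 0) : suppLE ρ (specM V b) := by
  have hrow : ∀ y, b y = 0 → ∀ j, (star V * ρ) y j = 0 := by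
    intro y hy
    obtain ⟨U, a, hU, ha, eρ, -, -⟩ := exists_spec hρ
    have h1 : ((star V * ρ * V) y y).re = ∑ x, a x * Complex.normSq ((star U * V) x y) := by
      have h0 := trace_specM_mul_specM U V a (Pi.single y 1)
      rw [← eρ, trace_mul_specM] at h0
      simpa [Pi.single_apply, Finset.sum_ite_eq] using h0
    rw [h y hy] at h1
    have h2 := (Finset.sum_eq_zero_iff_of_nonneg
      (fun x _ => mul_nonneg (ha x) (Complex.normSq_nonneg _))).1 h1.symm
    have h3 : ∀ x, ((star V * U) * Matrix.diagonal (fun i => (a i : ℂ))) y x = 0 := by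
      intro x
      rw [Matrix.mul_diagonal]
      rcases mul_eq_zero.1 (h2 x (Finset.mem_univ _)) with h4 | h4
      · rw [h4]; simp
      · have h5 : (star V * U) y x = star ((star U * V) x y) := by
          rw [← Matrix.star_apply, star_mul, star_star]
        rw [h5, Complex.normSq_eq_zero.1 h4]; simp
    intro j
    have h6 : star V * ρ = (star V * U) * Matrix.diagonal (fun i => (a i : ℂ)) * star U := by
      rw [eρ]; simp only [specM, Matrix.mul_assoc]
    rw [h6, Matrix.mul_apply]
    exact Finset.sum_eq_zero fun x _ => by rw [h3, zero_mul]
  refine suppLE_of_eq_mul (M := specM V (fun y => (b y)⁻¹) * ρ) ?_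
  rw [← Matrix.mul_assoc, specM_mul hV]
  unfold specM
  have h7 : Matrix.diagonal (fun i => ((b i * (b i)⁻¹ : ℝ) : ℂ)) * (star V * ρ) = star V * ρ := by
    ext y j
    rw [Matrix.diagonal_mul]
    by_cases hy : b y = 0
    · rw [hrow y hy j, mul_zero]
    · rw [mul_inv_cancel₀ hy]; simp
  rw [Matrix.mul_assoc, Matrix.mul_assoc, h7, ← Matrix.mul_assoc, hV.2, Matrix.one_mul]

lemma relEnt_of_suppLE {ρ σ : Matrix κ κ ℂ} (h : suppLE ρ σ) :
    relEnt ρ σ = (((ρ * matLog ρ).trace.re - (ρ * matLog σ).trace.re : ℝ) : EReal) := by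
  rw [relEnt, if_pos h, Matrix.mul_sub, Matrix.trace_sub, Complex.sub_re]

lemma trace_specM_mul_sq {U V M : Matrix κ κ ℂ} (hV : IsUni V) (hM : M.IsHermitian) (a : κ → ℝ) :
    (specM U a * (M * M)).trace.re = ∑ x, ∑ y, a x * Complex.normSq ((star U * M * V) x y) := by
  rw [Matrix.trace_mul_comm, trace_mul_specM]
  refine Finset.sum_congr rfl fun x _ => ?_
  rw [← Finset.mul_sum]
  congr 1
  have h : star U * (M * M) * U = (star U * M * V) * star (star U * M * V) := by
    have hs : star M = M := hM
    calc star U * (M * M) * U = star U * M * (V * star V) * (M * U) := by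
          rw [hV.2]; simp only [Matrix.mul_assoc, Matrix.one_mul]
      _ = _ := by simp only [star_mul, star_star, hs, Matrix.mul_assoc]
  rw [h, Matrix.mul_apply, Complex.re_sum]
  refine Finset.sum_congr rfl fun y _ => ?_
  rw [Matrix.star_apply]
  generalize (star U * M * V) x y = z
  have : z * star z = (Complex.normSq z : ℂ) := Complex.mul_conj _
  rw [this, Complex.ofReal_re]

lemma effect_sub_sq {E : Matrix κ κ ℂ} (hE : E.PosSemidef) (hE1 : (1 - E).PosSemidef) :
    (E - E * E).PosSemidef := by
  have h1 := hE.mul_mul_conjTranspose_same (1 - E)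
  have h2 := hE1.mul_mul_conjTranspose_same E
  rw [hE1.1.eq] at h1
  rw [hE.1.eq] at h2
  have h3 := h1.add h2
  convert h3 using 1
  noncomm_ring

/-- Lower bound on the errors of a binary test in terms of the relative entropy. -/
lemma test_bound {ρ σ E : Matrix κ κ ℂ} (hρ : IsState ρ) (hσ : IsState σ) (h : suppLE ρ σ)
    (hE : E.PosSemidef) (hE1 : (1 - E).PosSemidef) {T : ℝ} (hT : 0 < T) :
    (1 - ((ρ * matLog ρ).trace.re - (ρ * matLog σ).trace.re + 1) / T) / 2
      ≤ (ρ * (1 - E)).trace.re + Real.exp T * (σ * E).trace.re := by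
  have i1 : (ρ * ((1 - E) * (1 - E))).trace.re ≤ (ρ * (1 - E)).trace.re := by
    refine trace_mul_le hρ.1 (effect_sub_sq hE1 ?_)
    simpa using hE
  have i2 : (σ * (E * E)).trace.re ≤ (σ * E).trace.re :=
    trace_mul_le hσ.1 (effect_sub_sq hE hE1)
  have i2' := mul_le_mul_of_nonneg_left i2 (Real.exp_pos T).le
  refine le_trans ?_ (add_le_add i1 i2')
  obtain ⟨U, a, hU, ha, eρ, lρ, -⟩ := exists_spec hρ.1
  obtain ⟨V, b, hV, hb, eσ, lσ, -⟩ := exists_spec hσ.1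
  have hW := isUni_star_mul hU hV
  have ta : ∑ x, ∑ y, a x * Complex.normSq ((star U * V) x y) = 1 := by
    rw [sum_mul_overlap_row hW, ← trace_specM hU, ← eρ, hρ.2, Complex.one_re]
  have tb : ∑ x, ∑ y, b y * Complex.normSq ((star U * V) x y) = 1 := by
    rw [sum_mul_overlap_col hW, ← trace_specM hV, ← eσ, hσ.2, Complex.one_re]
  have hz : ∀ x y, b y = 0 → a x * Complex.normSq ((star U * V) x y) = 0 := by
    intro x y hy
    refine overlap_eq_zero hU hV (b := b) ?_ x y hy
    rw [← eρ, ← eσ]; exact h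
  rw [lρ, lσ, eρ, eσ, specM_mul hU, trace_specM hU, trace_specM_mul_specM,
    trace_specM_mul_sq hV hE1.1, trace_specM_mul_sq hU hE.1]
  rw [Finset.sum_comm (f := fun x y => b x * _)]
  rw [← sum_mul_overlap_row hW (fun x => a x * Real.log (a x))]
  have key : ∀ x y, a x * Complex.normSq ((star U * V) x y)
      - (a x * Real.log (a x) * Complex.normSq ((star U * V) x y)
        - a x * Real.log (b y) * Complex.normSq ((star U * V) x y)
        + b y * Complex.normSq ((star U * V) x y)) / T
      ≤ 2 * (a x * Complex.normSq ((star U * (1 - E) * V) x y)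
        + Real.exp T * (b y * Complex.normSq ((star V * E * U) y x))) := by
    intro x y
    have hs : Complex.normSq ((star V * E * U) y x) = Complex.normSq ((star U * E * V) x y) := by
      have : (star V * E * U) y x = star ((star U * E * V) x y) := by
        rw [← Matrix.star_apply]
        simp only [star_mul, star_star, Matrix.mul_assoc]
        rw [show star E = E from hE.1]
      rw [this]
      exact Complex.normSq_conj _
    rw [hs]
    have hsum : (star U * V) x y = (star U * (1 - E) * V) x y + (star U * E * V) x y := by
      rw [← Matrix.add_apply, ← Matrix.add_mul, ← Matrix.mul_add]; simp
    set w := Complex.normSq ((star U * V) x y) with hw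
    set p := (star U * (1 - E) * V) x y
    set q := (star U * E * V) x y
    have hw0 : 0 ≤ w := Complex.normSq_nonneg _
    have hpq : w ≤ 2 * (Complex.normSq p + Complex.normSq q) := by
      rw [hw, hsum]
      simp only [Complex.normSq_apply, Complex.add_re, Complex.add_im]
      nlinarith [sq_nonneg (p.re - q.re), sq_nonneg (p.im - q.im)]
    have hp := Complex.normSq_nonneg p
    have hq := Complex.normSq_nonneg q
    have hmin : min (a x) (Real.exp T * b y) * w
        ≤ 2 * (a x * Complex.normSq p + Real.exp T * (b y * Complex.normSq q)) := by
      have h0 : 0 ≤ min (a x) (Real.exp T * b y) :=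
        le_min (ha x) (mul_nonneg (Real.exp_pos T).le (hb y))
      have h1 := mul_le_mul_of_nonneg_right (min_le_left (a x) (Real.exp T * b y)) hp
      have h2 := mul_le_mul_of_nonneg_right (min_le_right (a x) (Real.exp T * b y)) hq
      have h3 := mul_le_mul_of_nonneg_left hpq h0
      nlinarith
    refine le_trans ?_ hmin
    rw [sub_le_iff_le_add, ← sub_le_iff_le_add', le_div_iff₀ hT]
    rcases (hb y).eq_or_lt with hb0 | hb0
    · have hz0 := hz x y hb0.symm
      rw [← hb0, mul_zero, min_eq_right (ha x)]
      have e1 : a x * Real.log (a x) * w = (a x * w) * Real.log (a x) := by ring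
      rw [e1, hz0]; simp
    · rcases (ha x).eq_or_lt with ha0 | ha0
      · rw [← ha0, min_eq_left (mul_nonneg (Real.exp_pos T).le (hb y))]
        simp [mul_nonneg hb0.le hw0]
      · have hlog : a x - b y ≤ a x * Real.log (a x) - a x * Real.log (b y) := by
          have := Real.log_le_sub_one_of_pos (div_pos hb0 ha0)
          rw [Real.log_div hb0.ne' ha0.ne'] at this
          have h2 := mul_le_mul_of_nonneg_left this ha0.le
          have h3 : a x * (b y / a x - 1) = b y - a x := by field_simp
          nlinarith
        by_cases hc : a x ≤ Real.exp T * b y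
        · rw [min_eq_left hc]
          have := mul_le_mul_of_nonneg_right hlog hw0
          nlinarith [mul_nonneg ha0.le hw0]
        · push Not at hc
          rw [min_eq_right hc.le]
          have h4 := Real.log_lt_log (mul_pos (Real.exp_pos T) hb0) hc
          rw [Real.log_mul (Real.exp_pos T).ne' hb0.ne', Real.log_exp] at h4
          have h5 : T ≤ Real.log (a x) - Real.log (b y) := by linarith
          have h6 := mul_le_mul_of_nonneg_left h5 (mul_nonneg ha0.le hw0)
          have h7 : 0 ≤ Real.exp T * b y * w * T :=
            mul_nonneg (mul_nonneg (mul_nonneg (Real.exp_pos T).le hb0.le) hw0) hT.le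
          have h8 := mul_nonneg hb0.le hw0
          nlinarith
  have hsum := Finset.sum_le_sum fun x (_ : x ∈ Finset.univ) =>
    Finset.sum_le_sum fun y (_ : y ∈ Finset.univ) => key x y
  have e2 : ∀ f : κ → κ → ℝ, ∑ x, ∑ i, 2 * f x i = 2 * ∑ x, ∑ i, f x i := fun f => by
    simp only [Finset.mul_sum]
  simp only [Finset.sum_sub_distrib, ← Finset.sum_div, Finset.sum_add_distrib,
    ← Finset.mul_sum, mul_add] at hsum
  simp only [Finset.mul_sum] at hsum ta tb ⊢
  rw [ta, tb, e2, e2] at hsum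
  linarith

end TestBound

section States

variable {κ : Type*} [Fintype κ] [DecidableEq κ]

lemma isClosed_posSemidef : IsClosed {A : Matrix κ κ ℂ | A.PosSemidef} := by
  simp only [Matrix.posSemidef_iff_dotProduct_mulVec, Set.ofPred_and, Set.ofPred_forall]
  refine IsClosed.inter ?_ (isClosed_iInter fun x => ?_)
  · exact isClosed_eq continuous_id.matrix_conjTranspose continuous_id
  · refine isClosed_le continuous_const ?_
    exact Continuous.dotProduct continuous_const (Continuous.matrix_mulVec continuous_id continuous_const)

lemma isClosed_isState : IsClosed {A : Matrix κ κ ℂ | IsState A} :=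
  isClosed_posSemidef.inter (isClosed_eq (Continuous.matrix_trace continuous_id) continuous_const)

lemma IsState.norm_le {A : Matrix κ κ ℂ} (hA : IsState A) (i j : κ) : ‖A i j‖ ≤ 1 := by
  obtain ⟨U, a, hU, ha, e, -, -⟩ := exists_spec hA.1
  have ht : ∑ x, a x = 1 := by rw [← trace_specM hU, ← e, hA.2, Complex.one_re]
  have hn : ∀ i x, ‖U i x‖ ≤ 1 := by
    intro i x
    have := Finset.single_le_sum (f := fun y => Complex.normSq (U i y))
      (fun y _ => Complex.normSq_nonneg _) (Finset.mem_univ x)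
    rw [hU.sum_row i, Complex.normSq_eq_norm_sq] at this
    nlinarith [norm_nonneg (U i x)]
  have : A i j = ∑ x, U i x * (a x : ℂ) * star (U j x) := by
    rw [e, specM, Matrix.mul_apply]
    simp only [Matrix.mul_diagonal, Matrix.star_apply]
  rw [this, ← ht]
  refine norm_sum_le_of_le _ fun x _ => ?_
  rw [norm_mul, norm_mul, norm_star, Complex.norm_real, Real.norm_of_nonneg (ha x)]
  have h1 := hn i x
  have h2 := hn j x
  have h3 := ha x
  calc ‖U i x‖ * a x * ‖U j x‖ ≤ 1 * a x * 1 := by gcongr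
    _ = a x := by ring

lemma isCompact_isState : IsCompact {A : Matrix κ κ ℂ | IsState A} := by
  have h : IsCompact (Set.pi Set.univ fun _ : κ => Set.pi Set.univ fun _ : κ =>
      Metric.closedBall (0 : ℂ) 1) :=
    isCompact_univ_pi fun _ => isCompact_univ_pi fun _ => isCompact_closedBall _ _
  refine h.of_isClosed_subset isClosed_isState fun A hA => ?_
  simp only [Set.mem_pi, Set.mem_univ, forall_const, mem_closedBall_zero_iff]
  exact fun i j => IsState.norm_le hA i j

lemma convex_isState : Convex ℝ {A : Matrix κ κ ℂ | IsState A} := by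
  intro A hA B hB s t hs ht hst
  refine ⟨(hA.1.smul hs).add (hB.1.smul ht), ?_⟩
  rw [Matrix.trace_add, Matrix.trace_smul, Matrix.trace_smul, hA.2, hB.2]
  rw [← add_smul, hst, one_smul]

lemma trace_mul_le_one {A E : Matrix κ κ ℂ} (hA : IsState A) (hE : (1 - E).PosSemidef) :
    (A * E).trace.re ≤ 1 := by
  have := trace_mul_le hA.1 hE
  rwa [Matrix.mul_one, hA.2, Complex.one_re] at this

end States

section Tensor

variable {ι : Type*}

lemma tensorPow_star (A : MatC ι) (n : ℕ) : tensorPow (star A) n = star (tensorPow A n) := by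
  ext i j
  simp [tensorPow, Matrix.star_apply]

variable [Fintype ι]

lemma tensorPow_mul (A B : MatC ι) (n : ℕ) :
    tensorPow (A * B) n = tensorPow A n * tensorPow B n := by
  ext i j
  simp only [tensorPow, Matrix.mul_apply]
  rw [Finset.prod_univ_sum, Fintype.piFinset_univ]
  exact Finset.sum_congr rfl fun x _ => Finset.prod_mul_distrib

lemma trace_tensorPow (A : MatC ι) (n : ℕ) : (tensorPow A n).trace = A.trace ^ n := by
  simp only [tensorPow, Matrix.trace, Matrix.diag]
  have : (∑ i, A i i) ^ n = ∏ _k : Fin n, ∑ i, A i i := by simp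
  rw [this, Finset.prod_univ_sum, Fintype.piFinset_univ]

lemma tensorPow_diagonal [DecidableEq ι] (f : ι → ℂ) (n : ℕ) :
    tensorPow (Matrix.diagonal f) n = Matrix.diagonal fun i => ∏ k, f (i k) := by
  ext i j
  by_cases h : i = j
  · subst h; simp [tensorPow]
  · rw [Matrix.diagonal_apply_ne _ h]
    obtain ⟨k, hk⟩ := Function.ne_iff.1 h
    exact Finset.prod_eq_zero (Finset.mem_univ k) (Matrix.diagonal_apply_ne _ hk)

lemma tensorPow_one [DecidableEq ι] (n : ℕ) : tensorPow (1 : MatC ι) n = 1 := by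
  rw [← Matrix.diagonal_one, tensorPow_diagonal]
  simp

lemma tensorPow_specM [DecidableEq ι] (U : MatC ι) (f : ι → ℝ) (n : ℕ) :
    tensorPow (specM U f) n = specM (tensorPow U n) (fun i => ∏ k, f (i k)) := by
  rw [specM, specM, tensorPow_mul, tensorPow_mul, tensorPow_diagonal, tensorPow_star]
  simp

lemma isUni_tensorPow [DecidableEq ι] {U : MatC ι} (hU : IsUni U) (n : ℕ) :
    IsUni (tensorPow U n) := by
  constructor
  · rw [← tensorPow_star, ← tensorPow_mul, hU.1, tensorPow_one]
  · rw [← tensorPow_star, ← tensorPow_mul, hU.2, tensorPow_one]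

lemma tensorPow_posSemidef [DecidableEq ι] {A : MatC ι} (hA : A.PosSemidef) (n : ℕ) :
    (tensorPow A n).PosSemidef := by
  obtain ⟨U, a, hU, ha, e, -, -⟩ := exists_spec hA
  rw [e, tensorPow_specM]
  exact specM_posSemidef _ fun i => Finset.prod_nonneg fun k _ => ha _

lemma tensorPow_isState [DecidableEq ι] {A : MatC ι} (hA : IsState A) (n : ℕ) :
    IsState (tensorPow A n) :=
  ⟨tensorPow_posSemidef hA.1 n, by rw [trace_tensorPow, hA.2, one_pow]⟩

end Tensor

section Product

variable {α β : Type*}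

lemma prodStateAB_eq {n : ℕ} (P : MatN α n) (Q : MatN β n) :
    prodStateAB P Q = (Matrix.kroneckerMap (· * ·) P Q).submatrix
      (Equiv.arrowProdEquivProdArrow (Fin n) (fun _ => α) (fun _ => β))
      (Equiv.arrowProdEquivProdArrow (Fin n) (fun _ => α) (fun _ => β)) := by
  ext i j
  rfl

variable [Fintype α] [Fintype β]

lemma prodStateAB_posSemidef {n : ℕ} {P : MatN α n} {Q : MatN β n}
    (hP : P.PosSemidef) (hQ : Q.PosSemidef) : (prodStateAB P Q).PosSemidef := by
  rw [prodStateAB_eq]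
  exact (hP.kronecker hQ).submatrix _

lemma trace_submatrix_equiv' {κ l : Type*} [Fintype κ] [Fintype l] (A : Matrix κ κ ℂ)
    (e : l ≃ κ) : (A.submatrix e e).trace = A.trace := by
  simp only [Matrix.trace, Matrix.diag, Matrix.submatrix_apply]
  exact Equiv.sum_comp e fun i => A i i

lemma trace_prodStateAB {n : ℕ} (P : MatN α n) (Q : MatN β n) :
    (prodStateAB P Q).trace = P.trace * Q.trace := by
  rw [prodStateAB_eq, trace_submatrix_equiv']
  exact Matrix.trace_kronecker P Q

lemma prodStateAB_mul {n : ℕ} (P P' : MatN α n) (Q Q' : MatN β n) :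
    prodStateAB (P * P') (Q * Q') = prodStateAB P Q * prodStateAB P' Q' := by
  rw [prodStateAB_eq, prodStateAB_eq, prodStateAB_eq, Matrix.submatrix_mul_equiv]
  congr 1
  exact Matrix.mul_kronecker_mul P P' Q Q'

lemma prodStateAB_isState {n : ℕ} {P : MatN α n} {Q : MatN β n}
    (hP : IsState P) (hQ : IsState Q) : IsState (prodStateAB P Q) :=
  ⟨prodStateAB_posSemidef hP.1 hQ.1, by rw [trace_prodStateAB, hP.2, hQ.2, mul_one]⟩

lemma isState_of_mem_sepSet {n : ℕ} {σ : MatN (α × β) n} (h : σ ∈ sepSet α β n) : IsState σ := by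
  refine convexHull_min (t := {A | IsState A}) ?_ convex_isState h
  rintro ρ ⟨P, Q, hP, hQ, rfl⟩
  exact prodStateAB_isState hP hQ

end Product

section Hull

lemma IsCompact.convexHull_of_finiteDimensional {E : Type*} [AddCommGroup E] [Module ℝ E]
    [TopologicalSpace E] [IsTopologicalAddGroup E] [ContinuousSMul ℝ E] [FiniteDimensional ℝ E]
    {s : Set E} (hs : IsCompact s) : IsCompact (convexHull ℝ s) := by
  set N := Module.finrank ℝ E + 1
  have hK : IsCompact ((fun p : (Fin N → ℝ) × (Fin N → E) => ∑ i, p.1 i • p.2 i) ''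
      (stdSimplex ℝ (Fin N) ×ˢ Set.pi Set.univ fun _ => s)) := by
    refine ((isCompact_stdSimplex ℝ (Fin N)).prod (isCompact_univ_pi fun _ => hs)).image ?_
    fun_prop
  convert hK using 1
  refine Set.Subset.antisymm (fun x hx => ?_) ?_
  · obtain ⟨l, _, z, w, hz, hai, hw, hw1, rfl⟩ := eq_pos_convex_span_of_mem_convexHull hx
    have hcard : Fintype.card l ≤ Fintype.card (Fin N) := by
      rw [Fintype.card_fin]
      exact hai.card_le_finrank_succ.trans (Nat.succ_le_succ (Submodule.finrank_le _))
    obtain ⟨⟨f, hf⟩⟩ := Function.Embedding.nonempty_of_card_le hcard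
    obtain ⟨s0, hs0⟩ : s.Nonempty := convexHull_nonempty_iff.1 ⟨_, hx⟩
    refine ⟨(Function.extend f w 0, Function.extend f z fun _ => s0), ⟨⟨fun i => ?_, ?_⟩, ?_⟩, ?_⟩
    · by_cases h : ∃ a, f a = i
      · obtain ⟨a, rfl⟩ := h
        simp only [hf.extend_apply]; exact (hw a).le
      · simp [Function.extend_apply' _ _ _ h]
    · simp only
      rw [← hw1]
      refine (Fintype.sum_of_injective f hf _ _ (fun i hi => ?_) fun i => ?_).symm
      · rw [Function.extend_apply' _ _ _ hi]; simp
      · rw [hf.extend_apply]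
    · intro i _
      simp only
      by_cases h : ∃ a, f a = i
      · obtain ⟨a, rfl⟩ := h
        simp only [hf.extend_apply]; exact hz ⟨a, rfl⟩
      · simpa [Function.extend_apply' _ _ _ h] using hs0
    · simp only
      refine (Fintype.sum_of_injective f hf _ _ (fun i hi => ?_) fun i => ?_).symm
      · rw [Function.extend_apply' _ _ _ hi]; simp
      · rw [hf.extend_apply, hf.extend_apply]
  · rintro _ ⟨⟨w, z⟩, ⟨hw, hz⟩, rfl⟩
    exact mem_convexHull_of_exists_fintype w z hw.1 hw.2 (fun i => hz i trivial) rfl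

variable {α β : Type*} [Fintype α] [Fintype β] [DecidableEq α] [DecidableEq β]

lemma isCompact_sepSet (n : ℕ) : IsCompact (sepSet α β n) := by
  refine IsCompact.convexHull_of_finiteDimensional ?_
  have h := (isCompact_isState (κ := Fin n → α)).prod (isCompact_isState (κ := Fin n → β))
  have h2 := h.image (f := fun p => prodStateAB p.1 p.2) (by
    refine continuous_matrix fun i j => ?_
    unfold prodStateAB
    exact (continuous_fst.matrix_elem _ _).mul (continuous_snd.matrix_elem _ _))
  convert h2 using 1
  ext ρ
  constructor
  · rintro ⟨P, Q, hP, hQ, rfl⟩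
    exact ⟨(P, Q), ⟨hP, hQ⟩, rfl⟩
  · rintro ⟨⟨P, Q⟩, ⟨hP, hQ⟩, rfl⟩
    exact ⟨P, Q, hP, hQ, rfl⟩

end Hull

section Mixture

variable {ι : Type*} {C : Set (MatC ι)} (μ : Measure ↥C) [IsProbabilityMeasure μ]

lemma measurable_entry (i j : ι) : Measurable fun σ : ↥C => (σ : MatC ι) i j := by
  have h : Measurable fun A : MatC ι => A i j :=
    (measurable_pi_apply j).comp (measurable_pi_apply i)
  exact h.comp measurable_subtype_coe

lemma measurable_tensorPow_entry (n : ℕ) (i j : Fin n → ι) :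
    Measurable fun σ : ↥C => tensorPow (σ : MatC ι) n i j :=
  Finset.measurable_prod _ fun k _ => measurable_entry (i k) (j k)

variable [Fintype ι] [DecidableEq ι]

lemma integrable_tensorPow_entry (hC : ∀ ρ ∈ C, IsState ρ) (n : ℕ) (i j : Fin n → ι) :
    Integrable (fun σ : ↥C => tensorPow (σ : MatC ι) n i j) μ :=
  Integrable.of_bound (measurable_tensorPow_entry n i j).aestronglyMeasurable 1
    (Eventually.of_forall fun σ => (tensorPow_isState (hC σ σ.2) n).norm_le i j)

lemma trace_iidMix_mul (hC : ∀ ρ ∈ C, IsState ρ) (n : ℕ) (E : MatN ι n) :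
    Integrable (fun σ : ↥C => (tensorPow (σ : MatC ι) n * E).trace) μ ∧
    (iidMix μ n * E).trace = ∫ σ : ↥C, (tensorPow (σ : MatC ι) n * E).trace ∂μ := by
  have h : ∀ i j, Integrable (fun σ : ↥C => tensorPow (σ : MatC ι) n i j * E j i) μ :=
    fun i j => (integrable_tensorPow_entry μ hC n i j).mul_const _
  simp only [Matrix.trace, Matrix.diag, Matrix.mul_apply]
  refine ⟨integrable_finsetSum _ fun i _ => integrable_finsetSum _ fun j _ => h i j, ?_⟩
  rw [integral_finsetSum _ fun i _ => integrable_finsetSum _ fun j _ => h i j]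
  refine Finset.sum_congr rfl fun i _ => ?_
  rw [integral_finsetSum _ fun j _ => h i j]
  refine Finset.sum_congr rfl fun j _ => ?_
  rw [integral_mul_const]
  rfl

lemma isState_iidMix (hC : ∀ ρ ∈ C, IsState ρ) (n : ℕ) : IsState (iidMix μ n) := by
  constructor
  · refine Matrix.PosSemidef.of_dotProduct_mulVec_nonneg ?_ fun x => ?_
    · ext i j
      rw [Matrix.conjTranspose_apply]
      unfold iidMix
      rw [Complex.star_def, ← integral_conj]
      refine integral_congr_ae (Eventually.of_forall fun σ => ?_)
      exact congrFun (congrFun (tensorPow_isState (hC σ σ.2) n).1.1 i) j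
    · have key : ∀ A : MatN ι n, star x ⬝ᵥ A.mulVec x
          = (A * Matrix.vecMulVec x (star x)).trace := by
        intro A
        rw [Matrix.mul_vecMulVec, Matrix.trace_vecMulVec, dotProduct_comm]
      rw [key, (trace_iidMix_mul μ hC n _).2]
      refine integral_nonneg fun σ => ?_
      simp only [← key]
      exact (tensorPow_isState (hC σ σ.2) n).1.dotProduct_mulVec_nonneg x
  · have := (trace_iidMix_mul μ hC n 1).2
    rw [Matrix.mul_one] at this
    rw [this]
    simp only [Matrix.mul_one]
    rw [integral_congr_ae (Eventually.of_forall fun σ : ↥C =>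
      (tensorPow_isState (hC σ σ.2) n).2)]
    simp

lemma re_trace_iidMix_mul_le (hC : ∀ ρ ∈ C, IsState ρ) (n : ℕ) (E : MatN ι n) {b : ℝ}
    (hb : ∀ ρ ∈ C, (tensorPow ρ n * E).trace.re ≤ b) : (iidMix μ n * E).trace.re ≤ b := by
  obtain ⟨hi, he⟩ := trace_iidMix_mul μ hC n E
  rw [he]
  have h2 : (∫ σ : ↥C, (tensorPow (σ : MatC ι) n * E).trace ∂μ).re
      = ∫ σ : ↥C, ((tensorPow (σ : MatC ι) n * E).trace).re ∂μ := (integral_re hi).symm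
  rw [h2]
  have := integral_mono hi.re (integrable_const b) fun σ : ↥C => hb σ σ.2
  simpa using this

end Mixture

section Converse

variable {κ : Type*} [Fintype κ] [DecidableEq κ]

lemma relEnt_re_nonneg {ρ σ : Matrix κ κ ℂ} (hρ : IsState ρ) (hσ : IsState σ) (h : suppLE ρ σ) :
    0 ≤ (ρ * matLog ρ).trace.re - (ρ * matLog σ).trace.re := by
  obtain ⟨U, a, hU, ha, eρ, lρ, -⟩ := exists_spec hρ.1
  obtain ⟨V, b, hV, hb, eσ, lσ, -⟩ := exists_spec hσ.1
  have hW := isUni_star_mul hU hV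
  have ta : ∑ x, ∑ y, a x * Complex.normSq ((star U * V) x y) = 1 := by
    rw [sum_mul_overlap_row hW, ← trace_specM hU, ← eρ, hρ.2, Complex.one_re]
  have tb : ∑ x, ∑ y, b y * Complex.normSq ((star U * V) x y) = 1 := by
    rw [sum_mul_overlap_col hW, ← trace_specM hV, ← eσ, hσ.2, Complex.one_re]
  have hz : ∀ x y, b y = 0 → a x * Complex.normSq ((star U * V) x y) = 0 := by
    intro x y hy
    refine overlap_eq_zero hU hV (b := b) ?_ x y hy
    rw [← eρ, ← eσ]; exact h
  rw [lρ, lσ, eρ, specM_mul hU, trace_specM hU, trace_specM_mul_specM,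
    ← sum_mul_overlap_row hW (fun x => a x * Real.log (a x))]
  have key : ∀ x y, a x * Complex.normSq ((star U * V) x y)
      - b y * Complex.normSq ((star U * V) x y)
      ≤ a x * Real.log (a x) * Complex.normSq ((star U * V) x y)
        - a x * Real.log (b y) * Complex.normSq ((star U * V) x y) := by
    intro x y
    have hw0 : 0 ≤ Complex.normSq ((star U * V) x y) := Complex.normSq_nonneg _
    rcases (hb y).eq_or_lt with hb0 | hb0
    · have hz0 := hz x y hb0.symm
      have e1 : a x * Real.log (a x) * Complex.normSq ((star U * V) x y)
        = (a x * Complex.normSq ((star U * V) x y)) * Real.log (a x) := by ring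
      rw [e1, hz0, ← hb0]; simp
    · rcases (ha x).eq_or_lt with ha0 | ha0
      · rw [← ha0]
        simp [mul_nonneg hb0.le hw0]
      · have hlog : a x - b y ≤ a x * Real.log (a x) - a x * Real.log (b y) := by
          have := Real.log_le_sub_one_of_pos (div_pos hb0 ha0)
          rw [Real.log_div hb0.ne' ha0.ne'] at this
          have h2 := mul_le_mul_of_nonneg_left this ha0.le
          have h3 : a x * (b y / a x - 1) = b y - a x := by field_simp
          nlinarith
        have := mul_le_mul_of_nonneg_right hlog hw0
        linarith
  have hsum := Finset.sum_le_sum fun x (_ : x ∈ Finset.univ) =>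
    Finset.sum_le_sum fun y (_ : y ∈ Finset.univ) => key x y
  simp only [Finset.sum_sub_distrib] at hsum
  rw [ta, tb] at hsum
  linarith

lemma le_typeII {A B : Set (Matrix κ κ ℂ)} {ε c : ℝ} (hε : 0 ≤ ε)
    (h : ∀ E : Matrix κ κ ℂ, E.PosSemidef → (1 - E).PosSemidef →
      (∀ ρ ∈ A, (ρ * (1 - E)).trace.re ≤ ε) → c ≤ sSup {x : ℝ | ∃ σ ∈ B, x = (σ * E).trace.re}) :
    c ≤ typeII A B ε := by
  refine le_csInf ⟨_, 1, Matrix.PosSemidef.one, ?_, ?_, rfl⟩ ?_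
  · rw [sub_self]; exact Matrix.PosSemidef.zero
  · intro ρ _
    simpa using hε
  · rintro _ ⟨E, h1, h2, h3, rfl⟩
    exact h E h1 h2 h3

lemma typeII_le {A B : Set (Matrix κ κ ℂ)} {ε c : ℝ} (hB : ∀ σ ∈ B, IsState σ)
    (hc : 0 ≤ c) (E : Matrix κ κ ℂ) (hE : E.PosSemidef) (hE1 : (1 - E).PosSemidef)
    (h1 : ∀ ρ ∈ A, (ρ * (1 - E)).trace.re ≤ ε) (h2 : ∀ σ ∈ B, (σ * E).trace.re ≤ c) :
    typeII A B ε ≤ c := by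
  have hle : sSup {x : ℝ | ∃ σ ∈ B, x = (σ * E).trace.re} ≤ c := by
    refine Real.sSup_le ?_ hc
    rintro _ ⟨σ, hσ, rfl⟩
    exact h2 σ hσ
  refine le_trans (csInf_le ⟨0, ?_⟩ ⟨E, hE, hE1, h1, rfl⟩) hle
  rintro _ ⟨E', h1', -, -, rfl⟩
  refine Real.sSup_nonneg ?_
  rintro _ ⟨σ, hσ, rfl⟩
  exact trace_mul_nonneg (hB σ hσ).1 h1'

lemma cFrac_mul_lt {n : ℕ} (hn : 0 < n) {x : EReal} {R : ℝ} :
    cFrac n * x < R ↔ x < ((n * R : ℝ) : EReal) := by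
  have hn' : (0 : ℝ) < n := by exact_mod_cast hn
  have hi : (0 : ℝ) < (n : ℝ)⁻¹ := inv_pos.2 hn'
  unfold cFrac
  induction x with
  | bot =>
    rw [EReal.coe_mul_bot_of_pos hi]
    exact iff_of_true (EReal.bot_lt_coe _) (EReal.bot_lt_coe _)
  | top => rw [EReal.coe_mul_top_of_pos hi]; simp
  | coe x =>
    rw [← EReal.coe_mul, EReal.coe_lt_coe_iff, EReal.coe_lt_coe_iff, inv_mul_lt_iff₀ hn']

/-- Weak converse for composite hypotheses: a sequence of states `ω n`, each of which is at least
as easy to detect as the worst element of `B n`, gives an upper bound on the Stein exponent. -/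
lemma steinExponent_le_liminf {ι : Type*} [Fintype ι] [DecidableEq ι]
    {A B : ∀ n : ℕ, Set (MatN ι n)} {ω : ∀ n : ℕ, MatN ι n} (hω : ∀ n, IsState (ω n))
    (hA : ∀ n, ∀ ρ ∈ A n, IsState ρ)
    (hB : ∀ n, ∀ E : MatN ι n, E.PosSemidef → (1 - E).PosSemidef →
      (ω n * E).trace.re ≤ sSup {x : ℝ | ∃ σ ∈ B n, x = (σ * E).trace.re}) :
    steinExponent A B ≤ liminf (fun n => cFrac n * ⨅ σ ∈ A n, relEnt σ (ω n)) atTop := by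
  by_contra! hlt
  obtain ⟨R, hR1, hR2⟩ := EReal.lt_iff_exists_real_btwn.1 hlt
  obtain ⟨R3, hR3, hR4⟩ := EReal.lt_iff_exists_real_btwn.1 hR2
  rw [EReal.coe_lt_coe_iff] at hR3
  obtain ⟨R', hR5, hR6⟩ := exists_between hR3
  have hfr := (frequently_lt_of_liminf_lt (by isBoundedDefault) hR1).and_eventually
    (eventually_gt_atTop 0)
  have hD : ∃ᶠ n : ℕ in atTop, 0 < n ∧ ∃ σ ∈ A n, suppLE σ (ω n) ∧
      (σ * matLog σ).trace.re - (σ * matLog (ω n)).trace.re < n * R := by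
    refine hfr.mono fun n ⟨h1, h2⟩ => ⟨h2, ?_⟩
    rw [cFrac_mul_lt h2] at h1
    simp only [iInf_lt_iff] at h1
    obtain ⟨σ, hσ, h3⟩ := h1
    have hs : suppLE σ (ω n) := by
      by_contra hs
      rw [relEnt, if_neg hs] at h3
      simp at h3
    rw [relEnt_of_suppLE hs, EReal.coe_lt_coe_iff] at h3
    exact ⟨σ, hσ, hs, h3⟩
  have hR0 : 0 < R := by
    obtain ⟨n, hn, σ, hσ, hs, h⟩ := hD.exists
    have := relEnt_re_nonneg (hA n σ hσ) (hω n) hs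
    have hn' : (0 : ℝ) < n := by exact_mod_cast hn
    exact (mul_pos_iff_of_pos_left hn').1 (lt_of_le_of_lt this h)
  have hR'0 : 0 < R' := hR0.trans hR5
  set c : ℝ := (1 - R / R') / 4 with hc
  have hc0 : 0 < c := by
    have : R / R' < 1 := (div_lt_one hR'0).2 hR5
    rw [hc]; linarith
  have hc1 : c < 1 := by
    have : 0 < R / R' := div_pos hR0 hR'0
    rw [hc]; linarith
  have hε : c / 2 ∈ Set.Ioo (0 : ℝ) 1 := ⟨by linarith, by linarith⟩
  have hlarge1 : ∀ᶠ n : ℕ in atTop, 1 ≤ (n : ℝ) * (2 * c * R') := by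
    have : Tendsto (fun n : ℕ => (n : ℝ) * (2 * c * R')) atTop atTop :=
      tendsto_natCast_atTop_atTop.atTop_mul_const (by positivity)
    exact this.eventually_ge_atTop 1
  have hlarge2 : ∀ᶠ n : ℕ in atTop, -Real.log (c / 2) ≤ (n : ℝ) * (R3 - R') := by
    have : Tendsto (fun n : ℕ => (n : ℝ) * (R3 - R')) atTop atTop :=
      tendsto_natCast_atTop_atTop.atTop_mul_const (by linarith)
    exact this.eventually_ge_atTop _
  have hfin : liminf (fun n : ℕ => cFrac n * negLog (typeII (A n) (B n) (c / 2))) atTop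
      ≤ (R3 : EReal) := by
    refine liminf_le_of_frequently_le' ((hD.and_eventually (hlarge1.and hlarge2)).mono ?_)
    rintro n ⟨⟨hn, σ, hσ, hs, hd⟩, h1, h2⟩
    have hn' : (0 : ℝ) < n := by exact_mod_cast hn
    have hT : 0 < (n : ℝ) * R' := mul_pos hn' hR'0
    have hlow : c / 2 * Real.exp (-(n * R')) ≤ typeII (A n) (B n) (c / 2) := by
      refine le_typeII (by linarith) fun E hE hE1 hI => ?_
      have h3 := test_bound (hA n σ hσ) (hω n) hs hE hE1 hT
      have h4 := hI σ hσ
      have h5 := hB n E hE hE1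
      set s := sSup {x : ℝ | ∃ σ ∈ B n, x = (σ * E).trace.re}
      have h6 := mul_le_mul_of_nonneg_left h5 (Real.exp_pos (n * R')).le
      set d := (σ * matLog σ).trace.re - (σ * matLog (ω n)).trace.re
      have h7 : (d + 1) / (n * R') ≤ R / R' + 2 * c := by
        rw [div_le_iff₀ hT]
        have : (R / R' + 2 * c) * (n * R') = n * R + n * (2 * c * R') := by
          field_simp
        rw [this]; linarith
      have h8 : c / 2 ≤ Real.exp (n * R') * s := by
        have : R / R' = 1 - 4 * c := by rw [hc]; ring
        linarith
      rw [Real.exp_neg, ← div_eq_mul_inv, div_le_iff₀ (Real.exp_pos _)]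
      linarith
    have hpos : 0 < c / 2 * Real.exp (-(n * R')) := by positivity
    have hlog := Real.log_le_log hpos hlow
    rw [Real.log_mul (by positivity) (Real.exp_pos _).ne', Real.log_exp] at hlog
    rw [negLog, if_neg (not_le.2 (hpos.trans_le hlow)), cFrac, ← EReal.coe_mul,
      EReal.coe_le_coe_iff, inv_mul_le_iff₀ hn']
    nlinarith
  have hS : steinExponent A B
      ≤ liminf (fun n : ℕ => cFrac n * negLog (typeII (A n) (B n) (c / 2))) atTop :=
    iInf₂_le (c / 2) hε
  exact absurd hR4 (not_lt.2 (hS.trans hfin))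

end Converse

section Spanner

/-- Barycentric spanners: a compact subset `C` of a finite-dimensional real vector space contains
finitely many vectors such that every element of `C` is a linear combination of them with
coefficients in `[-1, 1]`. -/
lemma exists_barycentric_spanner {V : Type*} [AddCommGroup V] [Module ℝ V] [TopologicalSpace V]
    [IsTopologicalAddGroup V] [ContinuousSMul ℝ V] [T2Space V] [FiniteDimensional ℝ V]
    {C : Set V} (hC : IsCompact C) :
    ∃ v : Fin (Module.finrank ℝ (Submodule.span ℝ C)) → V, (∀ i, v i ∈ C) ∧
      ∀ x ∈ C, ∃ c : Fin (Module.finrank ℝ (Submodule.span ℝ C)) → ℝ,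
        (∀ i, |c i| ≤ 1) ∧ x = ∑ i, c i • v i := by
  obtain ⟨f, hfC, hspan, hli⟩ := Submodule.exists_fun_fin_finrank_span_eq ℝ C
  generalize Module.finrank ℝ (Submodule.span ℝ C) = N at f hfC hspan hli ⊢
  set T : (Fin N → ℝ) →ₗ[ℝ] V := Fintype.linearCombination ℝ f with hT
  have hTapp : ∀ c, T c = ∑ i, c i • f i := fun c => Fintype.linearCombination_apply ℝ f c
  have hker : LinearMap.ker T = ⊥ :=
    LinearMap.ker_eq_bot.2 (linearIndependent_iff_injective_fintypeLinearCombination.1 hli)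
  obtain ⟨π, hπ⟩ := LinearMap.exists_leftInverse_of_injective T hker
  have hπT : ∀ c, π (T c) = c := fun c => LinearMap.congr_fun hπ c
  have hTπ : ∀ x ∈ C, T (π x) = x := by
    intro x hx
    have hx' : x ∈ LinearMap.range T := by
      rw [hT, Fintype.range_linearCombination, hspan]
      exact Submodule.subset_span hx
    obtain ⟨c, rfl⟩ := hx'
    rw [hπT]
  have hπc : Continuous π := LinearMap.continuous_of_finiteDimensional π
  let A : (Fin N → V) → Matrix (Fin N) (Fin N) ℝ := fun v => Matrix.of fun j i => π (v i) j
  have hA : Continuous fun v => |(A v).det| := by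
    refine (Continuous.matrix_det ?_).abs
    refine continuous_matrix fun j i => ?_
    exact (continuous_apply j).comp (hπc.comp (continuous_apply i))
  have hK : IsCompact (Set.pi Set.univ fun _ : Fin N => C) := isCompact_univ_pi fun _ => hC
  obtain ⟨v, hvK, hmax⟩ := hK.exists_isMaxOn ⟨f, fun i _ => hfC i⟩ hA.continuousOn
  have hvC : ∀ i, v i ∈ C := fun i => hvK i trivial
  have hdet1 : 1 ≤ |(A v).det| := by
    have h1 := hmax (show f ∈ Set.pi Set.univ fun _ : Fin N => C from fun i _ => hfC i)
    have h2 : A f = 1 := by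
      ext j i
      have : f i = T (Pi.single i 1) := by
        rw [hTapp, Finset.sum_eq_single i] <;> simp +contextual [Pi.single_apply]
      simp only [A, Matrix.of_apply]
      rw [this, hπT, Matrix.one_apply, Pi.single_apply]
    simp only [Set.mem_ofPred_eq, h2, Matrix.det_one, abs_one] at h1
    exact h1
  have hdet0 : (A v).det ≠ 0 := by
    intro h; rw [h] at hdet1; norm_num at hdet1
  refine ⟨v, hvC, fun x hx => ⟨fun i => (A v).cramer (π x) i / (A v).det, fun i => ?_, ?_⟩⟩
  · rw [abs_div, div_le_one (by linarith)]
    have h1 := hmax (show Function.update v i x ∈ Set.pi Set.univ fun _ : Fin N => C by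
      intro j _
      by_cases hj : j = i
      · subst hj; simpa using hx
      · simpa [Function.update_of_ne hj] using hvC j)
    have h2 : A (Function.update v i x) = (A v).updateCol i (π x) := by
      ext j l
      simp only [A, Matrix.of_apply, Matrix.updateCol_apply, Function.update_apply]
      split_ifs <;> rfl
    simp only [Set.mem_ofPred_eq, h2] at h1
    rw [Matrix.cramer_apply]
    exact h1
  · refine (hTπ x hx).symm.trans ?_
    have h1 : π x = ∑ i, ((A v).cramer (π x) i / (A v).det) • π (v i) := by
      have h2 := Matrix.mulVec_cramer (A v) (π x)
      ext j
      have h3 := congrFun h2 j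
      simp only [Matrix.mulVec, dotProduct, Pi.smul_apply, smul_eq_mul] at h3
      rw [Finset.sum_apply]
      simp only [Pi.smul_apply, smul_eq_mul]
      have h4 : ∀ i, (A v).cramer (π x) i / (A v).det * π (v i) j
          = (A v j i * (A v).cramer (π x) i) / (A v).det := by
        intro i
        simp only [A, Matrix.of_apply]
        ring
      simp only [h4]
      rw [← Finset.sum_div, h3, mul_div_cancel_left₀ _ hdet0]
    refine (congrArg T h1).trans ?_
    rw [map_sum]
    refine Finset.sum_congr rfl fun i _ => ?_
    rw [map_smul, hTπ _ (hvC i)]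

end Spanner

section Symmetric

variable {ι : Type*} [Fintype ι] [DecidableEq ι]

/-- The number of positions `k` at which the pair `(i k, j k)` takes a given value. -/
def pairCount (n : ℕ) (i j : Fin n → ι) (p : ι × ι) : Fin (n + 1) :=
  ⟨(Finset.univ.filter fun k => (i k, j k) = p).card,
    Nat.lt_succ_of_le ((Finset.card_le_univ _).trans (Fintype.card_fin n).le)⟩

/-- Matrices whose `(i, j)` entry is a function of `pairCount n i j`. -/
def countMap (ι : Type*) [Fintype ι] [DecidableEq ι] (n : ℕ) :
    ((ι × ι → Fin (n + 1)) → ℂ) →ₗ[ℝ] MatN ι n where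
  toFun g := Matrix.of fun i j => g (pairCount n i j)
  map_add' _ _ := rfl
  map_smul' _ _ := rfl

/-- An upper bound on the real dimension of the space of permutation invariant matrices. -/
def symDim (ι : Type*) [Fintype ι] (n : ℕ) : ℕ :=
  2 * (n + 1) ^ (Fintype.card ι * Fintype.card ι)

lemma finrank_range_countMap_le (n : ℕ) :
    Module.finrank ℝ (LinearMap.range (countMap ι n)) ≤ symDim ι n := by
  refine (LinearMap.finrank_range_le _).trans (le_of_eq ?_)
  rw [Module.finrank_pi_fintype]
  simp [symDim, mul_comm]

lemma tensorPow_mem_range (A : MatC ι) (n : ℕ) :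
    tensorPow A n ∈ LinearMap.range (countMap ι n) := by
  refine ⟨fun c => ∏ p : ι × ι, A p.1 p.2 ^ (c p : ℕ), ?_⟩
  ext i j
  change ∏ p : ι × ι, A p.1 p.2 ^ ((pairCount n i j p : Fin (n + 1)) : ℕ) = ∏ k, A (i k) (j k)
  rw [← Finset.prod_fiberwise' Finset.univ (fun k => (i k, j k)) (fun p => A p.1 p.2)]
  refine Finset.prod_congr rfl fun p _ => ?_
  rw [Finset.prod_const]
  rfl

lemma exists_perm_of_pairCount_eq {n : ℕ} {i j i' j' : Fin n → ι}
    (h : pairCount n i j = pairCount n i' j') :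
    ∃ π : Equiv.Perm (Fin n), i' ∘ π = i ∧ j' ∘ π = j := by
  have e : ∀ c : ι × ι, Nonempty ({k // (i k, j k) = c} ≃ {k // (i' k, j' k) = c}) := by
    intro c
    refine ⟨Fintype.equivOfCardEq ?_⟩
    have := congrArg Fin.val (congrFun h c)
    rw [Fintype.card_subtype, Fintype.card_subtype]
    exact this
  let π : Equiv.Perm (Fin n) := Equiv.ofFiberEquiv fun c => (e c).some
  have hπ : ∀ k, (i' (π k), j' (π k)) = (i k, j k) := fun k =>
    Equiv.ofFiberEquiv_map (f := fun k => (i k, j k)) (g := fun k => (i' k, j' k))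
      (fun c => (e c).some) k
  exact ⟨π, funext fun k => (Prod.ext_iff.1 (hπ k)).1, funext fun k => (Prod.ext_iff.1 (hπ k)).2⟩

lemma mem_range_countMap {n : ℕ} {M : MatN ι n}
    (hM : ∀ π : Equiv.Perm (Fin n), permCopies π M = M) : M ∈ LinearMap.range (countMap ι n) := by
  classical
  refine ⟨fun c => if h : ∃ p : (Fin n → ι) × (Fin n → ι), pairCount n p.1 p.2 = c
    then M h.choose.1 h.choose.2 else 0, ?_⟩
  ext i j
  have h : ∃ p : (Fin n → ι) × (Fin n → ι), pairCount n p.1 p.2 = pairCount n i j := ⟨(i, j), rfl⟩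
  change (if h : ∃ p : (Fin n → ι) × (Fin n → ι), pairCount n p.1 p.2 = pairCount n i j
    then M h.choose.1 h.choose.2 else 0) = M i j
  rw [dif_pos h]
  obtain ⟨π, h1, h2⟩ := exists_perm_of_pairCount_eq h.choose_spec
  rw [← h1, ← h2]
  exact congrFun (congrFun (hM π) i) j

end Symmetric

section Universal

variable {ι : Type*} [Fintype ι] [DecidableEq ι] {F : Set (MatC ι)}

lemma exists_iid_cover (hF : ∀ ρ ∈ F, IsState ρ) (hne : F.Nonempty) (hcpt : IsCompact F) (n : ℕ) :
    ∃ v : Fin (symDim ι n) → MatC ι, (∀ i, v i ∈ F) ∧ ∀ ρ ∈ F, ∀ E : MatN ι n, E.PosSemidef →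
      (tensorPow ρ n * E).trace.re ≤ ∑ i, (tensorPow (v i) n * E).trace.re := by
  have hcont : Continuous fun ρ : MatC ι => tensorPow ρ n :=
    continuous_matrix fun i j => continuous_finsetProd _ fun k _ => continuous_id.matrix_elem _ _
  obtain ⟨w, hw, hspan⟩ := exists_barycentric_spanner (hcpt.image hcont)
  have hN : Module.finrank ℝ (Submodule.span ℝ ((fun ρ : MatC ι => tensorPow ρ n) '' F))
      ≤ symDim ι n := by
    refine (Submodule.finrank_mono ?_).trans (finrank_range_countMap_le n)
    rw [Submodule.span_le]
    rintro _ ⟨ρ, -, rfl⟩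
    exact tensorPow_mem_range ρ n
  generalize Module.finrank ℝ (Submodule.span ℝ ((fun ρ : MatC ι => tensorPow ρ n) '' F)) = N
    at w hw hspan hN
  choose v hvF hv using hw
  obtain ⟨ρ0, hρ0⟩ := hne
  let v' : Fin (symDim ι n) → MatC ι := fun i => if h : (i : ℕ) < N then v ⟨i, h⟩ else ρ0
  have hv'F : ∀ i, v' i ∈ F := by
    intro i
    simp only [v']
    split_ifs
    · exact hvF _
    · exact hρ0
  refine ⟨v', hv'F, fun ρ hρ E hE => ?_⟩
  obtain ⟨c, hc, hsum⟩ := hspan _ ⟨ρ, hρ, rfl⟩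
  have hpos : ∀ i, 0 ≤ (tensorPow (v' i) n * E).trace.re := fun i =>
    trace_mul_nonneg (tensorPow_isState (hF _ (hv'F i)) n).1 hE
  have hcast : ∀ i : Fin N, v' (Fin.castLE hN i) = v i := by
    intro i
    simp [v']
  calc (tensorPow ρ n * E).trace.re
      = ∑ i, c i * (tensorPow (v' (Fin.castLE hN i)) n * E).trace.re := by
        simp only at hsum
        rw [hsum, Matrix.sum_mul, Matrix.trace_sum, Complex.re_sum]
        refine Finset.sum_congr rfl fun i _ => ?_
        rw [Matrix.smul_mul, Matrix.trace_smul, Complex.smul_re, ← hv i, hcast, smul_eq_mul]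
    _ ≤ ∑ i : Fin N, (tensorPow (v' (Fin.castLE hN i)) n * E).trace.re := by
        refine Finset.sum_le_sum fun i _ => ?_
        have := (abs_le.1 (hc i)).2
        nlinarith [hpos (Fin.castLE hN i)]
    _ ≤ ∑ i, (tensorPow (v' i) n * E).trace.re := by
        rw [← Finset.sum_image (s := Finset.univ) (g := Fin.castLE hN)
          (f := fun i => (tensorPow (v' i) n * E).trace.re)
          (fun a _ b _ h => Fin.castLE_injective hN h)]
        exact Finset.sum_le_sum_of_subset_of_nonneg (Finset.subset_univ _) fun i _ _ => hpos i

/-- A probability measure on `F` whose i.i.d. mixtures dominate every `ρ^{⊗n}`, `ρ ∈ F`, up to a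
polynomial factor. -/
lemma exists_universal_measure (hF : ∀ ρ ∈ F, IsState ρ) (hne : F.Nonempty) (hcpt : IsCompact F) :
    ∃ μ : Measure ↥F, IsProbabilityMeasure μ ∧ ∃ Z : ℝ, 0 < Z ∧ ∀ n : ℕ, ∀ ρ ∈ F,
      ∀ E : MatN ι n, E.PosSemidef → (tensorPow ρ n * E).trace.re
        ≤ Z * (((n : ℝ) + 1) ^ 2 * symDim ι n) * (iidMix μ n * E).trace.re := by
  obtain ⟨ρ0, hρ0⟩ := id hne
  have hι : Nonempty ι := by
    by_contra h
    rw [not_nonempty_iff] at h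
    have := (hF ρ0 hρ0).2
    simp [Matrix.trace] at this
  have hq : ∀ n, 0 < symDim ι n := fun n => by unfold symDim; positivity
  choose v hvF hv using exists_iid_cover hF hne hcpt
  let u : ℕ → ℝ := fun n => (((n : ℝ) + 1) ^ 2 * symDim ι n)⁻¹
  have hu : ∀ n, 0 < u n := fun n => by
    have := hq n
    simp only [u]; positivity
  let ν : ℕ → Measure ↥F := fun n => ∑ i, Measure.dirac (⟨v n i, hvF n i⟩ : ↥F)
  let M : Measure ↥F := Measure.sum fun n => ENNReal.ofReal (u n) • ν n
  have hν : ∀ n, ν n Set.univ = symDim ι n := by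
    intro n
    simp [ν]
  have hM : M Set.univ = ENNReal.ofReal (∑' n : ℕ, ((((n : ℝ) + 1) ^ 2)⁻¹)) := by
    have hs : Summable fun n : ℕ => (((n : ℝ) + 1) ^ 2)⁻¹ := by
      have := (summable_nat_add_iff 1).2 (Real.summable_nat_pow_inv.2 (one_lt_two))
      simpa using this
    rw [ENNReal.ofReal_tsum_of_nonneg (fun n => by positivity) hs]
    simp only [M]
    rw [Measure.sum_apply _ MeasurableSet.univ]
    refine tsum_congr fun n => ?_
    rw [Measure.smul_apply, hν, smul_eq_mul, ← ENNReal.ofReal_natCast,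
      ← ENNReal.ofReal_mul (hu n).le]
    congr 1
    have := hq n
    simp only [u]
    field_simp
  have hMtop : M Set.univ ≠ ⊤ := by rw [hM]; exact ENNReal.ofReal_ne_top
  have hM0 : M Set.univ ≠ 0 := by
    intro h0
    have h1 : ENNReal.ofReal (u 0) • ν 0 ≤ M := Measure.le_sum (fun n => ENNReal.ofReal (u n) • ν n) 0
    have h2 := h1 Set.univ
    rw [h0, Measure.smul_apply, hν, smul_eq_mul, nonpos_iff_eq_zero, mul_eq_zero] at h2
    rcases h2 with h2 | h2
    · rw [ENNReal.ofReal_eq_zero] at h2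
      exact absurd (hu 0) (not_lt.2 h2)
    · have := hq 0
      simp only [Nat.cast_eq_zero] at h2
      omega
  let μ : Measure ↥F := (M Set.univ)⁻¹ • M
  have hμ : IsProbabilityMeasure μ := ⟨by
    simp only [μ]
    rw [Measure.smul_apply, smul_eq_mul, ENNReal.inv_mul_cancel hM0 hMtop]⟩
  refine ⟨μ, hμ, (M Set.univ).toReal, ENNReal.toReal_pos hM0 hMtop, fun n ρ hρ E hE => ?_⟩
  obtain ⟨hi, he⟩ := trace_iidMix_mul μ hF n E
  have h2 : (iidMix μ n * E).trace.re
      = ∫ σ : ↥F, ((tensorPow (σ : MatC ι) n * E).trace).re ∂μ := by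
    rw [he]; exact (integral_re hi).symm
  set c := (M Set.univ)⁻¹ * ENNReal.ofReal (u n) with hc
  have hle : c • ν n ≤ μ := by
    have h1 : ENNReal.ofReal (u n) • ν n ≤ M := Measure.le_sum (fun n => ENNReal.ofReal (u n) • ν n) n
    rw [hc, mul_smul]
    intro s
    simp only [μ]
    rw [Measure.smul_apply, Measure.smul_apply (M Set.univ)⁻¹ M]
    exact mul_le_mul_right (h1 s) _
  have hmeas : StronglyMeasurable fun σ : ↥F => ((tensorPow (σ : MatC ι) n * E).trace).re := by
    refine Measurable.stronglyMeasurable ?_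
    refine Complex.measurable_re.comp ?_
    simp only [Matrix.trace, Matrix.diag, Matrix.mul_apply]
    exact Finset.measurable_sum _ fun i _ => Finset.measurable_sum _ fun j _ =>
      (measurable_tensorPow_entry n i j).mul_const _
  have h3 : ∫ σ : ↥F, ((tensorPow (σ : MatC ι) n * E).trace).re ∂(c • ν n)
      ≤ ∫ σ : ↥F, ((tensorPow (σ : MatC ι) n * E).trace).re ∂μ := by
    refine integral_mono_measure hle (Eventually.of_forall fun σ => ?_) hi.re
    exact trace_mul_nonneg (tensorPow_isState (hF _ σ.2) n).1 hE
  rw [integral_smul_measure] at h3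
  simp only [ν] at h3
  rw [integral_finsetSum_measure] at h3
  · simp only [integral_dirac' _ _ hmeas] at h3
    rw [← h2, hc, ENNReal.toReal_mul, ENNReal.toReal_inv, ENNReal.toReal_ofReal (hu n).le,
      smul_eq_mul] at h3
    refine (hv n ρ hρ E hE).trans ?_
    have hZ := ENNReal.toReal_pos hM0 hMtop
    have hq' : (0 : ℝ) < symDim ι n := by exact_mod_cast hq n
    have h4 := mul_le_mul_of_nonneg_left h3
      (show 0 ≤ (M Set.univ).toReal * (((n : ℝ) + 1) ^ 2 * symDim ι n) by positivity)
    refine le_trans (le_of_eq ?_) h4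
    simp only [u]
    field_simp
  · intro i _
    exact integrable_dirac' hmeas (by simp)

end Universal

section EigenvalueCount

variable {κ : Type*} [Fintype κ] [DecidableEq κ]

lemma specM_congr_of_eq {U V : Matrix κ κ ℂ} (hU : IsUni U) (hV : IsUni V) {a b : κ → ℝ}
    (h : specM U a = specM V b) (g : ℝ → ℝ) :
    specM U (fun x => g (a x)) = specM V (fun y => g (b y)) := by
  have key : ∀ f f' : κ → ℝ, star U * (specM U f - specM V f') * V
      = Matrix.of fun x y => ((f x - f' y : ℝ) : ℂ) * (star U * V) x y := by
    intro f f'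
    have e : star U * (specM U f - specM V f') * V
        = Matrix.diagonal (fun i => (f i : ℂ)) * (star U * V)
          - (star U * V) * Matrix.diagonal (fun i => (f' i : ℂ)) := by
      calc star U * (specM U f - specM V f') * V
          = (star U * U) * Matrix.diagonal (fun i => (f i : ℂ)) * (star U * V)
            - (star U * V) * Matrix.diagonal (fun i => (f' i : ℂ)) * (star V * V) := by
            unfold specM
            simp only [Matrix.mul_sub, Matrix.sub_mul, Matrix.mul_assoc]
        _ = _ := by rw [hU.1, hV.1, Matrix.one_mul, Matrix.mul_one]
    rw [e]
    ext x y
    rw [Matrix.sub_apply, Matrix.diagonal_mul, Matrix.mul_diagonal, Matrix.of_apply]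
    push_cast
    ring
  have h0 := key a b
  rw [h, sub_self, Matrix.mul_zero, Matrix.zero_mul] at h0
  have h1 : star U * (specM U (fun x => g (a x)) - specM V (fun y => g (b y))) * V = 0 := by
    rw [key]
    ext x y
    have h2 := congrFun (congrFun h0 x) y
    rw [Matrix.of_apply] at h2 ⊢
    rw [Matrix.zero_apply] at h2 ⊢
    rcases mul_eq_zero.1 h2.symm with h3 | h3
    · have h4 : a x = b y := by
        have : a x - b y = 0 := by exact_mod_cast h3
        linarith
      rw [h4, sub_self, Complex.ofReal_zero, zero_mul]
    · rw [h3, mul_zero]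
  have h2 : specM U (fun x => g (a x)) - specM V (fun y => g (b y)) = 0 := by
    generalize specM U (fun x => g (a x)) - specM V (fun y => g (b y)) = D at h1 ⊢
    calc D = (U * star U) * D * (V * star V) := by rw [hU.2, hV.2, Matrix.one_mul, Matrix.mul_one]
      _ = U * (star U * D * V) * star V := by simp only [Matrix.mul_assoc]
      _ = 0 := by rw [h1, Matrix.mul_zero, Matrix.zero_mul]
  exact sub_eq_zero.1 h2

lemma matLog_specM {U : Matrix κ κ ℂ} (hU : IsUni U) (a : κ → ℝ) :
    matLog (specM U a) = specM U (fun x => Real.log (a x)) := by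
  have hH := specM_isHermitian U a
  rw [matLog_eq hH]
  exact specM_congr_of_eq (isUni_eigenvectorUnitary hH) hU (eq_specM hH).symm Real.log

lemma permCopies_specM {ι : Type*} [Fintype ι] [DecidableEq ι] {n : ℕ}
    {U : MatN ι n} (hU : IsUni U) (π : Equiv.Perm (Fin n)) :
    ∃ V : MatN ι n, IsUni V ∧ ∀ a, permCopies π (specM U a) = specM V a := by
  let e : (Fin n → ι) ≃ (Fin n → ι) := Equiv.arrowCongr π.symm (Equiv.refl ι)
  have he : ∀ i, e i = i ∘ π := fun i => rfl
  refine ⟨U.submatrix e (Equiv.refl _), ⟨?_, ?_⟩, ?_⟩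
  · rw [Matrix.star_eq_conjTranspose, Matrix.conjTranspose_submatrix, Matrix.submatrix_mul_equiv,
      ← Matrix.star_eq_conjTranspose, hU.1]
    exact Matrix.submatrix_one_equiv _
  · rw [Matrix.star_eq_conjTranspose, Matrix.conjTranspose_submatrix, Matrix.submatrix_mul_equiv,
      ← Matrix.star_eq_conjTranspose, hU.2]
    exact Matrix.submatrix_one_equiv _
  · intro a
    have : permCopies π (specM U a) = (specM U a).submatrix e e := rfl
    rw [this, specM, specM, Matrix.star_eq_conjTranspose, Matrix.star_eq_conjTranspose,
      Matrix.conjTranspose_submatrix,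
      ← Matrix.submatrix_mul_equiv (U * _) _ e (Equiv.refl _) e,
      ← Matrix.submatrix_mul_equiv U _ e (Equiv.refl _) (Equiv.refl _)]
    rfl

lemma card_image_le_symDim {ι : Type*} [Fintype ι] [DecidableEq ι] {n : ℕ}
    {U : MatN ι n} (hU : IsUni U) {a : (Fin n → ι) → ℝ}
    (h : ∀ π : Equiv.Perm (Fin n), permCopies π (specM U a) = specM U a) :
    (Finset.univ.image a).card ≤ symDim ι n := by
  refine le_trans ?_ (finrank_range_countMap_le (ι := ι) n)
  have hmem : ∀ x, a x ∈ Finset.univ.image a := fun x => Finset.mem_image_of_mem _ (Finset.mem_univ x)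
  have hinv : ∀ g : ℝ → ℝ, specM U (fun x => g (a x)) ∈ LinearMap.range (countMap ι n) := by
    intro g
    refine mem_range_countMap fun π => ?_
    obtain ⟨V, hV, e⟩ := permCopies_specM hU π
    rw [e]
    refine specM_congr_of_eq hV hU ?_ g
    rw [← e, h π]
  let L : (↥(Finset.univ.image a) → ℝ) →ₗ[ℝ] ↥(LinearMap.range (countMap ι n)) :=
    { toFun := fun g => ⟨specM U (fun x => g ⟨a x, hmem x⟩), by
        have := hinv fun r => if hr : r ∈ Finset.univ.image a then g ⟨r, hr⟩ else 0
        simpa only [hmem, dif_pos] using this⟩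
      map_add' := fun g g' => Subtype.ext (specM_add U _ _).symm
      map_smul' := fun c g => Subtype.ext (by
        change specM U (fun x => c * g ⟨a x, hmem x⟩) = c • specM U (fun x => g ⟨a x, hmem x⟩)
        rw [← specM_smul]
        ext i j
        simp) }
  have hL : Function.Injective L := by
    intro g g' hg
    have h1 : specM U (fun x => g ⟨a x, hmem x⟩) = specM U (fun x => g' ⟨a x, hmem x⟩) :=
      congrArg Subtype.val hg
    have h2 := specM_conj hU (fun x => g ⟨a x, hmem x⟩)
    rw [h1, specM_conj hU, Matrix.diagonal_eq_diagonal_iff] at h2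
    funext ⟨r, hr⟩
    obtain ⟨x, -, hx⟩ := Finset.mem_image.1 hr
    subst hx
    exact_mod_cast (h2 x).symm
  have := LinearMap.finrank_le_finrank_of_injective hL
  rwa [Module.finrank_fintype_fun_eq_card, Fintype.card_coe] at this

lemma permCopies_iidMix {ι : Type*} {C : Set (MatC ι)} (μ : Measure ↥C) (n : ℕ)
    (π : Equiv.Perm (Fin n)) : permCopies π (iidMix μ n) = iidMix μ n := by
  ext i j
  change ∫ σ : ↥C, (∏ k, (σ : MatC ι) (i (π k)) (j (π k))) ∂μ = ∫ σ : ↥C, (∏ k, (σ : MatC ι) (i k) (j k)) ∂μ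
  congr 1
  funext σ
  exact Equiv.prod_comp π fun k => (σ : MatC ι) (i k) (j k)

end EigenvalueCount

section Regularisation

variable {κ : Type*} [Fintype κ] [DecidableEq κ]

lemma specM_diag_nonneg {X : Matrix κ κ ℂ} (hX : X.PosSemidef) (V : Matrix κ κ ℂ) (y : κ) :
    0 ≤ ((star V * X * V) y y).re := by
  have := hX.conjTranspose_mul_mul_same V
  rw [← Matrix.star_eq_conjTranspose] at this
  exact (Complex.le_def.1 this.diag_nonneg).1

lemma continuous_trace_mul (M : Matrix κ κ ℂ) :
    Continuous fun X : Matrix κ κ ℂ => (X * M).trace.re :=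
  Complex.continuous_re.comp (Continuous.matrix_trace (continuous_id.matrix_mul continuous_const))

/-- Affine minorants of the negative entropy which are almost tight at a given state. -/
lemma exists_affine_minorant {X : Matrix κ κ ℂ} (hX : IsState X) {t : ℝ} (ht : 0 < t) :
    ∃ L : Matrix κ κ ℂ, (∀ Y : Matrix κ κ ℂ, IsState Y →
        (Y * L).trace.re - t * Fintype.card κ ≤ (Y * matLog Y).trace.re) ∧
      (X * matLog X).trace.re ≤ (X * L).trace.re := by
  obtain ⟨U, a, hU, ha, eX, lX, -⟩ := exists_spec hX.1
  have hpos : ∀ x, 0 < a x + t := fun x => by have := ha x; linarith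
  refine ⟨specM U fun x => Real.log (a x + t), fun Y hY => ?_, ?_⟩
  · have h := klein hY.1 (specM_posDef hU hpos)
    have ht' : ∑ x, a x = 1 := by rw [← trace_specM hU, ← eX, hX.2, Complex.one_re]
    rw [matLog_specM hU, trace_specM hU, hY.2, Complex.one_re, Finset.sum_add_distrib, ht'] at h
    simp only [Finset.sum_const, Finset.card_univ, nsmul_eq_mul] at h
    linarith
  · rw [lX, eX, specM_mul hU, specM_mul hU, trace_specM hU, trace_specM hU]
    refine Finset.sum_le_sum fun x _ => ?_
    rcases (ha x).eq_or_lt with h0 | h0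
    · rw [← h0]; simp
    · exact mul_le_mul_of_nonneg_left (Real.log_le_log h0 (by linarith)) h0.le

lemma exists_affine_minorant_of_lt_relEnt {σ₀ : Matrix κ κ ℂ} (hσ₀ : IsState σ₀)
    {V : Matrix κ κ ℂ} (hV : IsUni V) {b : κ → ℝ} {R : ℝ}
    (hR : (R : EReal) < relEnt σ₀ (specM V b)) :
    ∃ (t : ℝ) (L : Matrix κ κ ℂ) (M : ℝ),
      (∀ Y : Matrix κ κ ℂ, IsState Y → (Y * L).trace.re - t ≤ (Y * matLog Y).trace.re) ∧
      R < (σ₀ * L).trace.re - t - ∑ y, (if b y = 0 then -M else Real.log (b y)) *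
        ((star V * σ₀ * V) y y).re := by
  by_cases hsupp : suppLE σ₀ (specM V b)
  · rw [relEnt_of_suppLE hsupp, EReal.coe_lt_coe_iff, matLog_specM hV, trace_mul_specM] at hR
    obtain ⟨gap, hgapdef⟩ : ∃ gap, gap = (σ₀ * matLog σ₀).trace.re
      - ∑ y, Real.log (b y) * ((star V * σ₀ * V) y y).re - R := ⟨_, rfl⟩
    have hgap : 0 < gap := by rw [hgapdef]; linarith
    have hc : (0 : ℝ) ≤ Fintype.card κ := Nat.cast_nonneg _
    have ht : 0 < gap / (Fintype.card κ + 1) := by positivity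
    obtain ⟨L, hL, hL'⟩ := exists_affine_minorant hσ₀ ht
    refine ⟨_, L, 0, hL, ?_⟩
    have h2 : gap / (Fintype.card κ + 1) * Fintype.card κ < gap := by
      rw [div_mul_eq_mul_div, div_lt_iff₀ (by positivity)]
      nlinarith
    have h3 : ∑ y, (if b y = 0 then -0 else Real.log (b y)) * ((star V * σ₀ * V) y y).re
        = ∑ y, Real.log (b y) * ((star V * σ₀ * V) y y).re := by
      refine Finset.sum_congr rfl fun y _ => ?_
      split_ifs with h
      · rw [h]; simp
      · rfl
    rw [h3]
    linarith
  · obtain ⟨L, hL, -⟩ := exists_affine_minorant hσ₀ one_pos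
    obtain ⟨y₀, hy₀, hy₀'⟩ : ∃ y, b y = 0 ∧ ((star V * σ₀ * V) y y).re ≠ 0 := by
      by_contra! hcon
      exact hsupp (suppLE_of_diag_zero hσ₀.1 hV hcon)
    have hy₁ : 0 < ((star V * σ₀ * V) y₀ y₀).re :=
      lt_of_le_of_ne (specM_diag_nonneg hσ₀.1 V y₀) (Ne.symm hy₀')
    obtain ⟨K, hK⟩ : ∃ K, K = R - (σ₀ * L).trace.re + 1 * Fintype.card κ
      + ∑ y, Real.log (b y) * ((star V * σ₀ * V) y y).re := ⟨_, rfl⟩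
    refine ⟨_, L, (|K| + 1) / ((star V * σ₀ * V) y₀ y₀).re, hL, ?_⟩
    have h1 : ∑ y, (if b y = 0 then -((|K| + 1) / ((star V * σ₀ * V) y₀ y₀).re)
          else Real.log (b y)) * ((star V * σ₀ * V) y y).re
        ≤ ∑ y, (Real.log (b y) * ((star V * σ₀ * V) y y).re - if y = y₀ then |K| + 1 else 0) := by
      refine Finset.sum_le_sum fun y _ => ?_
      have hsy := specM_diag_nonneg hσ₀.1 V y
      by_cases h : y = y₀
      · rw [h, if_pos hy₀, if_pos rfl, hy₀, Real.log_zero, neg_mul,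
          div_mul_cancel₀ _ hy₁.ne']
        linarith
      · rw [if_neg h, sub_zero]
        refine mul_le_mul_of_nonneg_right ?_ hsy
        split_ifs with hb0
        · rw [hb0, Real.log_zero]
          have : 0 ≤ (|K| + 1) / ((star V * σ₀ * V) y₀ y₀).re := by positivity
          linarith
        · rfl
    rw [Finset.sum_sub_distrib, Finset.sum_ite_eq' , if_pos (Finset.mem_univ _)] at h1
    have h2 := le_abs_self K
    linarith

lemma eventually_nhds_lt_regularised {σ₀ : Matrix κ κ ℂ} (hσ₀ : IsState σ₀)
    {V : Matrix κ κ ℂ} (hV : IsUni V) {b : κ → ℝ} {R : ℝ}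
    (hR : (R : EReal) < relEnt σ₀ (specM V b)) {q : ℝ} (hq : 0 < q) :
    ∀ᶠ p in 𝓝 σ₀ ×ˢ 𝓝[>] (0 : ℝ), IsState p.1 → R < (p.1 * matLog p.1).trace.re
      - (p.1 * specM V fun y => Real.log ((1 - p.2) * b y + p.2 * q)).trace.re := by
  have hs : ∀ y, Continuous fun X : Matrix κ κ ℂ => ((star V * X * V) y y).re := fun y =>
    Complex.continuous_re.comp
      (((continuous_const.matrix_mul continuous_id).matrix_mul continuous_const).matrix_elem y y)
  obtain ⟨t, L, M, hL, hM⟩ := exists_affine_minorant_of_lt_relEnt hσ₀ hV hR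
  have hsnd : Tendsto (fun p : Matrix κ κ ℂ × ℝ => p.2) (𝓝 σ₀ ×ˢ 𝓝[>] (0 : ℝ)) (𝓝 0) :=
    tendsto_snd.mono_right nhdsWithin_le_nhds
  have hcont : Tendsto (fun p : Matrix κ κ ℂ × ℝ => (p.1 * L).trace.re - t
      - ∑ y, (if b y = 0 then -M else Real.log ((1 - p.2) * b y + p.2 * q))
        * ((star V * p.1 * V) y y).re)
      (𝓝 σ₀ ×ˢ 𝓝[>] (0 : ℝ)) (𝓝 ((σ₀ * L).trace.re - t
        - ∑ y, (if b y = 0 then -M else Real.log (b y)) * ((star V * σ₀ * V) y y).re)) := by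
    have hfst : Tendsto (fun p : Matrix κ κ ℂ × ℝ => p.1) (𝓝 σ₀ ×ˢ 𝓝[>] (0 : ℝ)) (𝓝 σ₀) :=
      tendsto_fst
    refine ((((continuous_trace_mul L).tendsto σ₀).comp hfst).sub_const t).sub
      (tendsto_finsetSum _ fun y _ => Tendsto.mul ?_ (((hs y).tendsto σ₀).comp hfst))
    split_ifs with h
    · exact tendsto_const_nhds
    · refine Tendsto.log ?_ h
      have := ((tendsto_const_nhds (x := (1 : ℝ))).sub hsnd).mul_const (b y) |>.add
        (hsnd.mul_const q)
      simpa using this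
  have hγ : ∀ᶠ p : Matrix κ κ ℂ × ℝ in 𝓝 σ₀ ×ˢ 𝓝[>] (0 : ℝ), ∀ y,
      Real.log ((1 - p.2) * b y + p.2 * q)
        ≤ if b y = 0 then -M else Real.log ((1 - p.2) * b y + p.2 * q) := by
    have h1 : Tendsto (fun p : Matrix κ κ ℂ × ℝ => p.2 * q) (𝓝 σ₀ ×ˢ 𝓝[>] (0 : ℝ))
        (𝓝[>] (0 : ℝ)) := by
      refine tendsto_nhdsWithin_iff.2 ⟨by simpa using hsnd.mul_const q, ?_⟩
      filter_upwards [tendsto_snd.eventually (self_mem_nhdsWithin (s := Set.Ioi (0 : ℝ)))]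
        with p hp
      exact mul_pos hp hq
    filter_upwards [(Real.tendsto_log_nhdsGT_zero.comp h1).eventually (eventually_le_atBot (-M))]
      with p hp y
    split_ifs with h
    · rw [h, mul_zero, zero_add]
      exact hp
    · rfl
  filter_upwards [hcont.eventually (lt_mem_nhds hM), hγ] with p hp hp' hst
  have h1 := hL p.1 hst
  have h2 : ∑ y, Real.log ((1 - p.2) * b y + p.2 * q) * ((star V * p.1 * V) y y).re
      ≤ ∑ y, (if b y = 0 then -M else Real.log ((1 - p.2) * b y + p.2 * q))
        * ((star V * p.1 * V) y y).re :=
    Finset.sum_le_sum fun y _ =>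
      mul_le_mul_of_nonneg_right (hp' y) (specM_diag_nonneg hst.1 V y)
  rw [trace_mul_specM]
  linarith

/-- Mixing a bit of the maximally mixed state into the second argument does not spoil a uniform
strict lower bound on the relative entropy over a compact set of states. -/
lemma eventually_lt_relEnt_regularised {C : Set (Matrix κ κ ℂ)} (hC : IsCompact C)
    (hCs : ∀ σ ∈ C, IsState σ) {V : Matrix κ κ ℂ} (hV : IsUni V) {b : κ → ℝ}
    {R : ℝ} (hR : ∀ σ ∈ C, (R : EReal) < relEnt σ (specM V b)) {q : ℝ} (hq : 0 < q) :
    ∀ᶠ γ in 𝓝[>] (0 : ℝ), ∀ σ ∈ C, R < (σ * matLog σ).trace.re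
      - (σ * specM V fun y => Real.log ((1 - γ) * b y + γ * q)).trace.re := by
  have h := hC.mem_nhdsSet_prod_of_forall (l := 𝓝[>] (0 : ℝ))
    (s := {p : Matrix κ κ ℂ × ℝ | IsState p.1 → R < (p.1 * matLog p.1).trace.re
      - (p.1 * specM V fun y => Real.log ((1 - p.2) * b y + p.2 * q)).trace.re})
    fun σ hσ => eventually_nhds_lt_regularised (hCs σ hσ) hV (hR σ hσ) hq
  obtain ⟨u, hu, v, hv, huv⟩ := Filter.mem_prod_iff.1 h
  filter_upwards [hv] with γ hγ σ hσ
  have hm : ((σ, γ) : Matrix κ κ ℂ × ℝ) ∈ u ×ˢ v :=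
    ⟨subset_of_mem_nhdsSet hu hσ, hγ⟩
  have h2 := huv hm
  rw [Set.mem_ofPred_eq] at h2
  exact h2 (hCs σ hσ)

end Regularisation

section Optimiser

variable {κ : Type*} [Fintype κ] [DecidableEq κ]

lemma trace_segment_sq {X Y : Matrix κ κ ℂ} (hX : X.PosDef) (h : X.trace = Y.trace) (t : ℝ) :
    ((X + (t : ℂ) • (Y - X)) * (X + (t : ℂ) • (Y - X)) * X⁻¹).trace.re
      = X.trace.re + t ^ 2 * ((Y - X) * (Y - X) * X⁻¹).trace.re := by
  have hu : IsUnit X.det := (Matrix.isUnit_iff_isUnit_det X).1 hX.isUnit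
  have h0 : (Y - X).trace = 0 := by rw [Matrix.trace_sub, h, sub_self]
  generalize Y - X = Δ at h0 ⊢
  have e : (X + (t : ℂ) • Δ) * (X + (t : ℂ) • Δ) * X⁻¹
      = X + (t : ℂ) • (X * Δ * X⁻¹) + (t : ℂ) • Δ + ((t ^ 2 : ℝ) : ℂ) • (Δ * Δ * X⁻¹) := by
    have h1 : X * X⁻¹ = 1 := Matrix.mul_nonsing_inv X hu
    simp only [Matrix.add_mul, Matrix.mul_add, Matrix.smul_mul, Matrix.mul_smul, smul_smul,
      Matrix.mul_assoc, h1, Matrix.mul_one, smul_add]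
    push_cast
    rw [sq]
    abel
  have h2 : (X * Δ * X⁻¹).trace = 0 := by
    rw [Matrix.trace_mul_comm, ← Matrix.mul_assoc, Matrix.nonsing_inv_mul X hu, Matrix.one_mul, h0]
  rw [e]
  simp only [Matrix.trace_add, Matrix.trace_smul, h2, h0, add_zero, smul_eq_mul,
    Complex.add_re, Complex.re_ofReal_mul, Complex.zero_re, mul_zero]

/-- First-order optimality condition for the minimisation of a relative entropy over a compact
convex set of faithful states. -/
lemma exists_relEnt_optimiser {D : Set (Matrix κ κ ℂ)} (hD : IsCompact D) (hne : D.Nonempty)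
    (hconv : Convex ℝ D) (hDs : ∀ σ ∈ D, σ.PosDef ∧ σ.trace = 1) (K : Matrix κ κ ℂ) :
    ∃ τ ∈ D, ∀ σ ∈ D, (τ * matLog τ).trace.re - (τ * K).trace.re
      ≤ (σ * matLog τ).trace.re - (σ * K).trace.re := by
  have hlsc : LowerSemicontinuousOn
      (fun σ : Matrix κ κ ℂ => (σ * matLog σ).trace.re - (σ * K).trace.re) D := by
    intro σ hσ y hy
    have hc : Continuous fun X : Matrix κ κ ℂ =>
        (X * matLog σ).trace.re - (X * K).trace.re :=
      (continuous_trace_mul _).sub (continuous_trace_mul _)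
    filter_upwards [nhdsWithin_le_nhds ((hc.tendsto σ).eventually (lt_mem_nhds hy)),
      self_mem_nhdsWithin] with X hX hXD
    have h := klein (hDs X hXD).1.posSemidef (hDs σ hσ).1
    rw [(hDs X hXD).2, (hDs σ hσ).2] at h
    linarith
  obtain ⟨τ, hτ, hmin⟩ := hlsc.exists_isMinOn hne hD
  refine ⟨τ, hτ, fun σ hσ => ?_⟩
  obtain ⟨hτp, hτt⟩ := hDs τ hτ
  generalize hc : ((σ - τ) * (σ - τ) * τ⁻¹).trace.re = c
  have key : ∀ t : ℝ, 0 < t → t ≤ 1 → 0 ≤ ((σ * matLog τ).trace.re - (σ * K).trace.re)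
      - ((τ * matLog τ).trace.re - (τ * K).trace.re) + t * c := by
    intro t ht ht1
    have hmem : τ + (t : ℂ) • (σ - τ) ∈ D := by
      have := hconv.add_smul_sub_mem hτ hσ ⟨ht.le, ht1⟩
      convert this using 2
      ext i j
      simp
    have h1 := hmin hmem
    have h2 := klein_reverse (hDs _ hmem).1.posSemidef hτp
    rw [trace_segment_sq hτp (by rw [hτt, (hDs σ hσ).2]), (hDs _ hmem).2, hτt, hc] at h2
    simp only [Set.mem_ofPred_eq] at h1
    have lin : ∀ M : Matrix κ κ ℂ, ((τ + (t : ℂ) • (σ - τ)) * M).trace.re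
        = (τ * M).trace.re + t * ((σ * M).trace.re - (τ * M).trace.re) := by
      intro M
      rw [Matrix.add_mul, Matrix.smul_mul, Matrix.sub_mul, Matrix.trace_add, Matrix.trace_smul,
        Matrix.trace_sub, smul_eq_mul, Complex.add_re, Complex.re_ofReal_mul, Complex.sub_re]
    rw [lin K] at h1
    rw [lin (matLog τ)] at h2
    have h3 : 0 ≤ t * (((σ * matLog τ).trace.re - (σ * K).trace.re)
      - ((τ * matLog τ).trace.re - (τ * K).trace.re) + t * c) := by nlinarith
    exact nonneg_of_mul_nonneg_right h3 ht
  by_contra! hcon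
  generalize hA : ((σ * matLog τ).trace.re - (σ * K).trace.re)
      - ((τ * matLog τ).trace.re - (τ * K).trace.re) = A at key
  have hA0 : A < 0 := by linarith
  have h1 := key 1 one_pos le_rfl
  have hcp : 0 < c := by linarith
  have h2 := key (-A / (2 * c)) (div_pos (by linarith) (by linarith))
    (by rw [div_le_one (by linarith)]; linarith)
  have h3 : -A / (2 * c) * c = -A / 2 := by field_simp
  rw [h3] at h2
  linarith

end Optimiser

section OperatorMonotone

variable {κ : Type*} [Fintype κ] [DecidableEq κ]

open scoped Matrix.Norms.L2Operator MatrixOrder in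
/-- The logarithm is operator monotone. -/
lemma matLog_mono {A B : Matrix κ κ ℂ} (hA : A.PosDef) (hB : B.PosDef)
    (h : (B - A).PosSemidef) : (matLog B - matLog A).PosSemidef := by
  have key : ∀ X : Matrix κ κ ℂ, X.IsHermitian → CFC.log X = matLog X := by
    intro X hX
    rw [CFC.log, matLog_eq hX, hX.cfc_eq, Matrix.IsHermitian.cfc]
    simp [specM, Function.comp_def]
  have h1 : A ≤ B := Matrix.le_iff.2 h
  have h2 := CFC.log_le_log h1 (Matrix.isStrictlyPositive_iff_posDef.2 hA)
  rw [key A hA.1, key B hB.1] at h2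
  exact Matrix.le_iff.1 h2

end OperatorMonotone

section Pinching

variable {κ : Type*} [Fintype κ] [DecidableEq κ]

lemma pinching_le {S : Type*} [Fintype S] (P : S → Matrix κ κ ℂ) (hP : ∀ s, (P s).IsHermitian)
    (h1 : ∑ s, P s = 1) {X : Matrix κ κ ℂ} (hX : X.PosSemidef) :
    (((Fintype.card S : ℝ) : ℂ) • (∑ s, P s * X * P s) - X).PosSemidef := by
  have e : (((Fintype.card S : ℝ) : ℂ) • (∑ s, P s * X * P s) - X)
      = (((1 / 2 : ℝ)) : ℂ) • ∑ s, ∑ t, (P s - P t) * X * (P s - P t) := by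
    have e1 : ∑ s, ∑ t, P s * X * P t = X := by
      simp_rw [← Finset.mul_sum, h1, Matrix.mul_one, ← Finset.sum_mul, h1, Matrix.one_mul]
    have e2 : ∑ s, ∑ t, P t * X * P s = X := by
      rw [Finset.sum_comm]; exact e1
    simp only [Matrix.sub_mul, Matrix.mul_sub, Finset.sum_sub_distrib]
    rw [e1, e2]
    simp only [Finset.sum_const, Finset.card_univ, ← Finset.smul_sum]
    generalize ∑ s, P s * X * P s = Y
    rw [← Nat.cast_smul_eq_nsmul ℂ]
    ext i j
    simp only [Matrix.sub_apply, Matrix.smul_apply, smul_eq_mul]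
    push_cast
    ring
  rw [e]
  refine Matrix.PosSemidef.smul (Matrix.posSemidef_sum _ fun s _ =>
    Matrix.posSemidef_sum _ fun t _ => ?_) (by simp)
  have := hX.mul_mul_conjTranspose_same (P s - P t)
  rwa [((hP s).sub (hP t)).eq] at this

/-- A Hermitian matrix which is block diagonal with respect to the fibres of a function is
diagonalised by a unitary with the same block structure. -/
lemma exists_block_specM {S : Type*} [Fintype S] [DecidableEq S] (β : κ → S) {X : Matrix κ κ ℂ}
    (hX : X.IsHermitian) (h : ∀ x y, β x ≠ β y → X x y = 0) :
    ∃ (W : Matrix κ κ ℂ) (p : κ → ℝ), IsUni W ∧ X = specM W p ∧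
      ∀ x y, β x ≠ β y → W x y = 0 := by
  let e : (Σ s, {x // β x = s}) ≃ κ := Equiv.sigmaFiberEquiv β
  have hβ : ∀ x, (e.symm x).1 = β x := fun x => rfl
  have hM : ∀ s, (X.submatrix (Subtype.val : {x // β x = s} → κ) Subtype.val).IsHermitian :=
    fun s => hX.submatrix _
  let U : ∀ s, Matrix {x // β x = s} {x // β x = s} ℂ := fun s => (hM s).eigenvectorUnitary
  have hU : ∀ s, IsUni (U s) := fun s => isUni_eigenvectorUnitary (hM s)
  have hX' : X.submatrix e e
      = Matrix.blockDiagonal' fun s => X.submatrix (Subtype.val : {x // β x = s} → κ) Subtype.val := by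
    ext ⟨s, x, hx⟩ ⟨t, y, hy⟩
    by_cases hst : s = t
    · subst hst
      rw [Matrix.blockDiagonal'_apply_eq]
      rfl
    · rw [Matrix.blockDiagonal'_apply_ne _ _ _ hst]
      exact h x y (by rw [hx, hy]; exact hst)
  have hspec : X.submatrix e e = specM (Matrix.blockDiagonal' U)
      fun z => (hM z.1).eigenvalues z.2 := by
    rw [hX', specM, Matrix.star_eq_conjTranspose, Matrix.blockDiagonal'_conjTranspose,
      ← Matrix.blockDiagonal'_diagonal fun s x => (((hM s).eigenvalues x : ℝ) : ℂ),
      ← Matrix.blockDiagonal'_mul, ← Matrix.blockDiagonal'_mul]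
    congr 1
    funext s
    exact eq_specM (hM s)
  refine ⟨(Matrix.blockDiagonal' U).submatrix e.symm e.symm,
    fun x => (hM (e.symm x).1).eigenvalues (e.symm x).2, ⟨?_, ?_⟩, ?_, ?_⟩
  · rw [Matrix.star_eq_conjTranspose, Matrix.conjTranspose_submatrix, Matrix.submatrix_mul_equiv,
      Matrix.blockDiagonal'_conjTranspose, ← Matrix.blockDiagonal'_mul]
    have : (fun s => (U s).conjTranspose * U s) = 1 := funext fun s => (hU s).1
    rw [this, Matrix.blockDiagonal'_one, Matrix.submatrix_one_equiv]
  · rw [Matrix.star_eq_conjTranspose, Matrix.conjTranspose_submatrix, Matrix.submatrix_mul_equiv,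
      Matrix.blockDiagonal'_conjTranspose, ← Matrix.blockDiagonal'_mul]
    have : (fun s => U s * (U s).conjTranspose) = 1 := funext fun s => (hU s).2
    rw [this, Matrix.blockDiagonal'_one, Matrix.submatrix_one_equiv]
  · have h2 : X = (X.submatrix e e).submatrix e.symm e.symm := by
      ext x y
      simp
    refine h2.trans ?_
    rw [hspec, specM, specM, Matrix.star_eq_conjTranspose, Matrix.star_eq_conjTranspose,
      Matrix.conjTranspose_submatrix,
      ← Matrix.submatrix_mul_equiv (Matrix.blockDiagonal' U * _) _ e.symm e.symm e.symm,
      ← Matrix.submatrix_mul_equiv (Matrix.blockDiagonal' U) _ e.symm e.symm e.symm,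
      Matrix.submatrix_diagonal_equiv]
    rfl
  · intro x y hxy
    rw [Matrix.submatrix_apply]
    exact Matrix.blockDiagonal'_apply_ne U (e.symm x).2 (e.symm y).2 hxy

/-- Pinching a positive definite matrix with respect to the eigenprojections of `specM V b`. -/
lemma exists_pinched {V : Matrix κ κ ℂ} (hV : IsUni V) (b : κ → ℝ) {X : Matrix κ κ ℂ}
    (hX : X.PosDef) :
    ∃ (U : Matrix κ κ ℂ) (p : κ → ℝ), IsUni U ∧ (∀ x, 0 < p x) ∧ ∑ x, p x = X.trace.re ∧
      ((((Finset.univ.image b).card : ℝ) : ℂ) • specM U p - X).PosSemidef ∧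
      ∀ g : ℝ → ℝ, specM U (fun x => g (b x)) = specM V (fun x => g (b x)) := by
  let S := ↥(Finset.univ.image b)
  let β : κ → S := fun x => ⟨b x, Finset.mem_image_of_mem _ (Finset.mem_univ x)⟩
  have hβ : ∀ x y, β x = β y ↔ b x = b y := fun x y => Subtype.ext_iff
  let Q : S → Matrix κ κ ℂ := fun s => specM V fun x => if β x = s then 1 else 0
  let Y : Matrix κ κ ℂ := Matrix.of fun x y => if β x = β y then (star V * X * V) x y else 0
  have hYe : ∑ s, Q s * X * Q s = V * Y * star V := by
    have h1 : ∀ s, Q s * X * Q s = V * (Matrix.diagonal (fun x => if β x = s then (1 : ℂ) else 0)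
        * (star V * X * V) * Matrix.diagonal (fun x => if β x = s then (1 : ℂ) else 0)) * star V := by
      intro s
      have h2 : Q s = V * Matrix.diagonal (fun x => if β x = s then (1 : ℂ) else 0) * star V := by
        simp only [Q, specM]
        congr 2
        congr 1
        funext x
        split_ifs <;> simp
      rw [h2]
      simp only [Matrix.mul_assoc]
    simp_rw [h1]
    rw [← Finset.sum_mul, ← Finset.mul_sum]
    congr 2
    ext x y
    rw [Matrix.sum_apply]
    simp only [Matrix.mul_diagonal, Matrix.diagonal_mul, Y, Matrix.of_apply]
    generalize (star V * X * V) x y = z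
    simp only [ite_mul, one_mul, zero_mul, mul_ite, mul_one, mul_zero]
    rw [Finset.sum_ite_eq Finset.univ (β y)]
    simp
  have hsum : ∑ s, Q s = 1 := by
    have h1 : ∑ s, Q s = specM V fun x => ∑ s : S, if β x = s then 1 else 0 := by
      simp only [Q, specM]
      rw [← Finset.sum_mul, ← Finset.mul_sum]
      congr 2
      ext x y
      rw [Matrix.sum_apply]
      by_cases hxy : x = y
      · subst hxy; simp
      · simp [Matrix.diagonal_apply_ne _ hxy]
    rw [h1]
    have h2 : (fun x => ∑ s : S, if β x = s then (1 : ℝ) else 0) = fun _ => 1 := by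
      funext x
      exact (Finset.sum_ite_eq Finset.univ (β x) fun _ => (1 : ℝ)).trans (if_pos (Finset.mem_univ _))
    rw [h2, specM_const hV]
    simp
  have hpinch := pinching_le Q (fun s => specM_isHermitian V _) hsum hX.posSemidef
  rw [hYe, Fintype.card_coe] at hpinch
  have hXV : (star V * X * V).IsHermitian := by
    have := hX.posSemidef.conjTranspose_mul_mul_same V
    exact this.1
  have hYH : Y.IsHermitian := by
    ext x y
    rw [Matrix.conjTranspose_apply]
    simp only [Y, Matrix.of_apply]
    by_cases hxy : β x = β y
    · rw [if_pos hxy, if_pos hxy.symm]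
      exact hXV.apply x y
    · rw [if_neg hxy, if_neg (Ne.symm hxy), star_zero]
  obtain ⟨W, p, hW, hYW, hWβ⟩ := exists_block_specM β hYH (fun x y hxy => by
    simp only [Y, Matrix.of_apply, if_neg hxy])
  have hPW : V * Y * star V = specM (V * W) p := by
    rw [hYW]
    simp only [specM, star_mul, Matrix.mul_assoc]
  have hVW : IsUni (V * W) := by
    have h1 : IsUni (star V) := ⟨by rw [star_star]; exact hV.2, by rw [star_star]; exact hV.1⟩
    have := isUni_star_mul h1 hW
    rwa [star_star] at this
  rw [hPW] at hpinch
  have hcard : (0 : ℝ) ≤ ((Finset.univ.image b).card : ℝ) := Nat.cast_nonneg _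
  refine ⟨V * W, p, hVW, ?_, ?_, hpinch, ?_⟩
  · intro x
    have h1 : ((((Finset.univ.image b).card : ℝ) : ℂ) • specM (V * W) p).PosDef := by
      have := hX.add_posSemidef hpinch
      rwa [add_sub_cancel] at this
    rw [specM_smul] at h1
    have h2 := h1.conjTranspose_mul_mul_same (B := V * W) (by
      rw [Matrix.mulVec_injective_iff_isUnit]
      exact ⟨⟨V * W, star (V * W), hVW.2, hVW.1⟩, rfl⟩)
    rw [← Matrix.star_eq_conjTranspose, specM_conj hVW] at h2
    have h3 := h2.diag_pos (i := x)
    rw [Matrix.diagonal_apply_eq] at h3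
    have h4 : 0 < ((Finset.univ.image b).card : ℝ) * p x := by exact_mod_cast h3
    exact pos_of_mul_pos_right h4 hcard
  · rw [← trace_specM hVW, ← hPW, Matrix.trace_mul_comm, ← Matrix.mul_assoc, hV.1, Matrix.one_mul]
    have h1 : Y.trace = (star V * X * V).trace := by
      simp [Y, Matrix.trace]
    rw [h1, Matrix.trace_mul_comm, ← Matrix.mul_assoc, hV.2, Matrix.one_mul]
  · intro g
    have h1 : W * Matrix.diagonal (fun x => ((g (b x) : ℝ) : ℂ))
        = Matrix.diagonal (fun x => ((g (b x) : ℝ) : ℂ)) * W := by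
      ext x y
      rw [Matrix.mul_diagonal, Matrix.diagonal_mul]
      by_cases hxy : β x = β y
      · rw [(hβ x y).1 hxy, mul_comm]
      · rw [hWβ x y hxy, zero_mul, mul_zero]
    unfold specM
    rw [star_mul, Matrix.mul_assoc V, h1]
    calc V * (Matrix.diagonal (fun x => ((g (b x) : ℝ) : ℂ)) * W) * (star W * star V)
        = V * Matrix.diagonal (fun x => ((g (b x) : ℝ) : ℂ)) * (W * star W) * star V := by
          simp only [Matrix.mul_assoc]
      _ = _ := by rw [hW.2, Matrix.mul_one]

end Pinching

section ExponentialTest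

variable {κ : Type*} [Fintype κ] [DecidableEq κ]

/-- The core single-block estimate, for a fixed regularisation parameter `γ`. -/
lemma exists_exponential_test_aux {C : Set (Matrix κ κ ℂ)} (hC : IsCompact C) (hconv : Convex ℝ C)
    (hCs : ∀ σ ∈ C, IsState σ) {q : ℝ} (hq : 0 < q) (hqc : q * Fintype.card κ = 1)
    (hm : (q : ℂ) • (1 : Matrix κ κ ℂ) ∈ C)
    {V : Matrix κ κ ℂ} (hV : IsUni V) {b : κ → ℝ} (hb : ∀ y, 0 ≤ b y) {R : ℝ} {γ : ℝ} (hγ0 : 0 < γ)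
    (hγ1 : γ < 1) (hγ : ∀ σ ∈ C, R < (σ * matLog σ).trace.re
      - (σ * specM V fun y => Real.log ((1 - γ) * b y + γ * q)).trace.re) :
    ∃ (U : Matrix κ κ ℂ) (h : κ → ℝ), IsUni U ∧
      (∀ σ ∈ C, R - Real.log (Finset.univ.image b).card + γ * Real.log (γ * q)
        ≤ (1 - γ) * (σ * specM U h).trace.re) ∧
      (1 - γ) * (specM V b * specM U fun x => Real.exp (h x)).trace.re ≤ 1 := by
  have hγ1' : 0 < 1 - γ := by linarith
  have hcp : ∀ y, γ * q ≤ (1 - γ) * b y + γ * q := fun y => by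
    have := mul_nonneg hγ1'.le (hb y); linarith
  have hγq : 0 < γ * q := mul_pos hγ0 hq
  let φ : Matrix κ κ ℂ → Matrix κ κ ℂ := fun σ =>
    (1 - γ) • σ + γ • ((q : ℂ) • (1 : Matrix κ κ ℂ))
  have hφC : ∀ σ ∈ C, φ σ ∈ C := fun σ hσ => hconv hσ hm hγ1'.le hγ0.le (by ring)
  have hφc : Continuous φ := by fun_prop
  have hφconv : Convex ℝ (φ '' C) := by
    rintro _ ⟨σ, hσ, rfl⟩ _ ⟨σ', hσ', rfl⟩ s t hs ht hst
    refine ⟨s • σ + t • σ', hconv hσ hσ' hs ht hst, ?_⟩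
    obtain rfl : t = 1 - s := by linarith
    simp only [φ]
    generalize (q : ℂ) • (1 : Matrix κ κ ℂ) = m
    module
  have hφpd : ∀ σ ∈ φ '' C, σ.PosDef ∧ σ.trace = 1 := by
    rintro _ ⟨σ, hσ, rfl⟩
    refine ⟨Matrix.PosDef.posSemidef_add ((hCs σ hσ).1.smul hγ1'.le) ?_, (hCs _ (hφC σ hσ)).2⟩
    refine Matrix.PosDef.smul (Matrix.PosDef.smul Matrix.PosDef.one ?_) hγ0
    exact_mod_cast hq
  obtain ⟨τ, hτ, hopt⟩ := exists_relEnt_optimiser (hC.image hφc) ⟨_, _, hm, rfl⟩ hφconv hφpd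
    (specM V fun y => Real.log ((1 - γ) * b y + γ * q))
  have hτC : τ ∈ C := by
    obtain ⟨σ, hσ, rfl⟩ := hτ
    exact hφC σ hσ
  obtain ⟨hτp, hτt⟩ := hφpd τ hτ
  obtain ⟨U, p, hU, hp, hps, hpin, hg⟩ := exists_pinched hV b hτp
  rw [hτt, Complex.one_re] at hps
  have hκ : 0 < ((Finset.univ.image b).card : ℝ) := by
    have : (Finset.univ : Finset κ).Nonempty := by
      by_contra hcon
      rw [Finset.not_nonempty_iff_eq_empty] at hcon
      rw [hcon, Finset.sum_empty] at hps
      exact zero_ne_one hps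
    exact_mod_cast (this.image b).card_pos
  have hlogc := hg fun r => Real.log ((1 - γ) * r + γ * q)
  let h : κ → ℝ := fun x => Real.log (p x) - Real.log ((1 - γ) * b x + γ * q)
  have hH : specM U h = specM U (fun x => Real.log (p x))
      - specM V fun y => Real.log ((1 - γ) * b y + γ * q) := by
    rw [← hlogc, specM_sub]
  have hlogN : matLog ((((Finset.univ.image b).card : ℝ) : ℂ) • specM U p)
      = ((Real.log (Finset.univ.image b).card : ℝ) : ℂ) • 1 + specM U (fun x => Real.log (p x)) := by
    rw [specM_smul, matLog_specM hU, ← specM_const hU, specM_add]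
    congr 1
    funext x
    exact Real.log_mul hκ.ne' (hp x).ne'
  have hNpd : ((((Finset.univ.image b).card : ℝ) : ℂ) • specM U p).PosDef := by
    rw [specM_smul]
    exact specM_posDef hU fun x => mul_pos hκ (hp x)
  have hmono := matLog_mono hτp hNpd hpin
  rw [hlogN] at hmono
  have hD : ∀ σ ∈ φ '' C, R - Real.log (Finset.univ.image b).card ≤ (σ * specM U h).trace.re := by
    intro σ hσ
    obtain ⟨hσp, hσt⟩ := hφpd σ hσ
    have h1 := trace_mul_le hσp.posSemidef hmono
    rw [Matrix.mul_add, Matrix.trace_add, Matrix.mul_smul, Matrix.mul_one, Matrix.trace_smul, hσt,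
      Complex.add_re, smul_eq_mul, mul_one, Complex.ofReal_re] at h1
    have h2 := hopt σ hσ
    have h3 := hγ τ hτC
    rw [hH, Matrix.mul_sub, Matrix.trace_sub, Complex.sub_re]
    linarith
  refine ⟨U, h, hU, fun σ hσ => ?_, ?_⟩
  · have h1 := hD (φ σ) ⟨σ, hσ, rfl⟩
    have h2 : (φ σ * specM U h).trace.re
        = (1 - γ) * (σ * specM U h).trace.re + γ * q * ∑ x, h x := by
      rw [← trace_specM hU]
      simp only [φ, Matrix.add_mul, Matrix.smul_mul, Matrix.trace_add, Matrix.trace_smul,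
        Matrix.one_mul, Complex.add_re, Complex.smul_re, smul_eq_mul, Complex.re_ofReal_mul]
      ring
    have h3 : ∑ x, h x ≤ ∑ _x : κ, -Real.log (γ * q) := by
      refine Finset.sum_le_sum fun x _ => ?_
      have h4 : Real.log (p x) ≤ 0 := by
        refine Real.log_nonpos (hp x).le ?_
        rw [← hps]
        exact Finset.single_le_sum (fun i _ => (hp i).le) (Finset.mem_univ x)
      have h5 := Real.log_le_log hγq (hcp x)
      simp only [h]
      linarith
    rw [Finset.sum_const, Finset.card_univ, nsmul_eq_mul] at h3
    have h4 := mul_le_mul_of_nonneg_left h3 hγq.le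
    have h5 : γ * q * (Fintype.card κ * -Real.log (γ * q)) = - (γ * Real.log (γ * q)) := by
      calc γ * q * (Fintype.card κ * -Real.log (γ * q))
          = - ((q * Fintype.card κ) * (γ * Real.log (γ * q))) := by ring
        _ = _ := by rw [hqc, one_mul]
    linarith
  · have he : ∀ x, Real.exp (h x) = p x / ((1 - γ) * b x + γ * q) := by
      intro x
      have := hcp x
      rw [Real.exp_sub, Real.exp_log (hp x), Real.exp_log (by linarith)]
    have h1 : (specM V (fun y => (1 - γ) * b y + γ * q) * specM U fun x => Real.exp (h x)).trace.re
        = 1 := by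
      rw [← hg fun r => (1 - γ) * r + γ * q, specM_mul hU, trace_specM hU]
      refine Eq.trans ?_ hps
      refine Finset.sum_congr rfl fun x _ => ?_
      have := hcp x
      rw [he, mul_div_cancel₀ _ (by linarith)]
    have h2 : specM V (fun y => (1 - γ) * b y + γ * q)
        = ((1 - γ : ℝ) : ℂ) • specM V b + ((γ * q : ℝ) : ℂ) • 1 := by
      rw [specM_smul, ← specM_const hV, specM_add]
    rw [h2, Matrix.add_mul, Matrix.smul_mul, Matrix.smul_mul, Matrix.trace_add, Matrix.trace_smul,
      Matrix.trace_smul, Matrix.one_mul, smul_eq_mul, smul_eq_mul, Complex.add_re,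
      Complex.re_ofReal_mul, Complex.re_ofReal_mul, trace_specM hU] at h1
    have h3 : 0 ≤ γ * q * ∑ x, Real.exp (h x) :=
      mul_nonneg hγq.le (Finset.sum_nonneg fun x _ => (Real.exp_pos _).le)
    linarith

/-- A single-block exponential test: a Hermitian observable `H = U diag(h) U†` with large
expectation on all of `C`, and with `Tr[ω exp H]` bounded, where `ω = specM V b`. -/
lemma exists_exponential_test [Nonempty κ] {C : Set (Matrix κ κ ℂ)} (hC : IsCompact C)
    (hconv : Convex ℝ C) (hCs : ∀ σ ∈ C, IsState σ)
    (hm : (((Fintype.card κ : ℝ)⁻¹ : ℝ) : ℂ) • (1 : Matrix κ κ ℂ) ∈ C)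
    {V : Matrix κ κ ℂ} (hV : IsUni V) {b : κ → ℝ} (hb : ∀ y, 0 ≤ b y) {R : ℝ}
    (hR : ∀ σ ∈ C, (R : EReal) < relEnt σ (specM V b)) {ζ : ℝ} (hζ : 0 < ζ) :
    ∃ (U : Matrix κ κ ℂ) (h : κ → ℝ), IsUni U ∧
      (∀ σ ∈ C, R - Real.log (Finset.univ.image b).card - ζ ≤ (σ * specM U h).trace.re) ∧
      (specM V b * specM U fun x => Real.exp (h x)).trace.re ≤ Real.exp ζ := by
  have hκ : (0 : ℝ) < Fintype.card κ := by exact_mod_cast Fintype.card_pos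
  generalize hqd : ((Fintype.card κ : ℝ)⁻¹ : ℝ) = q at hm
  have hq : 0 < q := by rw [← hqd]; positivity
  have hqc : q * Fintype.card κ = 1 := by rw [← hqd]; exact inv_mul_cancel₀ hκ.ne'
  generalize hA : R - Real.log (Finset.univ.image b).card = A
  have h1 : ContinuousAt (fun γ : ℝ => (A + (γ * q * Real.log (γ * q)) / q) / (1 - γ)) 0 := by
    refine ContinuousAt.div ?_ (by fun_prop) (by norm_num)
    have : Continuous fun γ : ℝ => γ * q * Real.log (γ * q) :=
      Real.continuous_mul_log.comp (continuous_id.mul continuous_const)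
    exact (continuous_const.add (this.div_const q)).continuousAt
  have h2 : ContinuousAt (fun γ : ℝ => 1 / (1 - γ)) 0 :=
    ContinuousAt.div continuousAt_const (by fun_prop) (by norm_num)
  have e1 : ∀ᶠ γ in 𝓝[>] (0 : ℝ), A - ζ < (A + (γ * q * Real.log (γ * q)) / q) / (1 - γ) :=
    nhdsWithin_le_nhds (h1.tendsto.eventually (lt_mem_nhds (by simpa using hζ)))
  have e2 : ∀ᶠ γ in 𝓝[>] (0 : ℝ), 1 / (1 - γ) < Real.exp ζ :=
    nhdsWithin_le_nhds (h2.tendsto.eventually (gt_mem_nhds (by simpa using hζ)))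
  have e3 : ∀ᶠ γ in 𝓝[>] (0 : ℝ), γ < 1 := nhdsWithin_le_nhds (gt_mem_nhds one_pos)
  obtain ⟨γ, h3, h4, h5, h6, h7⟩ := (e1.and (e2.and (e3.and
    ((eventually_lt_relEnt_regularised hC hCs hV hR hq).and self_mem_nhdsWithin)))).exists
  have h5' : 0 < 1 - γ := by linarith
  obtain ⟨U, h, hU, hU1, hU2⟩ := exists_exponential_test_aux hC hconv hCs hq hqc hm hV hb h7 h5 h6
  refine ⟨U, h, hU, fun σ hσ => ?_, ?_⟩
  · have h8 := hU1 σ hσ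
    rw [hA] at h8
    have h9 : γ * q * Real.log (γ * q) / q = γ * Real.log (γ * q) := by field_simp
    rw [h9, lt_div_iff₀ h5'] at h3
    have h10 : (A - ζ) * (1 - γ) ≤ (σ * specM U h).trace.re * (1 - γ) := by linarith
    exact le_of_mul_le_mul_right h10 h5'
  · refine le_trans ?_ h4.le
    rw [le_div_iff₀ h5']
    linarith

end ExponentialTest

section SeparableCone

open scoped Kronecker

variable {X Y : Type*} [Fintype X] [Fintype Y] [DecidableEq X] [DecidableEq Y]

/-- The cone generated by products of positive semidefinite matrices. -/
def sepCone (X Y : Type*) [Fintype X] [Fintype Y] : AddSubmonoid (Matrix (X × Y) (X × Y) ℂ) :=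
  AddSubmonoid.closure {G | ∃ (P : Matrix X X ℂ) (Q : Matrix Y Y ℂ), P.PosSemidef ∧ Q.PosSemidef ∧
    G = P ⊗ₖ Q}

lemma kronecker_mem_sepCone {P : Matrix X X ℂ} {Q : Matrix Y Y ℂ} (hP : P.PosSemidef)
    (hQ : Q.PosSemidef) : P ⊗ₖ Q ∈ sepCone X Y :=
  AddSubmonoid.subset_closure ⟨P, Q, hP, hQ, rfl⟩

lemma one_mem_sepCone : (1 : Matrix (X × Y) (X × Y) ℂ) ∈ sepCone X Y := by
  rw [← Matrix.one_kronecker_one]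
  exact kronecker_mem_sepCone Matrix.PosSemidef.one Matrix.PosSemidef.one

lemma smul_mem_sepCone {c : ℝ} (hc : 0 ≤ c) {G : Matrix (X × Y) (X × Y) ℂ}
    (hG : G ∈ sepCone X Y) : c • G ∈ sepCone X Y := by
  induction hG using AddSubmonoid.closure_induction with
  | mem G hG =>
    obtain ⟨P, Q, hP, hQ, rfl⟩ := hG
    have : c • (P ⊗ₖ Q) = (c • P) ⊗ₖ Q := by
      rw [Matrix.smul_kronecker]
    rw [this]
    exact kronecker_mem_sepCone (hP.smul hc) hQ
  | zero => rw [smul_zero]; exact zero_mem _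
  | add G G' _ _ h h' => rw [smul_add]; exact add_mem h h'

lemma exists_one_add_smul_posSemidef {P : Matrix X X ℂ} (hP : P.IsHermitian) :
    ∃ c : ℝ, 0 < c ∧ ∀ s : ℝ, |s| ≤ c → (1 + s • P).PosSemidef := by
  refine ⟨(1 + ∑ x, |hP.eigenvalues x|)⁻¹, by positivity, fun s hs => ?_⟩
  have hU := isUni_eigenvectorUnitary hP
  have h1 := eq_specM hP
  have h2 : 1 + s • P = specM (hP.eigenvectorUnitary : Matrix X X ℂ)
      (fun x => 1 + s * hP.eigenvalues x) := by
    conv_lhs => rw [h1]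
    have : ∀ M : Matrix X X ℂ, s • M = (s : ℂ) • M := fun M => by
      ext i j; simp
    rw [this, specM_smul, ← specM_add]
    congr 1
    rw [specM_const hU]
    simp
  rw [h2]
  refine specM_posSemidef _ fun x => ?_
  have h3 : |hP.eigenvalues x| ≤ 1 + ∑ x, |hP.eigenvalues x| := by
    have := Finset.single_le_sum (f := fun x => |hP.eigenvalues x|)
      (fun i _ => abs_nonneg _) (Finset.mem_univ x)
    linarith
  have h4 : |s * hP.eigenvalues x| ≤ 1 := by
    rw [abs_mul]
    calc |s| * |hP.eigenvalues x|
        ≤ (1 + ∑ x, |hP.eigenvalues x|)⁻¹ * (1 + ∑ x, |hP.eigenvalues x|) := by gcongr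
      _ = 1 := inv_mul_cancel₀ (by positivity)
  have := neg_abs_le (s * hP.eigenvalues x)
  linarith

/-- The set of directions in which the identity is interior to the separable cone. -/
def IsSepDirection (M : Matrix (X × Y) (X × Y) ℂ) : Prop :=
  ∃ c : ℝ, 0 < c ∧ ∀ t : ℝ, |t| ≤ c → 1 + t • M ∈ sepCone X Y

lemma IsSepDirection.add {M N : Matrix (X × Y) (X × Y) ℂ} (hM : IsSepDirection M)
    (hN : IsSepDirection N) : IsSepDirection (M + N) := by
  obtain ⟨c, hc, h⟩ := hM
  obtain ⟨d, hd, h'⟩ := hN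
  refine ⟨min c d / 2, by positivity, fun t ht => ?_⟩
  have e : 1 + t • (M + N) = (1 / 2 : ℝ) • (1 + (2 * t) • M) + (1 / 2 : ℝ) • (1 + (2 * t) • N) := by
    module
  have h2 : |2 * t| ≤ min c d := by
    rw [abs_mul, abs_two]; linarith
  rw [e]
  exact add_mem (smul_mem_sepCone (by norm_num) (h _ (h2.trans (min_le_left _ _))))
    (smul_mem_sepCone (by norm_num) (h' _ (h2.trans (min_le_right _ _))))

lemma isSepDirection_kronecker {P : Matrix X X ℂ} {Q : Matrix Y Y ℂ} (hP : P.IsHermitian)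
    (hQ : Q.IsHermitian) : IsSepDirection (P ⊗ₖ Q) := by
  obtain ⟨c, hc, h⟩ := exists_one_add_smul_posSemidef hP
  obtain ⟨d, hd, h'⟩ := exists_one_add_smul_posSemidef hQ
  refine ⟨c * d, by positivity, fun t ht => ?_⟩
  have h3 : |t / c| ≤ d := by
    rw [abs_div, abs_of_pos hc, div_le_iff₀ hc]; linarith
  have h4 : |-(t / c)| ≤ d := by rwa [abs_neg]
  have h5 : |-c| ≤ c := by rw [abs_neg, abs_of_pos hc]
  have e : 1 + t • (P ⊗ₖ Q)
      = (1 / 2 : ℝ) • ((1 + c • P) ⊗ₖ (1 + (t / c) • Q))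
      + (1 / 2 : ℝ) • ((1 + (-c) • P) ⊗ₖ (1 + (-(t / c)) • Q)) := by
    have h6 : t = c * (t / c) := by field_simp
    simp only [Matrix.add_kronecker, Matrix.kronecker_add, Matrix.smul_kronecker,
      Matrix.kronecker_smul, Matrix.one_kronecker_one]
    conv_lhs => rw [h6]
    module
  rw [e]
  exact add_mem (smul_mem_sepCone (by norm_num)
      (kronecker_mem_sepCone (h _ (abs_of_pos hc).le) (h' _ h3)))
    (smul_mem_sepCone (by norm_num) (kronecker_mem_sepCone (h _ h5) (h' _ h4)))

lemma isSepDirection_kronecker_add_conj (M : Matrix X X ℂ) (N : Matrix Y Y ℂ) :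
    IsSepDirection (M ⊗ₖ N + M.conjTranspose ⊗ₖ N.conjTranspose) := by
  have e : M ⊗ₖ N + M.conjTranspose ⊗ₖ N.conjTranspose
      = (M + M.conjTranspose) ⊗ₖ ((1 / 2 : ℝ) • (N + N.conjTranspose))
      + (Complex.I • (M - M.conjTranspose)) ⊗ₖ
          ((1 / 2 : ℝ) • ((-Complex.I) • (N - N.conjTranspose))) := by
    ext ⟨i, j⟩ ⟨k, l⟩
    simp only [Matrix.add_apply, Matrix.kroneckerMap_apply, Matrix.smul_apply,
      Matrix.sub_apply, Matrix.conjTranspose_apply, smul_eq_mul, Complex.real_smul]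
    push_cast
    ring_nf
    rw [Complex.I_sq]
    ring
  rw [e]
  refine (isSepDirection_kronecker ?_ ?_).add (isSepDirection_kronecker ?_ ?_)
  · ext i j; simp [add_comm]
  · ext i j; simp [add_comm]
  · ext i j; simp; ring
  · ext i j; simp; ring

lemma isSepDirection_add_conjTranspose (M : Matrix (X × Y) (X × Y) ℂ) :
    IsSepDirection (M + M.conjTranspose) := by
  induction M using Matrix.induction_on' with
  | h_zero => exact ⟨1, one_pos, fun t _ => by simpa using one_mem_sepCone⟩
  | h_add p q hp hq =>
    have := hp.add hq
    rw [Matrix.conjTranspose_add]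
    convert this using 1
    abel
  | h_std_basis i j x =>
    have := isSepDirection_kronecker_add_conj (Matrix.single i.1 j.1 x) (Matrix.single i.2 j.2 1)
    convert this using 1
    have e : Matrix.single i j x
        = Matrix.single i.1 j.1 x ⊗ₖ Matrix.single i.2 j.2 1 := by
      rw [Matrix.single_kronecker_single, mul_one]
    rw [e]
    congr 1
    rw [Matrix.conjTranspose_kronecker]

lemma isSepDirection_of_isHermitian {M : Matrix (X × Y) (X × Y) ℂ} (hM : M.IsHermitian) :
    IsSepDirection M := by
  have := isSepDirection_add_conjTranspose ((1 / 2 : ℝ) • M)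
  convert this using 1
  rw [Matrix.conjTranspose_smul, hM.eq]
  simp only [star_trivial]
  module

end SeparableCone

section ProductWitness

open scoped Matrix Kronecker

variable {X X' Y Y' : Type*} [Fintype X] [Fintype Y] [Fintype X'] [Fintype Y']
  [DecidableEq X] [DecidableEq Y] [DecidableEq X'] [DecidableEq Y']

/-- The filtered reduction `Tr₁[α (P ⊗ 1)]` of a bipartite matrix. -/
def filterFst (α : Matrix (X × X') (X × X') ℂ) (P : Matrix X X ℂ) : Matrix X' X' ℂ :=
  fun i j => ∑ a, ∑ b, α (a, i) (b, j) * P b a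

lemma trace_filterFst_mul (α : Matrix (X × X') (X × X') ℂ) (P : Matrix X X ℂ)
    (M : Matrix X' X' ℂ) : (filterFst α P * M).trace = (α * P ⊗ₖ M).trace := by
  simp only [Matrix.trace, Matrix.diag_apply, Matrix.mul_apply, filterFst, Finset.sum_mul,
    Fintype.sum_prod_type, Matrix.kroneckerMap_apply]
  calc ∑ i, ∑ j, ∑ a, ∑ b, α (a, i) (b, j) * P b a * M j i
      = ∑ i, ∑ a, ∑ j, ∑ b, α (a, i) (b, j) * P b a * M j i :=
        Finset.sum_congr rfl fun i _ => Finset.sum_comm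
    _ = ∑ a, ∑ i, ∑ j, ∑ b, α (a, i) (b, j) * P b a * M j i := Finset.sum_comm
    _ = ∑ a, ∑ i, ∑ b, ∑ j, α (a, i) (b, j) * P b a * M j i :=
        Finset.sum_congr rfl fun a _ => Finset.sum_congr rfl fun i _ => Finset.sum_comm
    _ = _ := by simp only [mul_assoc]

lemma filterFst_posSemidef {α : Matrix (X × X') (X × X') ℂ} (hα : α.PosSemidef)
    {P : Matrix X X ℂ} (hP : P.PosSemidef) : (filterFst α P).PosSemidef := by
  have hH : (filterFst α P).IsHermitian := by
    ext i j
    simp only [Matrix.conjTranspose_apply, filterFst, star_sum, star_mul']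
    rw [Finset.sum_comm]
    refine Finset.sum_congr rfl fun a _ => Finset.sum_congr rfl fun b _ => ?_
    rw [hα.1.apply, hP.1.apply]
  refine Matrix.PosSemidef.of_dotProduct_mulVec_nonneg hH fun v => ?_
  have h1 : star v ⬝ᵥ filterFst α P *ᵥ v
      = (filterFst α P * Matrix.vecMulVec v (star v)).trace := by
    rw [Matrix.mul_vecMulVec, Matrix.trace_vecMulVec, dotProduct_comm]
  have h2 : 0 ≤ (star v ⬝ᵥ filterFst α P *ᵥ v).re := by
    rw [h1, trace_filterFst_mul]
    exact trace_mul_nonneg hα (hP.kronecker (Matrix.posSemidef_vecMulVec_self_star v))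
  have h3 : (star v ⬝ᵥ filterFst α P *ᵥ v).im = 0 := hH.im_star_dotProduct_mulVec_self v
  rw [Complex.nonneg_iff]
  exact ⟨h2, h3.symm⟩

lemma trace_filterFst_one (α : Matrix (X × X') (X × X') ℂ) :
    (filterFst α 1).trace = α.trace := by
  have := trace_filterFst_mul α 1 1
  rwa [Matrix.mul_one, Matrix.one_kronecker_one, Matrix.mul_one] at this

lemma trace_filterFst (α : Matrix (X × X') (X × X') ℂ) (P : Matrix X X ℂ) :
    (filterFst α P).trace = (filterFst (α.submatrix Prod.swap Prod.swap) 1 * P).trace := by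
  simp only [Matrix.trace, Matrix.diag_apply, Matrix.mul_apply, filterFst, Matrix.submatrix_apply,
    Prod.swap, Matrix.one_apply, mul_ite, mul_one, mul_zero, Finset.sum_ite_eq', Finset.mem_univ,
    if_true, Finset.sum_mul]
  rw [Finset.sum_comm]
  refine Finset.sum_congr rfl fun a _ => ?_
  rw [Finset.sum_comm]
/-- The product of two bipartite matrices, regrouped into a bipartite matrix. -/
def bipartiteMul (G : Matrix (X × Y) (X × Y) ℂ) (G' : Matrix (X' × Y') (X' × Y') ℂ) :
    Matrix ((X × X') × (Y × Y')) ((X × X') × (Y × Y')) ℂ :=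
  fun i j => G (i.1.1, i.2.1) (j.1.1, j.2.1) * G' (i.1.2, i.2.2) (j.1.2, j.2.2)

lemma bipartiteMul_kronecker (P : Matrix X X ℂ) (Q : Matrix Y Y ℂ) (M : Matrix X' X' ℂ)
    (N : Matrix Y' Y' ℂ) :
    bipartiteMul (P ⊗ₖ Q) (M ⊗ₖ N) = (P ⊗ₖ M) ⊗ₖ (Q ⊗ₖ N) := by
  ext i j
  simp only [bipartiteMul, Matrix.kroneckerMap_apply]
  ring

lemma trace_mul_bipartiteMul (α : Matrix (X × X') (X × X') ℂ) (β : Matrix (Y × Y') (Y × Y') ℂ)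
    (P : Matrix X X ℂ) (Q : Matrix Y Y ℂ) (G' : Matrix (X' × Y') (X' × Y') ℂ) :
    (α ⊗ₖ β * bipartiteMul (P ⊗ₖ Q) G').trace
      = (filterFst α P ⊗ₖ filterFst β Q * G').trace := by
  induction G' using Matrix.induction_on' with
  | h_zero =>
    have : bipartiteMul (P ⊗ₖ Q) (0 : Matrix (X' × Y') (X' × Y') ℂ) = 0 := by
      ext i j; simp [bipartiteMul]
    rw [this, Matrix.mul_zero, Matrix.mul_zero, Matrix.trace_zero, Matrix.trace_zero]
  | h_add p q hp hq =>
    have : bipartiteMul (P ⊗ₖ Q) (p + q)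
        = bipartiteMul (P ⊗ₖ Q) p + bipartiteMul (P ⊗ₖ Q) q := by
      ext i j; simp only [bipartiteMul, Matrix.add_apply, mul_add]
    rw [this, Matrix.mul_add, Matrix.mul_add, Matrix.trace_add, Matrix.trace_add, hp, hq]
  | h_std_basis i j x =>
    have e : Matrix.single i j x = Matrix.single i.1 j.1 x ⊗ₖ Matrix.single i.2 j.2 1 := by
      rw [Matrix.single_kronecker_single, mul_one]
    rw [e, bipartiteMul_kronecker, ← Matrix.mul_kronecker_mul, ← Matrix.mul_kronecker_mul,
      Matrix.trace_kronecker, Matrix.trace_kronecker, trace_filterFst_mul, trace_filterFst_mul]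

/-- `Tr[(α ⊗ β) G] ≤ Tr α · Tr β` for all positive semidefinite `α`, `β`. -/
def IsProductBounded (G : Matrix (X × Y) (X × Y) ℂ) : Prop :=
  ∀ (α : Matrix X X ℂ) (β : Matrix Y Y ℂ), α.PosSemidef → β.PosSemidef →
    (α ⊗ₖ β * G).trace.re ≤ α.trace.re * β.trace.re

lemma trace_im_eq_zero {α : Matrix X X ℂ} (hα : α.PosSemidef) : α.trace.im = 0 := by
  have := hα.trace_nonneg
  rw [Complex.nonneg_iff] at this
  exact this.2.symm

lemma isProductBounded_one : IsProductBounded (1 : Matrix (X × Y) (X × Y) ℂ) := by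
  intro α β hα hβ
  rw [Matrix.mul_one, Matrix.trace_kronecker, Complex.mul_re, trace_im_eq_zero hα, zero_mul,
    sub_zero]

lemma IsProductBounded.bipartiteMul {G : Matrix (X × Y) (X × Y) ℂ} (hG : IsProductBounded G)
    (hGs : G ∈ sepCone X Y) {G' : Matrix (X' × Y') (X' × Y') ℂ} (hG' : IsProductBounded G') :
    IsProductBounded (bipartiteMul G G') := by
  intro α β hα hβ
  have h1 : (α ⊗ₖ β * QSanov.bipartiteMul G G').trace.re
      ≤ (filterFst (α.submatrix Prod.swap Prod.swap) 1
        ⊗ₖ filterFst (β.submatrix Prod.swap Prod.swap) 1 * G).trace.re := by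
    clear hG
    induction hGs using AddSubmonoid.closure_induction with
    | mem G hG =>
      obtain ⟨P, Q, hP, hQ, rfl⟩ := hG
      rw [trace_mul_bipartiteMul, ← Matrix.mul_kronecker_mul, Matrix.trace_kronecker,
        ← trace_filterFst, ← trace_filterFst]
      refine (hG' _ _ (filterFst_posSemidef hα hP) (filterFst_posSemidef hβ hQ)).trans ?_
      rw [Complex.mul_re, trace_im_eq_zero (filterFst_posSemidef hα hP), zero_mul, sub_zero]
    | zero =>
      have : QSanov.bipartiteMul (0 : Matrix (X × Y) (X × Y) ℂ) G' = 0 := by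
        ext i j; simp [QSanov.bipartiteMul]
      rw [this, Matrix.mul_zero, Matrix.mul_zero, Matrix.trace_zero, Matrix.trace_zero]
    | add p q _ _ hp hq =>
      have : QSanov.bipartiteMul (p + q) G'
          = QSanov.bipartiteMul p G' + QSanov.bipartiteMul q G' := by
        ext i j; simp only [QSanov.bipartiteMul, Matrix.add_apply, add_mul]
      rw [this, Matrix.mul_add, Matrix.mul_add, Matrix.trace_add, Matrix.trace_add,
        Complex.add_re, Complex.add_re]
      exact add_le_add hp hq
  refine h1.trans ((hG _ _ (filterFst_posSemidef (hα.submatrix _) Matrix.PosSemidef.one)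
    (filterFst_posSemidef (hβ.submatrix _) Matrix.PosSemidef.one)).trans_eq ?_)
  rw [trace_filterFst_one, trace_filterFst_one]
  have e1 := trace_submatrix_equiv' α (Equiv.prodComm X' X)
  have e2 := trace_submatrix_equiv' β (Equiv.prodComm Y' Y)
  exact congrArg₂ (fun x y : ℂ => x.re * y.re) e1 e2

lemma IsProductBounded.submatrix {G : Matrix (X × Y) (X × Y) ℂ} (hG : IsProductBounded G)
    (e : X' ≃ X) (f : Y' ≃ Y) :
    IsProductBounded (G.submatrix (Equiv.prodCongr e f) (Equiv.prodCongr e f)) := by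
  intro α β hα hβ
  have h := hG _ _ (hα.submatrix e.symm) (hβ.submatrix f.symm)
  rw [trace_submatrix_equiv', trace_submatrix_equiv'] at h
  refine le_trans (le_of_eq ?_) h
  have e1 : α ⊗ₖ β = (α.submatrix e.symm e.symm ⊗ₖ β.submatrix f.symm f.symm).submatrix
      (Equiv.prodCongr e f) (Equiv.prodCongr e f) := by
    ext i j
    simp
  rw [e1, Matrix.submatrix_mul_equiv, trace_submatrix_equiv']

end ProductWitness

section Blocks

open scoped Matrix Kronecker

section Power

variable {X Y : Type*} [Fintype X] [Fintype Y] [DecidableEq X] [DecidableEq Y]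

/-- The `m`-fold power of a bipartite matrix, regrouped into a bipartite matrix. -/
def bipartitePow (G : Matrix (X × Y) (X × Y) ℂ) (m : ℕ) :
    Matrix ((Fin m → X) × (Fin m → Y)) ((Fin m → X) × (Fin m → Y)) ℂ :=
  fun i j => ∏ k, G (i.1 k, i.2 k) (j.1 k, j.2 k)

lemma IsProductBounded.bipartitePow {G : Matrix (X × Y) (X × Y) ℂ} (hG : IsProductBounded G)
    (hGs : G ∈ sepCone X Y) (m : ℕ) : IsProductBounded (bipartitePow G m) := by
  induction m with
  | zero =>
    have : QSanov.bipartitePow G 0 = 1 := by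
      ext i j
      obtain rfl : i = j := Subsingleton.elim _ _
      simp [QSanov.bipartitePow]
    rw [this]
    exact isProductBounded_one
  | succ m ih =>
    have := (hG.bipartiteMul hGs ih).submatrix (Fin.consEquiv fun _ => X).symm
      (Fin.consEquiv fun _ => Y).symm
    convert this using 1
    ext i j
    simp only [QSanov.bipartitePow, Fin.prod_univ_succ]
    rfl

end Power

variable {n m k r : ℕ}

/-- Splitting an index of `n` sites into the `r` remaining sites and `m` blocks of `k` sites. -/
def splitIdx (T : Type*) (e : (Fin m × Fin k) ⊕ Fin r ≃ Fin n) :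
    (Fin n → T) ≃ (Fin r → T) × (Fin m → Fin k → T) where
  toFun i := (fun t => i (e (Sum.inr t)), fun b t => i (e (Sum.inl (b, t))))
  invFun p s := Sum.elim (fun q => p.2 q.1 q.2) p.1 (e.symm s)
  left_inv i := by
    funext s
    obtain ⟨s, rfl⟩ := e.surjective s
    rcases s with ⟨b, t⟩ | t <;> simp
  right_inv p := by
    ext <;> simp

variable {ι : Type*} [Fintype ι] [DecidableEq ι]

/-- An operator on `m` blocks, extended by the identity on the remaining sites. -/
def liftBlocks (e : (Fin m × Fin k) ⊕ Fin r ≃ Fin n) (M : MatN (Fin k → ι) m) : MatN ι n :=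
  ((1 : MatN ι r) ⊗ₖ M).submatrix (splitIdx ι e) (splitIdx ι e)

lemma liftBlocks_one (e : (Fin m × Fin k) ⊕ Fin r ≃ Fin n) :
    liftBlocks e (1 : MatN (Fin k → ι) m) = 1 := by
  rw [liftBlocks, Matrix.one_kronecker_one, Matrix.submatrix_one_equiv]

lemma liftBlocks_sub (e : (Fin m × Fin k) ⊕ Fin r ≃ Fin n) (M N : MatN (Fin k → ι) m) :
    liftBlocks e (M - N) = liftBlocks e M - liftBlocks e N := by
  rw [liftBlocks, sub_eq_add_neg, Matrix.kronecker_add]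
  ext i j
  simp [liftBlocks, sub_eq_add_neg]

lemma liftBlocks_smul (e : (Fin m × Fin k) ⊕ Fin r ≃ Fin n) (c : ℂ) (M : MatN (Fin k → ι) m) :
    liftBlocks e (c • M) = c • liftBlocks e M := by
  rw [liftBlocks, Matrix.kronecker_smul]
  rfl

lemma liftBlocks_posSemidef (e : (Fin m × Fin k) ⊕ Fin r ≃ Fin n) {M : MatN (Fin k → ι) m}
    (hM : M.PosSemidef) : (liftBlocks e M).PosSemidef :=
  (Matrix.PosSemidef.one.kronecker hM).submatrix _

lemma trace_tensorPow_mul_liftBlocks (e : (Fin m × Fin k) ⊕ Fin r ≃ Fin n) {ρ : MatC ι}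
    (hρ : ρ.trace = 1) (M : MatN (Fin k → ι) m) :
    (tensorPow ρ n * liftBlocks e M).trace = (tensorPow (tensorPow ρ k) m * M).trace := by
  have h : tensorPow ρ n = (tensorPow ρ r ⊗ₖ tensorPow (tensorPow ρ k) m).submatrix
      (splitIdx ι e) (splitIdx ι e) := by
    ext i j
    simp only [tensorPow, Matrix.submatrix_apply, Matrix.kroneckerMap_apply, splitIdx,
      Equiv.coe_fn_mk]
    rw [← Equiv.prod_comp e, Fintype.prod_sum_type, Fintype.prod_prod_type, mul_comm]
  rw [h, liftBlocks, Matrix.submatrix_mul_equiv, trace_submatrix_equiv', ← Matrix.mul_kronecker_mul,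
    Matrix.trace_kronecker, Matrix.mul_one, trace_tensorPow, hρ, one_pow, one_mul]

variable {α β : Type*} [Fintype α] [Fintype β] [DecidableEq α] [DecidableEq β]

/-- View an operator on `k` copies of `A × B` as bipartite across the cut `A^k : B^k`. -/
def cutMat (G : MatN (α × β) k) :
    Matrix ((Fin k → α) × (Fin k → β)) ((Fin k → α) × (Fin k → β)) ℂ :=
  G.submatrix (Equiv.arrowProdEquivProdArrow (Fin k) (fun _ => α) (fun _ => β)).symm
    (Equiv.arrowProdEquivProdArrow (Fin k) (fun _ => α) (fun _ => β)).symm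

lemma trace_prodStateAB_mul (P : MatN α k) (Q : MatN β k) (G : MatN (α × β) k) :
    (prodStateAB P Q * G).trace = (P ⊗ₖ Q * cutMat G).trace := by
  have h : G = (cutMat G).submatrix
      (Equiv.arrowProdEquivProdArrow (Fin k) (fun _ => α) (fun _ => β))
      (Equiv.arrowProdEquivProdArrow (Fin k) (fun _ => α) (fun _ => β)) := by
    ext i j
    rfl
  conv_lhs => rw [h]
  rw [prodStateAB_eq, Matrix.submatrix_mul_equiv, trace_submatrix_equiv']

lemma cutMat_liftBlocks_tensorPow (e : (Fin m × Fin k) ⊕ Fin r ≃ Fin n) (G : MatN (α × β) k) :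
    cutMat (liftBlocks e (tensorPow G m))
      = (bipartiteMul (1 : Matrix ((Fin r → α) × (Fin r → β)) _ ℂ)
          (bipartitePow (cutMat G) m)).submatrix
        (Equiv.prodCongr (splitIdx α e) (splitIdx β e))
        (Equiv.prodCongr (splitIdx α e) (splitIdx β e)) := by
  ext i j
  simp only [cutMat, liftBlocks, Matrix.submatrix_apply, Matrix.kroneckerMap_apply, bipartiteMul,
    bipartitePow, tensorPow, splitIdx, Equiv.coe_fn_mk, Equiv.prodCongr_apply, Prod.map]
  congr 1
  simp only [Matrix.one_apply]
  congr 1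
  simp only [eq_iff_iff, Prod.mk.injEq, funext_iff]
  simp [Equiv.arrowProdEquivProdArrow, forall_and]

lemma trace_mul_liftBlocks_le (e : (Fin m × Fin k) ⊕ Fin r ≃ Fin n) {G : MatN (α × β) k}
    (hG : IsProductBounded (cutMat G)) (hGs : cutMat G ∈ sepCone (Fin k → α) (Fin k → β))
    {σ : MatN (α × β) n} (hσ : σ ∈ sepSet α β n) :
    (σ * liftBlocks e (tensorPow G m)).trace.re ≤ 1 := by
  refine convexHull_min (t := {σ | (σ * liftBlocks e (tensorPow G m)).trace.re ≤ 1}) ?_ ?_ hσ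
  · rintro _ ⟨P, Q, hP, hQ, rfl⟩
    change (prodStateAB P Q * _).trace.re ≤ 1
    rw [trace_prodStateAB_mul, cutMat_liftBlocks_tensorPow]
    have h := (isProductBounded_one.bipartiteMul one_mem_sepCone
      (hG.bipartitePow hGs m)).submatrix (splitIdx α e) (splitIdx β e)
    refine (h P Q hP.1 hQ.1).trans_eq ?_
    rw [hP.2, hQ.2, Complex.one_re, one_mul]
  · intro σ hσ τ hτ s t hs ht hst
    change (σ * _).trace.re ≤ 1 at hσ
    change (τ * _).trace.re ≤ 1 at hτ
    change ((s • σ + t • τ) * _).trace.re ≤ 1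
    rw [Matrix.add_mul, Matrix.smul_mul, Matrix.smul_mul, Matrix.trace_add, Matrix.trace_smul,
      Matrix.trace_smul, Complex.add_re, Complex.smul_re, Complex.smul_re, smul_eq_mul, smul_eq_mul]
    nlinarith

lemma exists_eq_smul_isState {κ : Type*} [Fintype κ] [DecidableEq κ] {P : Matrix κ κ ℂ}
    (hP : P.PosSemidef) (h0 : P ≠ 0) : ∃ (p : ℝ) (P₀ : Matrix κ κ ℂ), 0 ≤ p ∧ IsState P₀ ∧
      P = (p : ℂ) • P₀ := by
  have h1 : P.trace = (P.trace.re : ℂ) := by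
    apply Complex.ext
    · simp
    · simpa using trace_im_eq_zero hP
  have h2 : P.trace ≠ 0 := fun h => h0 (hP.trace_eq_zero_iff.mp h)
  have h3 : 0 ≤ P.trace.re := (Complex.nonneg_iff.mp hP.trace_nonneg).1
  refine ⟨P.trace.re, P.trace⁻¹ • P, h3, ⟨?_, ?_⟩, ?_⟩
  · refine hP.smul ?_
    rw [h1, ← Complex.ofReal_inv]
    exact_mod_cast inv_nonneg.mpr h3
  · rw [Matrix.trace_smul, smul_eq_mul, inv_mul_cancel₀ h2]
  · rw [← h1, smul_smul, mul_inv_cancel₀ h2, one_smul]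

lemma isProductBounded_cutMat {G : MatN (α × β) k}
    (hG : ∀ σ ∈ sepSet α β k, (σ * G).trace.re ≤ 1) : IsProductBounded (cutMat G) := by
  intro P Q hP hQ
  by_cases hP0 : P = 0
  · simp [hP0]
  by_cases hQ0 : Q = 0
  · simp [hQ0]
  obtain ⟨p, P, hp, hP', rfl⟩ := exists_eq_smul_isState hP hP0
  obtain ⟨q, Q, hq, hQ', rfl⟩ := exists_eq_smul_isState hQ hQ0
  have h := hG _ (subset_convexHull ℝ _ ⟨P, Q, hP', hQ', rfl⟩)
  rw [trace_prodStateAB_mul] at h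
  rw [Matrix.smul_kronecker, Matrix.kronecker_smul, Matrix.smul_mul, Matrix.smul_mul,
    Matrix.trace_smul, Matrix.trace_smul, Matrix.trace_smul, Matrix.trace_smul, hP'.2, hQ'.2,
    smul_eq_mul, smul_eq_mul, smul_eq_mul, smul_eq_mul, Complex.re_ofReal_mul,
    Complex.re_ofReal_mul, Complex.re_ofReal_mul, Complex.re_ofReal_mul, Complex.one_re, mul_one,
    mul_one]
  have := mul_le_mul_of_nonneg_left h (mul_nonneg hp hq)
  linarith

end Blocks

section BlockTest

variable {α β : Type*} [Fintype α] [Fintype β] [DecidableEq α] [DecidableEq β]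

lemma exp_neg_le_one_sub {x : ℝ} (hx : x ≤ 1 / 2) : Real.exp (-x - 2 * x ^ 2) ≤ 1 - x := by
  have h0 : 0 < 1 - x := by linarith
  have h1 : (1 - x)⁻¹ ≤ Real.exp (x + 2 * x ^ 2) := by
    have h2 : (1 - x)⁻¹ = x / (1 - x) + 1 := by field_simp; ring
    have h3 : x / (1 - x) ≤ x + 2 * x ^ 2 := by
      rw [div_le_iff₀ h0]
      nlinarith [sq_nonneg x, mul_nonneg (sq_nonneg x) (by linarith : 0 ≤ 1 - 2 * x)]
    rw [h2]
    exact (Real.add_one_le_exp _).trans (Real.exp_le_exp.mpr h3)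
  rw [show -x - 2 * x ^ 2 = -(x + 2 * x ^ 2) by ring, Real.exp_neg]
  exact inv_le_of_inv_le₀ h0 h1

lemma trace_mul_im_eq_zero {κ : Type*} [Fintype κ] {A B : Matrix κ κ ℂ} (hA : A.IsHermitian)
    (hB : B.IsHermitian) : (A * B).trace.im = 0 := by
  rw [← Complex.conj_eq_iff_im]
  change star (A * B).trace = _
  rw [← Matrix.trace_conjTranspose, Matrix.conjTranspose_mul, hA.eq, hB.eq, Matrix.trace_mul_comm]

lemma pow_re_of_im_eq_zero {z : ℂ} (hz : z.im = 0) (m : ℕ) : (z ^ m).re = z.re ^ m := by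
  obtain ⟨x, rfl⟩ : ∃ x : ℝ, z = x := ⟨z.re, Complex.ext rfl hz⟩
  rw [← Complex.ofReal_pow, Complex.ofReal_re, Complex.ofReal_re]

/-- A witness close to the identity, in the separable cone, normalised on separable states, whose
powers are exponentially large on spectral points with a small empirical mean of `h`. -/
lemma exists_witness {k : ℕ} {U : MatN (α × β) k} (hU : IsUni U) {h : (Fin k → α × β) → ℝ} {c : ℝ}
    (hc : ∀ σ ∈ sepSet α β k, c ≤ (σ * specM U h).trace.re) {ζ : ℝ} (hζ : 0 < ζ) :
    ∃ (δ : ℝ) (g : (Fin k → α × β) → ℝ), 0 < δ ∧ (∀ x, 0 ≤ g x) ∧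
      IsProductBounded (cutMat (specM U g)) ∧
      cutMat (specM U g) ∈ sepCone (Fin k → α) (Fin k → β) ∧
      ∀ (m : ℕ) (y : Fin m → Fin k → α × β), ∑ b, h (y b) < m * (c - ζ) →
        Real.exp (m * δ) ≤ ∏ b, g (y b) := by
  have hHerm : (cutMat (specM U fun x => h x - c)).IsHermitian :=
    (specM_isHermitian U _).submatrix _
  obtain ⟨d, hd, hsep⟩ := isSepDirection_of_isHermitian hHerm
  obtain ⟨Z, hZ0, hZ⟩ : ∃ Z : ℝ, 0 < Z ∧ ∀ x, |h x - c| ≤ Z := by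
    refine ⟨1 + ∑ x, |h x - c|, by positivity, fun x => ?_⟩
    have := Finset.single_le_sum (f := fun x => |h x - c|)
      (fun i _ => abs_nonneg _) (Finset.mem_univ x)
    linarith
  obtain ⟨η, hη, hηd, hηZ, hηζ⟩ : ∃ η : ℝ, 0 < η ∧ η ≤ d ∧ η * Z ≤ 1 / 2 ∧
      2 * η * Z ^ 2 ≤ ζ / 2 := by
    refine ⟨min d (min (1 / 2 / Z) (ζ / 4 / Z ^ 2)), by positivity, min_le_left _ _, ?_, ?_⟩
    · rw [← le_div_iff₀ hZ0]
      exact (min_le_right _ _).trans (min_le_left _ _)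
    · have : min d (min (1 / 2 / Z) (ζ / 4 / Z ^ 2)) * Z ^ 2 ≤ ζ / 4 := by
        rw [← le_div_iff₀ (by positivity)]
        exact (min_le_right _ _).trans (min_le_right _ _)
      linarith
  have hsmall : ∀ x, |η * (h x - c)| ≤ 1 / 2 := fun x => by
    rw [abs_mul, abs_of_pos hη]
    exact (mul_le_mul_of_nonneg_left (hZ x) hη.le).trans hηZ
  have hG : specM U (fun x => 1 - η * (h x - c))
      = 1 + ((-η : ℝ) : ℂ) • specM U fun x => h x - c := by
    rw [specM_smul]
    have h1 := specM_const hU 1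
    rw [Complex.ofReal_one, one_smul] at h1
    rw [← h1, specM_add]
    congr 1
    funext x
    ring
  refine ⟨η * ζ / 2, fun x => 1 - η * (h x - c), by positivity, fun x => ?_, ?_, ?_, ?_⟩
  · have := (le_abs_self _).trans (hsmall x)
    linarith
  · refine isProductBounded_cutMat fun σ hσ => ?_
    have h1 : specM U (fun x => h x - c) = specM U h - (c : ℂ) • 1 := by
      rw [← specM_const hU, specM_sub]
    rw [hG, Matrix.mul_add, Matrix.mul_one, Matrix.trace_add, Matrix.mul_smul, Matrix.trace_smul,
      (isState_of_mem_sepSet hσ).2, smul_eq_mul, Complex.add_re, Complex.re_ofReal_mul, h1,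
      Matrix.mul_sub, Matrix.trace_sub, Matrix.mul_smul, Matrix.mul_one, Matrix.trace_smul,
      (isState_of_mem_sepSet hσ).2, smul_eq_mul, Complex.sub_re, Complex.re_ofReal_mul,
      Complex.one_re, mul_one]
    have := mul_nonneg hη.le (sub_nonneg.mpr (hc σ hσ))
    linarith
  · have h1 := hsep (-η) (by rwa [abs_neg, abs_of_pos hη])
    convert h1 using 1
    rw [hG]
    ext i j
    simp only [cutMat, Matrix.submatrix_apply, Matrix.add_apply, Matrix.smul_apply,
      Complex.real_smul, smul_eq_mul, Matrix.one_apply, EmbeddingLike.apply_eq_iff_eq]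
  · intro m y hy
    calc Real.exp (m * (η * ζ / 2))
        ≤ Real.exp (∑ b, (-(η * (h (y b) - c)) - 2 * (η * (h (y b) - c)) ^ 2)) := by
          rw [Real.exp_le_exp]
          have h1 : ∀ b, -(η * h (y b)) + η * c - η * (ζ / 2)
              ≤ -(η * (h (y b) - c)) - 2 * (η * (h (y b) - c)) ^ 2 := fun b => by
            have h2 : (h (y b) - c) ^ 2 ≤ Z ^ 2 := by
              rw [← sq_abs]
              exact pow_le_pow_left₀ (abs_nonneg _) (hZ _) 2
            have h3 := mul_le_mul_of_nonneg_left h2 (sq_nonneg η)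
            have h4 := mul_le_mul_of_nonneg_left hηζ hη.le
            nlinarith
          refine le_trans ?_ (Finset.sum_le_sum fun b _ => h1 b)
          rw [Finset.sum_sub_distrib, Finset.sum_add_distrib, Finset.sum_neg_distrib,
            ← Finset.mul_sum]
          simp only [Finset.sum_const, Finset.card_univ, Fintype.card_fin, nsmul_eq_mul]
          have := mul_le_mul_of_nonneg_left hy.le hη.le
          linarith
      _ = ∏ b, Real.exp (-(η * (h (y b) - c)) - 2 * (η * (h (y b) - c)) ^ 2) := Real.exp_sum _ _
      _ ≤ ∏ b, (1 - η * (h (y b) - c)) :=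
          Finset.prod_le_prod (fun _ _ => (Real.exp_pos _).le) fun b _ =>
            exp_neg_le_one_sub ((le_abs_self _).trans (hsmall _))

/-- Blockwise threshold test for the empirical mean of an observable `H = U diag(h) U†`. -/
lemma exists_block_test {k : ℕ} {U : MatN (α × β) k} (hU : IsUni U) {h : (Fin k → α × β) → ℝ}
    {c : ℝ} (hc : ∀ σ ∈ sepSet α β k, c ≤ (σ * specM U h).trace.re) {ζ : ℝ} (hζ : 0 < ζ) :
    ∃ δ : ℝ, 0 < δ ∧ ∀ (m r n : ℕ) (_ : (Fin m × Fin k) ⊕ Fin r ≃ Fin n),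
      ∃ E : MatN (α × β) n, E.PosSemidef ∧ (1 - E).PosSemidef ∧
        (∀ σ ∈ sepSet α β n, (σ * (1 - E)).trace.re ≤ Real.exp (-(m * δ))) ∧
        ∀ ρ : MatC (α × β), IsState ρ → (tensorPow ρ n * E).trace.re
          ≤ Real.exp (-(m * (c - ζ)))
            * (tensorPow ρ k * specM U fun x => Real.exp (h x)).trace.re ^ m := by
  obtain ⟨δ, g, hδ, hg0, hgb, hgs, hg⟩ := exists_witness hU hc hζ
  refine ⟨δ, hδ, fun m r n e => ?_⟩
  have hW := isUni_tensorPow hU m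
  let t : (Fin m → Fin k → α × β) → ℝ := fun y => if m * (c - ζ) ≤ ∑ b, h (y b) then 1 else 0
  have hsub : (1 : MatN (Fin k → α × β) m) - specM (tensorPow U m) t
      = specM (tensorPow U m) fun y => 1 - t y := by
    have h1 := specM_const hW 1
    rw [Complex.ofReal_one, one_smul] at h1
    rw [← h1, specM_sub]
  have hE1 : (1 : MatN (α × β) n) - liftBlocks e (specM (tensorPow U m) t)
      = liftBlocks e (specM (tensorPow U m) fun y => 1 - t y) := by
    rw [← hsub, liftBlocks_sub, liftBlocks_one]
  refine ⟨liftBlocks e (specM (tensorPow U m) t), ?_, ?_, fun σ hσ => ?_, fun ρ hρ => ?_⟩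
  · refine liftBlocks_posSemidef e (specM_posSemidef _ fun y => ?_)
    simp only [t]
    split_ifs <;> norm_num
  · rw [hE1]
    refine liftBlocks_posSemidef e (specM_posSemidef _ fun y => ?_)
    simp only [t]
    split_ifs <;> norm_num
  · rw [hE1]
    have h1 : (((Real.exp (-(m * δ)) : ℝ) : ℂ) • liftBlocks e (tensorPow (specM U g) m)
        - liftBlocks e (specM (tensorPow U m) fun y => 1 - t y)).PosSemidef := by
      rw [← liftBlocks_smul, ← liftBlocks_sub, tensorPow_specM, specM_smul, specM_sub]
      refine liftBlocks_posSemidef e (specM_posSemidef _ fun y => ?_)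
      have hp : 0 ≤ ∏ b, g (y b) := Finset.prod_nonneg fun b _ => hg0 _
      simp only [t]
      split_ifs with hy
      · have := mul_nonneg (Real.exp_pos (-(m * δ))).le hp
        linarith
      · have h2 := mul_le_mul_of_nonneg_left (hg m y (not_le.mp hy)) (Real.exp_pos (-(m * δ))).le
        rw [← Real.exp_add, neg_add_cancel, Real.exp_zero] at h2
        linarith
    refine (trace_mul_le (isState_of_mem_sepSet hσ).1 h1).trans ?_
    rw [Matrix.mul_smul, Matrix.trace_smul, smul_eq_mul, Complex.re_ofReal_mul]
    have := mul_le_mul_of_nonneg_left (trace_mul_liftBlocks_le (m := m) e hgb hgs hσ)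
      (Real.exp_pos (-(m * δ))).le
    linarith
  · rw [trace_tensorPow_mul_liftBlocks e hρ.2]
    have h1 : (((Real.exp (-(m * (c - ζ))) : ℝ) : ℂ)
        • tensorPow (specM U fun x => Real.exp (h x)) m
        - specM (tensorPow U m) t).PosSemidef := by
      rw [tensorPow_specM, specM_smul, specM_sub]
      refine specM_posSemidef _ fun y => ?_
      rw [← Real.exp_sum, ← Real.exp_add]
      simp only [t]
      split_ifs with hy
      · have := Real.one_le_exp (by linarith : 0 ≤ -(m * (c - ζ)) + ∑ b, h (y b))
        linarith
      · have := Real.exp_pos (-(m * (c - ζ)) + ∑ b, h (y b))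
        linarith
    refine (trace_mul_le (tensorPow_posSemidef (tensorPow_posSemidef hρ.1 k) m) h1).trans_eq ?_
    rw [Matrix.mul_smul, Matrix.trace_smul, smul_eq_mul, Complex.re_ofReal_mul, ← tensorPow_mul,
      trace_tensorPow, pow_re_of_im_eq_zero]
    exact trace_mul_im_eq_zero (tensorPow_posSemidef hρ.1 k).1 (specM_isHermitian U _)

end BlockTest

section Assembly

variable {α β : Type*} [Fintype α] [Fintype β] [DecidableEq α] [DecidableEq β]

lemma isState_inv_card_smul_one (κ : Type*) [Fintype κ] [DecidableEq κ] [Nonempty κ] :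
    IsState ((((Fintype.card κ : ℝ)⁻¹ : ℝ) : ℂ) • (1 : Matrix κ κ ℂ)) := by
  refine ⟨Matrix.PosSemidef.one.smul (by exact_mod_cast (by positivity)), ?_⟩
  rw [Matrix.trace_smul, Matrix.trace_one, smul_eq_mul]
  push_cast
  exact inv_mul_cancel₀ (by exact_mod_cast Fintype.card_ne_zero)

lemma smul_one_mem_sepSet [Nonempty α] [Nonempty β] (k : ℕ) :
    (((Fintype.card (Fin k → α × β) : ℝ)⁻¹ : ℝ) : ℂ) • (1 : MatN (α × β) k) ∈ sepSet α β k := by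
  refine subset_convexHull ℝ _ ⟨_, _, isState_inv_card_smul_one (Fin k → α),
    isState_inv_card_smul_one (Fin k → β), ?_⟩
  ext i j
  have h : (i = j) ↔ ((fun t => (i t).1) = fun t => (j t).1) ∧
      ((fun t => (i t).2) = fun t => (j t).2) := by
    simp only [funext_iff, Prod.ext_iff, forall_and]
  simp only [prodStateAB, Matrix.smul_apply, Matrix.one_apply, h]
  by_cases h1 : (fun t => (i t).1) = fun t => (j t).1
  · by_cases h2 : (fun t => (i t).2) = fun t => (j t).2
    · simp [h1, h2, mul_pow, mul_comm]
    · simp [h2]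
  · simp [h1]

lemma le_negLog {x s : ℝ} (h : x ≤ Real.exp (-s)) : ((s : ℝ) : EReal) ≤ negLog x := by
  unfold negLog
  split_ifs with hx
  · exact le_top
  · rw [EReal.coe_le_coe_iff]
    have := Real.log_le_log (not_le.mp hx) h
    rw [Real.log_exp] at this
    linarith

/-- Exponential decay along blocks of length `k` at rate `s` per block bounds the Stein exponent. -/
lemma le_steinExponent_of_blocks {ι : Type*} [Fintype ι] [DecidableEq ι]
    {A B : ∀ n : ℕ, Set (MatN ι n)} {k : ℕ} (hk : 0 < k) {s : ℝ}
    (h : ∀ ε : ℝ, 0 < ε → ∀ᶠ m : ℕ in atTop, ∀ r n, n = m * k + r →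
      typeII (A n) (B n) ε ≤ Real.exp (-(m * s))) :
    ((s / k : ℝ) : EReal) ≤ steinExponent A B := by
  refine le_iInf₂ fun ε hε => ?_
  have hk' : (0 : ℝ) < k := by exact_mod_cast hk
  have h1 : Tendsto (fun n : ℕ => (n / k : ℕ)) atTop atTop :=
    Nat.tendsto_div_const_atTop hk.ne'
  have h2 : ∀ᶠ n : ℕ in atTop, (((n : ℝ)⁻¹ * ((n / k : ℕ) * s) : ℝ) : EReal)
      ≤ cFrac n * negLog (typeII (A n) (B n) ε) := by
    filter_upwards [h1.eventually (h ε hε.1)] with n hn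
    have h3 := le_negLog (hn (n % k) n (Nat.div_add_mod' n k).symm)
    have h0 : (0 : EReal) ≤ cFrac n := by
      unfold cFrac
      exact_mod_cast inv_nonneg.mpr (n.cast_nonneg (α := ℝ))
    rw [EReal.coe_mul]
    exact mul_le_mul_of_nonneg_left h3 h0
  have h4 : Tendsto (fun n : ℕ => (n : ℝ)⁻¹ * ((n / k : ℕ) * s)) atTop (𝓝 (s / k)) := by
    have h5 := ((tendsto_nat_floor_mul_div_atTop (R := ℝ) (inv_nonneg.mpr hk'.le)).comp
      tendsto_natCast_atTop_atTop).mul_const s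
    have e : (k : ℝ)⁻¹ * s = s / k := by ring
    rw [e] at h5
    refine h5.congr fun n => ?_
    simp only [Function.comp]
    rw [inv_mul_eq_div, Nat.floor_div_eq_div]
    ring
  have h6 : Tendsto (fun n : ℕ => (((n : ℝ)⁻¹ * ((n / k : ℕ) * s) : ℝ) : EReal)) atTop
      (𝓝 ((s / k : ℝ) : EReal)) := (continuous_coe_real_ereal.tendsto _).comp h4
  rw [← h6.liminf_eq]
  exact liminf_le_liminf h2

/-- The polynomial overhead, in logarithmic scale, of a block of `k` copies. -/
def logOverhead (ι : Type*) [Fintype ι] (Z : ℝ) (k : ℕ) : ℝ :=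
  Real.log (symDim ι k) + Real.log (Z * (((k : ℝ) + 1) ^ 2 * symDim ι k))

lemma symDim_pos (ι : Type*) [Fintype ι] (k : ℕ) : (0 : ℝ) < symDim ι k := by
  unfold symDim
  positivity

lemma logOverhead_isLittleO (ι : Type*) [Fintype ι] {Z : ℝ} (hZ : 0 < Z) :
    (fun k => logOverhead ι Z k) =o[atTop] fun k : ℕ => (k : ℝ) := by
  obtain ⟨D, hD⟩ : ∃ D : ℕ, D = Fintype.card ι * Fintype.card ι := ⟨_, rfl⟩
  have h1 : ∀ k : ℕ, logOverhead ι Z k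
      = (2 * Real.log 2 + Real.log Z) + (2 * D + 2) * Real.log ((k : ℝ) + 1) := by
    intro k
    have h2 : (0 : ℝ) < (k : ℝ) + 1 := by positivity
    have h3 : (symDim ι k : ℝ) = 2 * ((k : ℝ) + 1) ^ D := by
      rw [symDim, hD]; push_cast; ring
    have h4 : ((k : ℝ) + 1) ^ D ≠ 0 := by positivity
    rw [logOverhead, h3, Real.log_mul hZ.ne' (by positivity),
      Real.log_mul (pow_ne_zero 2 h2.ne') (by positivity), Real.log_mul two_ne_zero h4,
      Real.log_pow, Real.log_pow]
    push_cast
    ring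
  simp only [h1]
  have ht : Tendsto (fun k : ℕ => (k : ℝ) + 1) atTop atTop :=
    tendsto_atTop_add_const_right _ _ tendsto_natCast_atTop_atTop
  have h5 : (fun k : ℕ => Real.log ((k : ℝ) + 1)) =o[atTop] fun k : ℕ => (k : ℝ) := by
    refine (Real.isLittleO_log_id_atTop.comp_tendsto ht).trans_isBigO ?_
    refine Asymptotics.IsBigO.of_bound 2 ?_
    filter_upwards [eventually_ge_atTop 1] with k hk
    have : (1 : ℝ) ≤ k := by exact_mod_cast hk
    simp only [Function.comp, id, Real.norm_eq_abs]
    rw [abs_of_nonneg (by positivity), abs_of_nonneg (by positivity)]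
    linarith
  refine Asymptotics.IsLittleO.add ?_ (h5.const_mul_left _)
  rw [Asymptotics.isLittleO_const_left]
  right
  exact tendsto_norm_atTop_atTop.comp tendsto_natCast_atTop_atTop

/-- Single-letter-type achievability bound from blocks of length `k`. -/
lemma sub_logOverhead_div_le_steinExponent [Nonempty α] [Nonempty β] {F : Set (MatC (α × β))}
    (hF : ∀ ρ ∈ F, IsState ρ) {μ : Measure ↥F} [IsProbabilityMeasure μ] {Z : ℝ} (hZ : 0 < Z)
    {k : ℕ} (hk : 0 < k)
    (hμ : ∀ ρ ∈ F, ∀ E : MatN (α × β) k, E.PosSemidef → (tensorPow ρ k * E).trace.re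
      ≤ Z * (((k : ℝ) + 1) ^ 2 * symDim (α × β) k) * (iidMix μ k * E).trace.re) {R : ℝ}
    (hR : (R : EReal) < ⨅ σ ∈ sepSet α β k, relEnt σ (iidMix μ k)) :
    (((R - logOverhead (α × β) Z k) / k : ℝ) : EReal)
      ≤ steinExponent (sepSet α β) (iidSet F) := by
  have hk' : (0 : ℝ) < k := by exact_mod_cast hk
  obtain ⟨P, hPd⟩ : ∃ P, P = Z * (((k : ℝ) + 1) ^ 2 * symDim (α × β) k) := ⟨_, rfl⟩
  have hP : 0 < P := by
    have := symDim_pos (α × β) k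
    rw [hPd]; positivity
  have key : ∀ ζ : ℝ, 0 < ζ → (((R - logOverhead (α × β) Z k - 3 * ζ) / k : ℝ) : EReal)
      ≤ steinExponent (sepSet α β) (iidSet F) := by
    intro ζ hζ
    obtain ⟨V, b, hV, hb, hω, -, -⟩ := exists_spec (isState_iidMix μ hF k).1
    have hR' : ∀ σ ∈ sepSet α β k, (R : EReal) < relEnt σ (specM V b) := fun σ hσ => by
      rw [← hω]
      exact hR.trans_le (iInf₂_le σ hσ)
    have hN : (Finset.univ.image b).card ≤ symDim (α × β) k := by
      refine card_image_le_symDim hV fun π => ?_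
      rw [← hω]
      exact permCopies_iidMix μ k π
    obtain ⟨U, h, hU, hU1, hU2⟩ := exists_exponential_test (isCompact_sepSet k)
      (convex_convexHull ℝ _) (fun σ hσ => isState_of_mem_sepSet hσ) (smul_one_mem_sepSet k)
      hV hb hR' hζ
    have hlogN : Real.log (Finset.univ.image b).card ≤ Real.log (symDim (α × β) k) := by
      refine Real.log_le_log ?_ (by exact_mod_cast hN)
      exact_mod_cast (Finset.univ_nonempty.image b).card_pos
    obtain ⟨c, hc⟩ : ∃ c, c = R - Real.log (symDim (α × β) k) - ζ := ⟨_, rfl⟩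
    have hU1' : ∀ σ ∈ sepSet α β k, c ≤ (σ * specM U h).trace.re := fun σ hσ => by
      have := hU1 σ hσ
      linarith
    obtain ⟨δ, hδ, htest⟩ := exists_block_test hU hU1' hζ
    refine le_steinExponent_of_blocks hk fun ε hε => ?_
    have hlim : Tendsto (fun m : ℕ => Real.exp (-(m * δ))) atTop (𝓝 0) :=
      Real.tendsto_exp_neg_atTop_nhds_zero.comp
        (tendsto_natCast_atTop_atTop.atTop_mul_const hδ)
    filter_upwards [hlim.eventually (gt_mem_nhds hε)] with m hm r n hn
    obtain ⟨E, hE, hE1, h1, h2⟩ := htest m r n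
      (((finProdFinEquiv.sumCongr (Equiv.refl _)).trans finSumFinEquiv).trans (finCongr hn.symm))
    refine typeII_le ?_ (Real.exp_pos _).le E hE hE1 (fun σ hσ => (h1 σ hσ).trans hm.le) ?_
    · rintro _ ⟨ρ, hρ, rfl⟩
      exact tensorPow_isState (hF ρ hρ) n
    · rintro _ ⟨ρ, hρ, rfl⟩
      refine (h2 ρ (hF ρ hρ)).trans ?_
      have hexp : (specM U fun x => Real.exp (h x)).PosSemidef :=
        specM_posSemidef _ fun x => (Real.exp_pos _).le
      have h3 : (tensorPow ρ k * specM U fun x => Real.exp (h x)).trace.re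
          ≤ Real.exp (Real.log P + ζ) := by
        refine (hμ ρ hρ _ hexp).trans ?_
        rw [Real.exp_add, Real.exp_log hP, ← hPd, hω]
        exact mul_le_mul_of_nonneg_left hU2 hP.le
      have h4 := trace_mul_nonneg (tensorPow_posSemidef (hF ρ hρ).1 k) hexp
      calc _ ≤ Real.exp (-(m * (c - ζ))) * Real.exp (Real.log P + ζ) ^ m :=
            mul_le_mul_of_nonneg_left (pow_le_pow_left₀ h4 h3 m) (Real.exp_pos _).le
        _ = _ := by
            rw [← Real.exp_nat_mul, ← Real.exp_add, hc, logOverhead, ← hPd]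
            congr 1
            ring
  have hlim : Tendsto (fun ζ : ℝ => (((R - logOverhead (α × β) Z k - 3 * ζ) / k : ℝ) : EReal))
      (𝓝[>] 0) (𝓝 (((R - logOverhead (α × β) Z k) / k : ℝ) : EReal)) := by
    refine (continuous_coe_real_ereal.tendsto _).comp (Tendsto.mono_left ?_ nhdsWithin_le_nhds)
    have hcont : Continuous fun ζ : ℝ => (R - logOverhead (α × β) Z k - 3 * ζ) / k := by fun_prop
    have := hcont.tendsto 0
    rwa [mul_zero, sub_zero] at this
  exact le_of_tendsto hlim (eventually_nhdsWithin_of_forall key)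

lemma limsup_le_steinExponent [Nonempty α] [Nonempty β] {F : Set (MatC (α × β))}
    (hF : ∀ ρ ∈ F, IsState ρ) {μ : Measure ↥F} [IsProbabilityMeasure μ] {Z : ℝ} (hZ : 0 < Z)
    (hμ : ∀ k : ℕ, ∀ ρ ∈ F, ∀ E : MatN (α × β) k, E.PosSemidef → (tensorPow ρ k * E).trace.re
      ≤ Z * (((k : ℝ) + 1) ^ 2 * symDim (α × β) k) * (iidMix μ k * E).trace.re) :
    limsup (fun k => cFrac k * ⨅ σ ∈ sepSet α β k, relEnt σ (iidMix μ k)) atTop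
      ≤ steinExponent (sepSet α β) (iidSet F) := by
  refine le_of_forall_gt_imp_ge_of_dense fun x hx => ?_
  obtain ⟨y, hy1, hy2⟩ := EReal.lt_iff_exists_real_btwn.1 hx
  obtain ⟨z, hz1, hz2⟩ := EReal.lt_iff_exists_real_btwn.1 hy2
  obtain ⟨w, hw1, hw2⟩ := EReal.lt_iff_exists_real_btwn.1 hz1
  rw [EReal.coe_lt_coe_iff] at hw1 hw2
  refine limsup_le_of_le (h := ?_)
  filter_upwards [(logOverhead_isLittleO (α × β) hZ).bound (sub_pos.mpr hw1),
    eventually_gt_atTop 0] with k hk hk0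
  refine le_trans ?_ hz2.le
  have hk' : (0 : ℝ) < k := by exact_mod_cast hk0
  by_contra! hcon
  have h1 : ((k * w : ℝ) : EReal) < ⨅ σ ∈ sepSet α β k, relEnt σ (iidMix μ k) := by
    refine lt_of_lt_of_le (b := ((k * z : ℝ) : EReal)) ?_ ?_
    · rw [EReal.coe_lt_coe_iff]
      exact mul_lt_mul_of_pos_left hw2 hk'
    · by_contra! h
      exact lt_asymm hcon ((cFrac_mul_lt hk0).mpr h)
  have h2 := (sub_logOverhead_div_le_steinExponent hF hZ hk0 (hμ k) h1).trans_lt hy1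
  rw [EReal.coe_lt_coe_iff, div_lt_iff₀ hk'] at h2
  rw [Real.norm_eq_abs, Real.norm_eq_abs, abs_of_pos hk'] at hk
  have := le_abs_self (logOverhead (α × β) Z k)
  linarith

lemma steinExponent_sepSet_le_liminf {F : Set (MatC (α × β))} (hF : ∀ ρ ∈ F, IsState ρ)
    (μ : Measure ↥F) [IsProbabilityMeasure μ] :
    steinExponent (sepSet α β) (iidSet F)
      ≤ liminf (fun n => cFrac n * ⨅ σ ∈ sepSet α β n, relEnt σ (iidMix μ n)) atTop := by
  refine steinExponent_le_liminf (isState_iidMix μ hF)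
    (fun n σ hσ => isState_of_mem_sepSet hσ) fun n E _ hE1 => ?_
  refine re_trace_iidMix_mul_le μ hF n E fun ρ hρ => le_csSup ⟨1, ?_⟩ ⟨_, ⟨ρ, hρ, rfl⟩, rfl⟩
  rintro _ ⟨_, ⟨τ, hτ, rfl⟩, rfl⟩
  exact trace_mul_le_one (tensorPow_isState (hF τ hτ) n) hE1

end Assembly

/-- **Entanglement testing, i.i.d. alternative.**
`Stein(𝒮‖𝒻₁^{iid}) = min*_{μ∈𝒫(𝒻₁)} lim_n (1/n) inf_{σ∈𝒮_{Aⁿ:Bⁿ}} D(σ‖∫dμ(ρ) ρ^{⊗n})`. -/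
theorem entanglement_testing_iid (dA dB : ℕ)
    (F1 : Set (MatC (Fin dA × Fin dB)))
    (hF_states : ∀ ρ ∈ F1, IsState ρ)
    (hF_ne : F1.Nonempty) (hF_closed : IsClosed F1) :
    ∃ S : EReal,
      steinExponent (sepSet (Fin dA) (Fin dB)) (iidSet F1) = S ∧
      (∃ μ : Measure ↥F1, IsProbabilityMeasure μ ∧
        Filter.Tendsto
          (fun n : ℕ => cFrac n * ⨅ σ ∈ sepSet (Fin dA) (Fin dB) n, relEnt σ (iidMix μ n))
          Filter.atTop (nhds S)) ∧
      (∀ μ : Measure ↥F1, IsProbabilityMeasure μ → ∀ L : EReal,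
        Filter.Tendsto
          (fun n : ℕ => cFrac n * ⨅ σ ∈ sepSet (Fin dA) (Fin dB) n, relEnt σ (iidMix μ n))
          Filter.atTop (nhds L) → S ≤ L) := by
  have hne : Nonempty (Fin dA × Fin dB) := by
    obtain ⟨ρ, hρ⟩ := hF_ne
    by_contra h
    rw [not_nonempty_iff] at h
    have := (hF_states ρ hρ).2
    rw [Matrix.trace, Finset.univ_eq_empty, Finset.sum_empty] at this
    exact zero_ne_one this
  obtain ⟨hA, hB⟩ := nonempty_prod.mp hne
  have hcpt : IsCompact F1 := isCompact_isState.of_isClosed_subset hF_closed hF_states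
  obtain ⟨μ, hμ, Z, hZ, hdom⟩ := exists_universal_measure hF_states hF_ne hcpt
  refine ⟨_, rfl, ⟨μ, hμ, ?_⟩, fun ν _ L hL => ?_⟩
  · exact tendsto_of_le_liminf_of_limsup_le (steinExponent_sepSet_le_liminf hF_states μ)
      (limsup_le_steinExponent hF_states hZ hdom)
  · rw [← hL.liminf_eq]
    exact steinExponent_sepSet_le_liminf hF_states ν

end QSanov
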